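/- Fix a constant C₀ ≥ 1. There exists a constant C (depending only on C₀) such that the following holds for all sufficiently large N. Let L be a set of N² lines in ℝ³ such that: (a) no point of ℝ³ is incident to more than C₀·N lines of L; (b) no affine plane contains more than C₀·N lines of L; and (c) for every nonzero real polynomial f in three variables of total degree at most 2, at most C₀·N lines of L are contained in the zero set of f. For l ∈ L let ν(l) denote the number of lines l' ∈ L, with l' ≠ l, that intersect l. Then Σ_{l ∈ L} ν(l)² ≤ C · N⁴ · (log N)³. -/

import Mathlib

open scoped Classical

/-- A line in `ℝ³`: a one-dimensional affine subspace, as a set of points. -/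
def IsLine (l : Set (Fin 3 → ℝ)) : Prop :=
  ∃ p v : Fin 3 → ℝ, v ≠ 0 ∧ l = {x | ∃ t : ℝ, x = p + t • v}

/-- An affine plane in `ℝ³`: the solution set of a nontrivial linear equation. -/
def IsPlane (π : Set (Fin 3 → ℝ)) : Prop :=
  ∃ (f : Fin 3 → ℝ) (c : ℝ), f ≠ 0 ∧ π = {x | ∑ i, f i * x i = c}

section MixedParity

/-- The product of the sums of parities of consecutive entries, modulo two. -/
def altProd : List ℕ → ZMod 2
  | [] => 1
  | [_] => 1
  | a :: b :: t => ((a : ZMod 2) + b) * altProd (b :: t)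

/-- Sum of `φ` over the lists obtained from a list by deleting one entry. -/
def faceSum {α : Type*} : (List α → ZMod 2) → List α → ZMod 2
  | _, [] => 0
  | φ, a :: l => φ l + faceSum (fun m => φ (a :: m)) l

theorem faceSum_mul_left {α : Type*} (c : ZMod 2) (φ : List α → ZMod 2) (l : List α) :
    faceSum (fun m => c * φ m) l = c * faceSum φ l := by
  induction l generalizing φ with
  | nil => simp [faceSum]
  | cons a l ih => simp only [faceSum]; rw [ih]; ring

theorem faceSum_altProd_cons (a : ℕ) (l : List ℕ) (hl : l ≠ []) :
    faceSum (fun m => altProd (a :: m)) l = altProd l := by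
  induction l generalizing a with
  | nil => exact absurd rfl hl
  | cons b t ih =>
    cases t with
    | nil => simp [faceSum, altProd]
    | cons c u =>
      have h := ih b (by simp)
      rw [faceSum]
      have : (fun m => altProd (a :: b :: m))
          = fun m => ((a : ZMod 2) + b) * altProd (b :: m) := by
        funext m; simp [altProd]
      rw [this, faceSum_mul_left, h]
      simp only [altProd]
      have h2 : (a : ZMod 2) + a = 0 := CharTwo.add_self_eq_zero _
      linear_combination (altProd (c :: u)) * h2

/-- Parity of the first entry times `altProd`. -/
def headProd : List ℕ → ZMod 2
  | [] => 0
  | a :: t => (a : ZMod 2) * altProd (a :: t)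

theorem faceSum_headProd (l : List ℕ) (hl : 2 ≤ l.length) :
    faceSum headProd l = altProd l := by
  match l, hl with
  | a :: b :: t, _ =>
    rw [faceSum]
    have : (fun m => headProd (a :: m)) = fun m => (a : ZMod 2) * altProd (a :: m) := rfl
    rw [this, faceSum_mul_left, faceSum_altProd_cons a _ (by simp)]
    simp only [headProd, altProd]
    ring

theorem faceSum_perm {α : Type*} {l l' : List α} (h : l.Perm l') (φ : List α → ZMod 2)
    (hφ : ∀ m m' : List α, m.Perm m' → φ m = φ m') : faceSum φ l = faceSum φ l' := by
  induction h generalizing φ with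
  | nil => rfl
  | cons a h ih =>
    simp only [faceSum]
    rw [hφ _ _ h, ih _ (fun m m' hm => hφ _ _ (hm.cons a))]
  | swap a b l =>
    simp only [faceSum]
    have : (fun m => φ (a :: b :: m)) = fun m => φ (b :: a :: m) := by
      funext m; exact hφ _ _ (List.Perm.swap _ _ _)
    rw [this]; ring
  | trans _ _ ih1 ih2 => rw [ih1 φ hφ, ih2 φ hφ]

theorem faceSum_congr {α : Type*} (φ ψ : List α → ZMod 2) (l : List α)
    (h : ∀ m, m.Sublist l → φ m = ψ m) : faceSum φ l = faceSum ψ l := by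
  induction l generalizing φ ψ with
  | nil => rfl
  | cons a l ih =>
    simp only [faceSum]
    rw [h l (List.sublist_cons_self a l), ih _ _ (fun m hm => h _ (hm.cons_cons a))]

theorem faceSum_map {α β : Type*} (g : α → β) (φ : List β → ZMod 2) (l : List α) :
    faceSum φ (l.map g) = faceSum (fun m => φ (m.map g)) l := by
  induction l generalizing φ with
  | nil => rfl
  | cons a l ih => simp only [List.map_cons, faceSum]; rw [ih]

theorem insertionSort_eq_of_perm {l l' : List ℕ} (h : l.Perm l') :
    l.insertionSort (· ≤ ·) = l'.insertionSort (· ≤ ·) :=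
  (((List.perm_insertionSort _ l).trans h).trans
    (List.perm_insertionSort _ l').symm).eq_of_pairwise'
      (List.pairwise_insertionSort _ l) (List.pairwise_insertionSort _ l')

theorem insertionSort_of_pairwise {l : List ℕ} (h : l.Pairwise (· ≤ ·)) :
    l.insertionSort (· ≤ ·) = l :=
  (List.perm_insertionSort _ l).eq_of_pairwise' (List.pairwise_insertionSort _ l) h

theorem faceSum_headProd_sort (l : List ℕ) (hl : 2 ≤ l.length) :
    faceSum (fun m => headProd (m.insertionSort (· ≤ ·))) l
      = altProd (l.insertionSort (· ≤ ·)) := by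
  rw [faceSum_perm (List.perm_insertionSort (· ≤ ·) l).symm _
    (fun m m' h => by rw [insertionSort_eq_of_perm h])]
  rw [faceSum_congr _ headProd]
  · exact faceSum_headProd _ (by simpa using hl)
  · intro m hm
    rw [insertionSort_of_pairwise ((List.pairwise_insertionSort (· ≤ ·) l).sublist hm)]

/-- Change of sign of a label: the labels `2 * j` and `2 * j + 1` are opposite. -/
def flipLabel (a : ℕ) : ℕ := if a % 2 = 0 then a + 1 else a - 1

theorem flipLabel_cast (a : ℕ) : ((flipLabel a : ℕ) : ZMod 2) = (a : ZMod 2) + 1 := by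
  unfold flipLabel
  split_ifs with h
  · push_cast; ring
  · have : a = (a - 1) + 1 := by omega
    conv_rhs => rw [this]
    push_cast
    have h2 : (1 : ZMod 2) + 1 = 0 := by decide
    linear_combination - h2

theorem altProd_map_flip (l : List ℕ) : altProd (l.map flipLabel) = altProd l := by
  match l with
  | [] => rfl
  | [_] => rfl
  | a :: b :: t =>
    have ih := altProd_map_flip (b :: t)
    simp only [List.map_cons] at ih
    simp only [List.map_cons, altProd, ih, flipLabel_cast]
    have h2 : (1 : ZMod 2) + 1 = 0 := by decide
    linear_combination (altProd (b :: t)) * h2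

/-- No two opposite labels occur in the list. -/
def NoOpposite (l : List ℕ) : Prop := ∀ a ∈ l, ∀ b ∈ l, a / 2 = b / 2 → a = b

theorem headProd_sort_flip (l : List ℕ) (hl : l ≠ []) (h : NoOpposite l) :
    headProd (l.insertionSort (· ≤ ·)) + headProd ((l.map flipLabel).insertionSort (· ≤ ·))
      = altProd (l.insertionSort (· ≤ ·)) := by
  have h1 : (l.map flipLabel).insertionSort (· ≤ ·)
      = (l.insertionSort (· ≤ ·)).map flipLabel := by
    rw [insertionSort_eq_of_perm (((List.perm_insertionSort (· ≤ ·) l).map flipLabel).symm)]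
    apply insertionSort_of_pairwise
    rw [List.pairwise_map]
    have h2 := List.pairwise_insertionSort (· ≤ ·) l
    refine h2.imp_of_mem ?_
    intro a b ha hb hab
    rw [List.mem_insertionSort] at ha hb
    have h3 := h a ha b hb
    unfold flipLabel
    split_ifs <;> omega
  rw [h1]
  have hne : l.insertionSort (· ≤ ·) ≠ [] := by
    intro h0
    have := congrArg List.length h0
    simp at this
    exact hl this
  obtain ⟨a, t, hat⟩ := List.exists_cons_of_ne_nil hne
  rw [hat]
  have h5 := altProd_map_flip (a :: t)
  simp only [List.map_cons] at h5
  simp only [List.map_cons, headProd, h5, flipLabel_cast]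
  have h2 : (a : ZMod 2) + a = 0 := CharTwo.add_self_eq_zero _
  linear_combination (altProd (a :: t)) * h2

/-- A sorted list without opposite labels and with non-zero alternating product has strictly
increasing label classes. -/
theorem pairwise_lt_of_altProd_ne_zero (l : List ℕ) (hs : l.Pairwise (· ≤ ·)) (h : NoOpposite l)
    (hW : altProd l ≠ 0) : l.Pairwise (fun a b => a / 2 < b / 2) := by
  match l with
  | [] => simp
  | [_] => simp
  | a :: b :: t =>
    simp only [altProd] at hW
    have hW1 : (a : ZMod 2) + b ≠ 0 := left_ne_zero_of_mul hW
    have hW2 := right_ne_zero_of_mul hW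
    have ih := pairwise_lt_of_altProd_ne_zero (b :: t) hs.of_cons
      (fun x hx y hy => h x (List.mem_cons_of_mem _ hx) y (List.mem_cons_of_mem _ hy)) hW2
    have hab : a ≠ b := by
      rintro rfl; exact hW1 (CharTwo.add_self_eq_zero _)
    have hab2 : a / 2 < b / 2 := by
      have h1 : a ≤ b := (List.pairwise_cons.1 hs).1 b (by simp)
      have h2 : a / 2 ≠ b / 2 := fun h3 => hab (h a (by simp) b (by simp) h3)
      omega
    refine List.pairwise_cons.2 ⟨?_, ih⟩
    intro c hc
    rcases List.mem_cons.1 hc with rfl | hc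
    · exact hab2
    · exact hab2.trans ((List.pairwise_cons.1 ih).1 c hc)

end MixedParity

section Chains

variable {E : Type*}

/-- Prepend a vertex to every simplex of a chain. -/
noncomputable def coneChain (v : E) : (List E →₀ ZMod 2) →ₗ[ZMod 2] (List E →₀ ZMod 2) :=
  Finsupp.lmapDomain _ _ (List.cons v)

/-- The boundary of a simplex, as a chain modulo two. -/
noncomputable def faces : List E → (List E →₀ ZMod 2)
  | [] => 0
  | v :: l => Finsupp.single l 1 + coneChain v (faces l)

/-- The boundary operator on chains modulo two. -/
noncomputable def bdry : (List E →₀ ZMod 2) →ₗ[ZMod 2] (List E →₀ ZMod 2) :=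
  Finsupp.linearCombination _ faces

/-- The extension of a function on simplices to chains. -/
noncomputable def chainSum (φ : List E → ZMod 2) : (List E →₀ ZMod 2) →ₗ[ZMod 2] ZMod 2 :=
  Finsupp.linearCombination _ φ

theorem coneChain_single (v : E) (l : List E) (a : ZMod 2) :
    coneChain v (Finsupp.single l a) = Finsupp.single (v :: l) a := by
  simp [coneChain]

theorem bdry_single (l : List E) : bdry (Finsupp.single l 1) = faces l := by
  simp [bdry]

theorem chainSum_single (φ : List E → ZMod 2) (l : List E) :
    chainSum φ (Finsupp.single l 1) = φ l := by
  simp [chainSum]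

theorem bdry_coneChain (v : E) (c : List E →₀ ZMod 2) :
    bdry (coneChain v c) = c + coneChain v (bdry c) := by
  have : bdry ∘ₗ coneChain v = LinearMap.id + coneChain v ∘ₗ bdry := by
    refine Finsupp.lhom_ext' fun l => LinearMap.ext_ring ?_
    simp [coneChain_single, bdry_single, faces]
  exact LinearMap.congr_fun this c

theorem add_self_chain (c : List E →₀ ZMod 2) : c + c = 0 := by
  ext l; simpa using CharTwo.add_self_eq_zero (c l)

theorem bdry_faces (l : List E) : bdry (faces l) = 0 := by
  induction l with
  | nil => simp [faces]
  | cons v l ih =>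
    simp only [faces, map_add, bdry_single, bdry_coneChain, ih, map_zero, add_zero]
    exact add_self_chain _

theorem chainSum_coneChain (φ : List E → ZMod 2) (v : E) (c : List E →₀ ZMod 2) :
    chainSum φ (coneChain v c) = chainSum (fun l => φ (v :: l)) c := by
  have : chainSum φ ∘ₗ coneChain v = chainSum (fun l => φ (v :: l)) := by
    refine Finsupp.lhom_ext' fun l => LinearMap.ext_ring ?_
    simp [coneChain_single, chainSum_single]
  exact LinearMap.congr_fun this c

theorem chainSum_faces (φ : List E → ZMod 2) (l : List E) :
    chainSum φ (faces l) = faceSum φ l := by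
  induction l generalizing φ with
  | nil => simp [faces, faceSum]
  | cons v l ih => simp [faces, faceSum, chainSum_single, chainSum_coneChain, ih]

/-- The chains all of whose simplices satisfy a given property. -/
noncomputable def chainsIn (S : Set (List E)) : Submodule (ZMod 2) (List E →₀ ZMod 2) :=
  Finsupp.supported (ZMod 2) (ZMod 2) S

theorem single_mem_chainsIn {S : Set (List E)} {l : List E} (h : l ∈ S) :
    Finsupp.single l (1 : ZMod 2) ∈ chainsIn S :=
  Finsupp.single_mem_supported _ _ h

theorem chainsIn_mono {S T : Set (List E)} (h : S ⊆ T) : chainsIn S ≤ chainsIn T :=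
  Finsupp.supported_mono h

/-- A linear map sends chains in `S` to a submodule when it does so for simplices in `S`. -/
theorem map_mem_of_chainsIn {M : Type*} [AddCommMonoid M] [Module (ZMod 2) M]
    {S : Set (List E)} {V : Submodule (ZMod 2) M}
    (f : (List E →₀ ZMod 2) →ₗ[ZMod 2] M) (h : ∀ l ∈ S, f (Finsupp.single l 1) ∈ V)
    {c : List E →₀ ZMod 2} (hc : c ∈ chainsIn S) : f c ∈ V := by
  have : chainsIn S ≤ V.comap f := by
    rw [chainsIn, Finsupp.supported_eq_span_single, Submodule.span_le]
    rintro _ ⟨l, hl, rfl⟩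
    exact h l hl
  exact this hc

theorem eq_of_chainsIn {M : Type*} [AddCommMonoid M] [Module (ZMod 2) M]
    {S : Set (List E)} (f g : (List E →₀ ZMod 2) →ₗ[ZMod 2] M)
    (h : ∀ l ∈ S, f (Finsupp.single l 1) = g (Finsupp.single l 1))
    {c : List E →₀ ZMod 2} (hc : c ∈ chainsIn S) : f c = g c := by
  have : chainsIn S ≤ LinearMap.eqLocus f g := by
    rw [chainsIn, Finsupp.supported_eq_span_single, Submodule.span_le]
    rintro _ ⟨l, hl, rfl⟩
    exact h l hl
  exact this hc

theorem faces_mem (l : List E) {S : Set (List E)}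
    (h : ∀ m : List E, m.Sublist l → m.length + 1 = l.length → m ∈ S) : faces l ∈ chainsIn S := by
  induction l generalizing S with
  | nil => simp [faces]
  | cons v l ih =>
    refine Submodule.add_mem _ (single_mem_chainsIn (h l (by simp) (by simp))) ?_
    refine map_mem_of_chainsIn (S := {m | v :: m ∈ S}) (coneChain v) ?_ (ih ?_)
    · intro m hm
      rw [coneChain_single]
      exact single_mem_chainsIn hm
    · intro m hm hl
      exact h _ (hm.cons_cons v) (by simp [hl])

/-- The map on chains induced by a map on vertices. -/
noncomputable def mapChain {E' : Type*} (g : E → E') :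
    (List E →₀ ZMod 2) →ₗ[ZMod 2] (List E' →₀ ZMod 2) :=
  Finsupp.lmapDomain _ _ (List.map g)

theorem mapChain_single {E' : Type*} (g : E → E') (l : List E) (a : ZMod 2) :
    mapChain g (Finsupp.single l a) = Finsupp.single (l.map g) a := by
  simp [mapChain]

theorem mapChain_coneChain {E' : Type*} (g : E → E') (v : E) (c : List E →₀ ZMod 2) :
    mapChain g (coneChain v c) = coneChain (g v) (mapChain g c) := by
  have : mapChain g ∘ₗ coneChain v = coneChain (g v) ∘ₗ mapChain g := by
    refine Finsupp.lhom_ext' fun l => LinearMap.ext_ring ?_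
    simp [coneChain_single, mapChain_single]
  exact LinearMap.congr_fun this c

theorem mapChain_faces {E' : Type*} (g : E → E') (l : List E) :
    mapChain g (faces l) = faces (l.map g) := by
  induction l with
  | nil => simp [faces]
  | cons v l ih => simp [faces, mapChain_single, mapChain_coneChain, ih]

theorem mapChain_bdry {E' : Type*} (g : E → E') (c : List E →₀ ZMod 2) :
    mapChain g (bdry c) = bdry (mapChain g c) := by
  have : mapChain g ∘ₗ bdry = bdry ∘ₗ mapChain g := by
    refine Finsupp.lhom_ext' fun l => LinearMap.ext_ring ?_
    simp [bdry_single, mapChain_single, mapChain_faces]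
  exact LinearMap.congr_fun this c

end Chains

section Subdivision

variable {E : Type*} [NormedAddCommGroup E] [NormedSpace ℝ E]

/-- The barycenter of a list of points. -/
noncomputable def barycenter (l : List E) : E := ((l.length : ℝ)⁻¹) • l.sum

theorem barycenter_map_neg (l : List E) :
    barycenter (l.map (fun x => -x)) = -barycenter l := by
  have : (l.map (fun x => -x)).sum = -l.sum := by
    induction l with
    | nil => simp
    | cons a l ih => simp [ih, add_comm]
  simp [barycenter, this]

theorem sum_mem_smul_convex {K : Set E} (hK : Convex ℝ K) (l : List E) (h : ∀ x ∈ l, x ∈ K)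
    (hl : l ≠ []) : ∃ y ∈ K, l.sum = (l.length : ℝ) • y := by
  induction l with
  | nil => exact absurd rfl hl
  | cons a l ih =>
    by_cases h0 : l = []
    · subst h0; exact ⟨a, h a (by simp), by simp⟩
    obtain ⟨y, hy, hs⟩ := ih (fun x hx => h x (by simp [hx])) h0
    have hpos : (0 : ℝ) < (l.length : ℝ) + 1 := by positivity
    refine ⟨(1 / ((l.length : ℝ) + 1)) • a + ((l.length : ℝ) / ((l.length : ℝ) + 1)) • y,
      hK (h a (by simp)) hy (by positivity) (by positivity) (by field_simp; ring), ?_⟩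
    simp only [List.sum_cons, List.length_cons, hs, smul_add, smul_smul]
    push_cast
    rw [mul_one_div_cancel hpos.ne', mul_div_cancel₀ _ hpos.ne', one_smul]

theorem barycenter_mem {K : Set E} (hK : Convex ℝ K) (l : List E) (h : ∀ x ∈ l, x ∈ K)
    (hl : l ≠ []) : barycenter l ∈ K := by
  obtain ⟨y, hy, hs⟩ := sum_mem_smul_convex hK l h hl
  have : (l.length : ℝ) ≠ 0 := by simpa using hl
  rw [barycenter, hs, smul_smul, inv_mul_cancel₀ this, one_smul]
  exact hy

theorem norm_sum_sub_le (l : List E) (x : E) (d : ℝ) (h : ∀ y ∈ l, dist y x ≤ d) :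
    ‖l.sum - (l.length : ℝ) • x‖ ≤ l.length * d := by
  induction l with
  | nil => simp
  | cons a l ih =>
    have h1 := ih (fun y hy => h y (by simp [hy]))
    have h2 := h a (by simp)
    rw [dist_eq_norm] at h2
    have : (a :: l).sum - (((a :: l).length : ℕ) : ℝ) • x
        = (a - x) + (l.sum - (l.length : ℝ) • x) := by
      simp only [List.sum_cons, List.length_cons]; push_cast; module
    rw [this]
    refine (norm_add_le _ _).trans ?_
    simp only [List.length_cons]; push_cast; linarith

theorem dist_barycenter_le (l : List E) (d : ℝ) (h : ∀ x ∈ l, ∀ y ∈ l, dist x y ≤ d)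
    (x : E) (hx : x ∈ l) : dist (barycenter l) x ≤ (1 - (l.length : ℝ)⁻¹) * d := by
  obtain ⟨l₁, l₂, rfl⟩ := List.append_of_mem hx
  have h1 := norm_sum_sub_le (l₁ ++ l₂) x d (fun y hy => h y (by
    simp only [List.mem_append, List.mem_cons] at hy ⊢; tauto) x hx)
  set n := ((l₁ ++ x :: l₂).length : ℝ) with hn
  have hn' : n = ((l₁ ++ l₂).length : ℝ) + 1 := by
    rw [hn]; simp only [List.length_append, List.length_cons]; push_cast; ring
  have hpos : 0 < n := by rw [hn']; positivity
  have : barycenter (l₁ ++ x :: l₂) - x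
      = n⁻¹ • ((l₁ ++ l₂).sum - ((l₁ ++ l₂).length : ℝ) • x) := by
    have h3 : (((l₁ ++ l₂).length : ℕ) : ℝ) = n - 1 := by rw [hn']; ring
    rw [barycenter, ← hn, h3]
    have hx' : n⁻¹ • (n • x) = x := by rw [smul_smul, inv_mul_cancel₀ hpos.ne', one_smul]
    have hs : (l₁ ++ x :: l₂).sum = (l₁ ++ l₂).sum + x := by
      simp only [List.sum_append, List.sum_cons]; abel
    rw [hs, sub_smul, one_smul, smul_sub, smul_sub, hx', smul_add]
    abel
  rw [dist_eq_norm, this, norm_smul, Real.norm_eq_abs, abs_of_pos (inv_pos.2 hpos)]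
  refine (mul_le_mul_of_nonneg_left h1 (inv_pos.2 hpos).le).trans (le_of_eq ?_)
  rw [hn']; field_simp; ring

/-- Barycentric subdivision of chains whose simplices have `n` vertices. -/
noncomputable def subdiv : ℕ → (List E →₀ ZMod 2) →ₗ[ZMod 2] (List E →₀ ZMod 2)
  | 0 => LinearMap.id
  | n + 1 => Finsupp.linearCombination _
      (fun l => coneChain (barycenter l) (subdiv n (faces l)))

theorem subdiv_zero : subdiv (E := E) 0 = LinearMap.id := by
  rw [subdiv]

theorem subdiv_succ_single (n : ℕ) (l : List E) :
    subdiv (n + 1) (Finsupp.single l 1) = coneChain (barycenter l) (subdiv n (faces l)) := by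
  simp [subdiv]

theorem bdry_subdiv_of_single (n : ℕ)
    (h : ∀ l : List E, l.length = n + 1 → bdry (subdiv n (faces l)) = 0)
    {c : List E →₀ ZMod 2} (hc : c ∈ chainsIn {l | l.length = n + 1}) :
    bdry (subdiv (n + 1) c) = subdiv n (bdry c) := by
  rw [← LinearMap.comp_apply, ← LinearMap.comp_apply]
  refine eq_of_chainsIn _ _ ?_ hc
  intro l hl
  rw [LinearMap.comp_apply, LinearMap.comp_apply, subdiv_succ_single, bdry_coneChain,
    h l hl, map_zero, add_zero, bdry_single]

theorem bdry_subdiv (n : ℕ) {c : List E →₀ ZMod 2} (hc : c ∈ chainsIn {l | l.length = n + 1}) :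
    bdry (subdiv (n + 1) c) = subdiv n (bdry c) := by
  induction n generalizing c with
  | zero =>
    refine bdry_subdiv_of_single 0 (fun l _ => ?_) hc
    rw [subdiv_zero, LinearMap.id_apply, bdry_faces]
  | succ n ih =>
    refine bdry_subdiv_of_single (n + 1) (fun l hl => ?_) hc
    rw [ih, bdry_faces, map_zero]
    exact faces_mem l fun m _ hm => by simp only [Set.mem_ofPred_eq]; omega

theorem mapChain_neg_subdiv (n : ℕ) (c : List E →₀ ZMod 2) :
    mapChain (fun x => -x) (subdiv n c) = subdiv n (mapChain (fun x => -x) c) := by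
  induction n generalizing c with
  | zero => simp [subdiv]
  | succ n ih =>
    have : mapChain (fun x : E => -x) ∘ₗ subdiv (n + 1)
        = subdiv (n + 1) ∘ₗ mapChain (fun x : E => -x) := by
      refine Finsupp.lhom_ext' fun l => LinearMap.ext_ring ?_
      simp only [LinearMap.comp_apply, Finsupp.lsingle_apply]
      rw [subdiv_succ_single, mapChain_single, subdiv_succ_single, mapChain_coneChain, ih,
        mapChain_faces, barycenter_map_neg]
    exact LinearMap.congr_fun this c

/-- Simplices with `n` vertices, contained in `K` and of diameter at most `d`. -/
def smallSimplices (n : ℕ) (K : Set E) (d : ℝ) : Set (List E) :=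
  {l | l.length = n ∧ (∀ x ∈ l, x ∈ K) ∧ ∀ x ∈ l, ∀ y ∈ l, dist x y ≤ d}

theorem subdiv_mem (n : ℕ) {d : ℝ} (hd : 0 ≤ d) (l : List E)
    (hl : l ∈ smallSimplices n Set.univ d) :
    subdiv n (Finsupp.single l 1) ∈
      chainsIn (smallSimplices n (convexHull ℝ {x | x ∈ l}) ((1 - (n : ℝ)⁻¹) * d)) := by
  induction n generalizing l with
  | zero =>
    obtain ⟨h1, -, -⟩ := hl
    obtain rfl := List.length_eq_zero_iff.1 h1
    exact single_mem_chainsIn ⟨rfl, by simp, by simp⟩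
  | succ n ih =>
    obtain ⟨h1, -, h3⟩ := hl
    have hne : l ≠ [] := by rintro rfl; simp at h1
    rw [subdiv_succ_single]
    have hn1 : (1 - ((n + 1 : ℕ) : ℝ)⁻¹) * d ≥ 0 := by
      refine mul_nonneg ?_ hd
      rw [sub_nonneg]; apply inv_le_one_of_one_le₀; simp
    have hball : ∀ x ∈ convexHull ℝ {x | x ∈ l},
        dist x (barycenter l) ≤ (1 - ((n + 1 : ℕ) : ℝ)⁻¹) * d := by
      intro x hx
      have : convexHull ℝ {x | x ∈ l} ⊆
          Metric.closedBall (barycenter l) ((1 - ((n + 1 : ℕ) : ℝ)⁻¹) * d) := by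
        refine convexHull_min ?_ (convex_closedBall _ _)
        intro y hy
        rw [Metric.mem_closedBall, dist_comm, ← h1]
        exact dist_barycenter_le l d h3 y hy
      exact this hx
    have key : subdiv n (faces l) ∈ chainsIn (smallSimplices n (convexHull ℝ {x | x ∈ l})
        ((1 - ((n + 1 : ℕ) : ℝ)⁻¹) * d)) := by
      refine map_mem_of_chainsIn (S := {m | m.Sublist l ∧ m.length + 1 = l.length})
        (subdiv n) ?_ (faces_mem l fun m h h' => ⟨h, h'⟩)
      rintro m ⟨hm, hlen⟩
      have hmn : m.length = n := by omega
      refine chainsIn_mono ?_ (ih m ⟨hmn, by simp, fun x hx y hy =>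
        h3 x (hm.subset hx) y (hm.subset hy)⟩)
      rintro k ⟨k1, k2, k3⟩
      refine ⟨k1, fun x hx => convexHull_mono (fun y hy => hm.subset hy) (k2 x hx),
        fun x hx y hy => ?_⟩
      have hnpos : 0 < n := by
        rcases Nat.eq_zero_or_pos n with h0 | h0
        · subst h0; rw [List.length_eq_zero_iff] at k1; subst k1; simp at hx
        · exact h0
      refine (k3 x hx y hy).trans (mul_le_mul_of_nonneg_right ?_ hd)
      have : ((n + 1 : ℕ) : ℝ)⁻¹ ≤ (n : ℝ)⁻¹ :=
        inv_anti₀ (by exact_mod_cast hnpos) (by push_cast; linarith)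
      linarith
    refine map_mem_of_chainsIn (coneChain (barycenter l)) ?_ key
    rintro m ⟨m1, m2, m3⟩
    rw [coneChain_single]
    refine single_mem_chainsIn ⟨by simp [m1], ?_, ?_⟩
    · intro x hx
      rcases List.mem_cons.1 hx with rfl | hx
      · exact barycenter_mem (convex_convexHull ℝ _) l (fun y hy => subset_convexHull ℝ _ hy) hne
      · exact m2 x hx
    · intro x hx y hy
      rcases List.mem_cons.1 hx with rfl | hx <;> rcases List.mem_cons.1 hy with rfl | hy
      · simpa using hn1
      · rw [dist_comm]; exact hball _ (m2 y hy)
      · exact hball _ (m2 x hx)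
      · exact m3 x hx y hy

theorem subdiv_iterate_mem {𝒦 : Set (Set E)} (h𝒦 : ∀ K ∈ 𝒦, Convex ℝ K) (n : ℕ) {d : ℝ}
    (hd : 0 ≤ d) (j : ℕ) {c : List E →₀ ZMod 2}
    (hc : c ∈ chainsIn {l | ∃ K ∈ 𝒦, l ∈ smallSimplices n K d}) :
    (subdiv n)^[j] c ∈
      chainsIn {l | ∃ K ∈ 𝒦, l ∈ smallSimplices n K ((1 - (n : ℝ)⁻¹) ^ j * d)} := by
  have hn0 : 0 ≤ 1 - (n : ℝ)⁻¹ := by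
    rw [sub_nonneg]
    rcases Nat.eq_zero_or_pos n with rfl | h0
    · simp
    · exact inv_le_one_of_one_le₀ (by exact_mod_cast h0)
  induction j with
  | zero => simpa using hc
  | succ j ih =>
    rw [Function.iterate_succ_apply']
    refine map_mem_of_chainsIn (subdiv n) ?_ ih
    rintro l ⟨K, hK, l1, l2, l3⟩
    refine chainsIn_mono ?_ (subdiv_mem n (mul_nonneg (pow_nonneg hn0 j) hd) l
      ⟨l1, by simp, l3⟩)
    rintro m ⟨m1, m2, m3⟩
    refine ⟨K, hK, m1, fun x hx => convexHull_min l2 (h𝒦 K hK) (m2 x hx), fun x hx y hy => ?_⟩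
    refine (m3 x hx y hy).trans (le_of_eq (by ring))

end Subdivision

section BorsukUlam

theorem exists_ne_zero_of_chainSum_ne_zero {E : Type*} {S : Set (List E)} {φ : List E → ZMod 2}
    {c : List E →₀ ZMod 2} (hc : c ∈ chainsIn S) (h : chainSum φ c ≠ 0) : ∃ l ∈ S, φ l ≠ 0 := by
  by_contra! hcon
  refine h ?_
  have := eq_of_chainsIn (chainSum φ) 0 (fun l hl => by
    rw [chainSum_single, hcon l hl, LinearMap.zero_apply]) hc
  simpa using this

/-- The alternation functional takes the value one on each of a sequence of antipodal chains. -/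
theorem chainSum_altProd_eq_one {E : Type*} (neg : E → E) (label : E → ℕ) (U : Set E)
    (hflip : ∀ x ∈ U, label (neg x) = flipLabel (label x)) (c : ℕ → List E →₀ ZMod 2) (m : ℕ)
    (hc : ∀ k ≤ m, c k ∈
      chainsIn {l | l.length = k + 1 ∧ (∀ x ∈ l, x ∈ U) ∧ NoOpposite (l.map label)})
    (hb : ∀ k < m, bdry (c (k + 1)) = c k + mapChain neg (c k))
    (e : E) (h0 : c 0 = Finsupp.single [e] 1) (k : ℕ) (hk : k ≤ m) :
    chainSum (fun l => altProd ((l.map label).insertionSort (· ≤ ·))) (c k) = 1 := by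
  induction k with
  | zero => rw [h0, chainSum_single]; simp [altProd]
  | succ k ih =>
    rw [← ih (by omega)]
    set G : List E → ZMod 2 := fun l => headProd ((l.map label).insertionSort (· ≤ ·)) with hG
    have h1 : chainSum (fun l => altProd ((l.map label).insertionSort (· ≤ ·))) (c (k + 1))
        = chainSum G (bdry (c (k + 1))) := by
      rw [← LinearMap.comp_apply (chainSum G)]
      refine eq_of_chainsIn _ _ ?_ (hc (k + 1) hk)
      rintro l ⟨hl, -, -⟩
      rw [chainSum_single, LinearMap.comp_apply, bdry_single, chainSum_faces,
        ← faceSum_headProd_sort _ (by rw [List.length_map]; omega), faceSum_map]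
    have h2 : chainSum G (c k + mapChain neg (c k))
        = chainSum (fun l => altProd ((l.map label).insertionSort (· ≤ ·))) (c k) := by
      have := eq_of_chainsIn (chainSum G + chainSum G ∘ₗ mapChain neg)
        (chainSum (fun l => altProd ((l.map label).insertionSort (· ≤ ·)))) ?_ (hc k (by omega))
      · rw [map_add, ← this, LinearMap.add_apply, LinearMap.comp_apply]
      rintro l ⟨hl, hU, hop⟩
      rw [LinearMap.add_apply, LinearMap.comp_apply, mapChain_single, chainSum_single,
        chainSum_single, chainSum_single]
      have hm : (l.map neg).map label = (l.map label).map flipLabel := by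
        rw [List.map_map, List.map_map]
        exact List.map_congr_left fun x hx => hflip x (hU x hx)
      simp only [hG, hm]
      refine headProd_sort_flip _ ?_ hop
      intro h
      rw [List.map_eq_nil_iff] at h
      subst h; simp at hl
    rw [h1, hb k (by omega), h2]

/-- The standard basis vectors, extended by zero to all natural indices. -/
noncomputable def basisVec (m k : ℕ) : Fin (m + 1) → ℝ :=
  if h : k < m + 1 then Pi.single ⟨k, h⟩ 1 else 0

/-- Octahedral hemispheres. -/
noncomputable def hemisphere (m : ℕ) : ℕ → List (Fin (m + 1) → ℝ) →₀ ZMod 2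
  | 0 => Finsupp.single [basisVec m 0] 1
  | k + 1 => coneChain (basisVec m (k + 1))
      (hemisphere m k + mapChain (fun x => -x) (hemisphere m k))

theorem mapChain_neg_neg {E : Type*} [AddGroup E] (c : List E →₀ ZMod 2) :
    mapChain (fun x => -x) (mapChain (fun x => -x) c) = c := by
  have : mapChain (fun x : E => -x) ∘ₗ mapChain (fun x : E => -x) = LinearMap.id := by
    refine Finsupp.lhom_ext' fun l => LinearMap.ext_ring ?_
    simp [mapChain_single, Function.comp_def]
  exact LinearMap.congr_fun this c

theorem bdry_hemisphere_antipodal (m k : ℕ) :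
    bdry (hemisphere m k) + mapChain (fun x => -x) (bdry (hemisphere m k)) = 0 := by
  induction k with
  | zero =>
    simp only [hemisphere, bdry_single, faces, mapChain_single, map_zero, add_zero, List.map_nil]
    exact add_self_chain _
  | succ k ih =>
    have hb : bdry (hemisphere m (k + 1))
        = hemisphere m k + mapChain (fun x => -x) (hemisphere m k) := by
      rw [hemisphere, bdry_coneChain, map_add, ← mapChain_bdry, ih, map_zero, add_zero]
    rw [hb, map_add, mapChain_neg_neg, add_comm (mapChain _ _) (hemisphere m k)]
    exact add_self_chain _

theorem bdry_hemisphere_succ (m k : ℕ) : bdry (hemisphere m (k + 1))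
    = hemisphere m k + mapChain (fun x => -x) (hemisphere m k) := by
  rw [hemisphere, bdry_coneChain, map_add, ← mapChain_bdry, bdry_hemisphere_antipodal, map_zero,
    add_zero]

theorem hemisphere_mem (m k : ℕ) : hemisphere m k ∈ chainsIn {l | l.length = k + 1 ∧
    ∃ ε : ℕ → ℝ, (∀ i, ε i * ε i = 1) ∧ ∀ x ∈ l, ∃ i ≤ k, x = ε i • basisVec m i} := by
  induction k with
  | zero =>
    exact single_mem_chainsIn ⟨rfl, fun _ => 1, by simp, by simp⟩
  | succ k ih =>
    have key : hemisphere m k + mapChain (fun x => -x) (hemisphere m k) ∈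
      chainsIn {l | l.length = k + 1 ∧
        ∃ ε : ℕ → ℝ, (∀ i, ε i * ε i = 1) ∧ ∀ x ∈ l, ∃ i ≤ k, x = ε i • basisVec m i} := by
      refine Submodule.add_mem _ ih (map_mem_of_chainsIn _ ?_ ih)
      rintro l ⟨hl, ε, hε, hx⟩
      rw [mapChain_single]
      refine single_mem_chainsIn ⟨by simpa using hl, fun i => -ε i, by simpa using hε, ?_⟩
      intro x hx'
      obtain ⟨y, hy, rfl⟩ := List.mem_map.1 hx'
      obtain ⟨i, hi, rfl⟩ := hx y hy
      exact ⟨i, hi, by simp⟩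
    refine map_mem_of_chainsIn _ ?_ key
    rintro l ⟨hl, ε, hε, hx⟩
    rw [coneChain_single]
    refine single_mem_chainsIn ⟨by simp [hl], fun i => if i = k + 1 then 1 else ε i, ?_, ?_⟩
    · intro i; dsimp only; split_ifs
      · simp
      · exact hε i
    · intro x hx'
      rcases List.mem_cons.1 hx' with rfl | hx'
      · exact ⟨k + 1, le_rfl, by simp⟩
      · obtain ⟨i, hi, rfl⟩ := hx x hx'
        exact ⟨i, by omega, by dsimp only; rw [if_neg (by omega)]⟩

/-- A convex piece of the sphere for the supremum norm, away from the origin. -/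
def octantFace (m : ℕ) (ε : ℕ → ℝ) : Set (Fin (m + 1) → ℝ) :=
  {v | ∑ i : Fin (m + 1), ε i * v i = 1} ∩ Metric.closedBall 0 1

theorem convex_octantFace (m : ℕ) (ε : ℕ → ℝ) : Convex ℝ (octantFace m ε) := by
  refine Convex.inter ?_ (convex_closedBall _ _)
  intro x hx y hy a b ha hb hab
  simp only [Set.mem_ofPred_eq] at *
  calc ∑ i : Fin (m + 1), ε i * (a • x + b • y) i
      = a * ∑ i : Fin (m + 1), ε i * x i + b * ∑ i : Fin (m + 1), ε i * y i := by
        rw [Finset.mul_sum, Finset.mul_sum, ← Finset.sum_add_distrib]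
        exact Finset.sum_congr rfl fun i _ => by simp; ring
    _ = 1 := by rw [hx, hy]; linarith

theorem smul_basisVec_mem_octantFace (m : ℕ) (ε : ℕ → ℝ) (hε : ∀ i, ε i * ε i = 1) (i : ℕ)
    (hi : i ≤ m) : ε i • basisVec m i ∈ octantFace m ε := by
  have hb : basisVec m i = Pi.single ⟨i, by omega⟩ 1 := by rw [basisVec, dif_pos]
  refine ⟨?_, ?_⟩
  · simp only [Set.mem_ofPred_eq, hb]
    rw [Finset.sum_eq_single ⟨i, by omega⟩]
    · simpa using hε i
    · intro j _ hj; simp [hj]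
    · simp
  · rw [mem_closedBall_zero_iff, norm_smul, hb, Pi.norm_single, norm_one, mul_one]
    rcases mul_self_eq_one_iff.1 (hε i) with h | h <;> simp [h]

theorem subdiv_mem_length {E : Type*} [NormedAddCommGroup E] [NormedSpace ℝ E] (n : ℕ)
    {c : List E →₀ ZMod 2} (hc : c ∈ chainsIn {l | l.length = n}) :
    subdiv n c ∈ chainsIn {l | l.length = n} := by
  induction n generalizing c with
  | zero => rwa [subdiv_zero]
  | succ n ih =>
    refine map_mem_of_chainsIn _ ?_ hc
    intro l hl
    rw [subdiv_succ_single]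
    refine map_mem_of_chainsIn (coneChain (barycenter l)) ?_ (ih (faces_mem l fun m _ hm => ?_))
    · intro m hm
      rw [coneChain_single]
      refine single_mem_chainsIn ?_
      simp only [Set.mem_ofPred_eq] at *
      simp [hm]
    · simp only [Set.mem_ofPred_eq] at *
      omega

theorem bdry_subdiv_iterate {E : Type*} [NormedAddCommGroup E] [NormedSpace ℝ E] (n j : ℕ)
    {c : List E →₀ ZMod 2} (hc : c ∈ chainsIn {l | l.length = n + 1}) :
    bdry ((subdiv (n + 1))^[j] c) = (subdiv n)^[j] (bdry c) ∧
      (subdiv (n + 1))^[j] c ∈ chainsIn {l | l.length = n + 1} := by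
  induction j with
  | zero => exact ⟨rfl, hc⟩
  | succ j ih =>
    rw [Function.iterate_succ_apply', Function.iterate_succ_apply']
    exact ⟨by rw [bdry_subdiv n ih.2, ih.1], subdiv_mem_length _ ih.2⟩

theorem mapChain_neg_subdiv_iterate {E : Type*} [NormedAddCommGroup E] [NormedSpace ℝ E]
    (n j : ℕ) (c : List E →₀ ZMod 2) :
    mapChain (fun x => -x) ((subdiv n)^[j] c) = (subdiv n)^[j] (mapChain (fun x => -x) c) := by
  induction j with
  | zero => rfl
  | succ j ih => rw [Function.iterate_succ_apply', Function.iterate_succ_apply',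
      mapChain_neg_subdiv, ih]

theorem subdiv_one_single {E : Type*} [NormedAddCommGroup E] [NormedSpace ℝ E] (e : E) :
    subdiv 1 (Finsupp.single [e] 1) = Finsupp.single [e] 1 := by
  rw [subdiv_succ_single, subdiv_zero, faces, faces, map_zero, add_zero, LinearMap.id_apply,
    coneChain_single]
  simp [barycenter]

/-- **Borsuk–Ulam theorem**: an odd continuous map to a space of smaller dimension has a zero
away from the origin. -/
theorem exists_ne_zero_eq_zero_of_odd (m : ℕ) (F : (Fin (m + 1) → ℝ) → Fin m → ℝ)
    (hF : Continuous F) (hodd : ∀ x, F (-x) = -F x) : ∃ x, x ≠ 0 ∧ F x = 0 := by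
  by_contra! hcon
  set A : Set (Fin (m + 1) → ℝ) := {v | 1 ≤ ∑ i, |v i|} ∩ Metric.closedBall 0 1 with hA
  have hAc : IsCompact A := by
    refine (isCompact_closedBall _ _).inter_left ?_
    exact isClosed_le continuous_const (by fun_prop)
  have hA0 : ∀ x ∈ A, x ≠ 0 := by
    rintro x ⟨hx, -⟩ rfl
    simp at hx
    linarith
  have hneg : ∀ x ∈ A, -x ∈ A := by
    rintro x ⟨hx, hx'⟩
    refine ⟨by simpa using hx, by simpa using hx'⟩
  obtain ⟨η, hη, hηF⟩ : ∃ η > 0, ∀ x ∈ A, ∃ j, η ≤ |F x j| := by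
    rcases A.eq_empty_or_nonempty with h | h
    · exact ⟨1, one_pos, by simp [h]⟩
    obtain ⟨x₀, hx₀, hmin⟩ := hAc.exists_isMinOn h (hF.norm.continuousOn)
    have hpos : 0 < ‖F x₀‖ := norm_pos_iff.2 (hcon x₀ (hA0 x₀ hx₀))
    refine ⟨‖F x₀‖ / 2, by positivity, fun x hx => ?_⟩
    by_contra! hlt
    have h1 : ‖F x‖ ≤ ‖F x₀‖ / 2 :=
      (pi_norm_le_iff_of_nonneg (by positivity)).2 fun j => (hlt j).le
    have h2 := isMinOn_iff.1 hmin x hx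
    linarith
  obtain ⟨δ, hδ, hunif⟩ : ∃ δ > 0, ∀ x ∈ A, ∀ y ∈ A, dist x y ≤ δ → dist (F x) (F y) < η := by
    have := hAc.uniformContinuousOn_of_continuous hF.continuousOn
    obtain ⟨δ, hδ, h⟩ := Metric.uniformContinuousOn_iff.1 this η hη
    exact ⟨δ / 2, by positivity, fun x hx y hy hxy => h x hx y hy (by linarith)⟩
  set pick : (Fin m → ℝ) → ℕ := fun u =>
    if h : ∃ j, η ≤ u j then (h.choose : ℕ) else 0 with hpick
  have hpick_spec : ∀ x ∈ A, ∃ j : Fin m, (pick fun i => |F x i|) = j ∧ η ≤ |F x j| := by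
    intro x hx
    have h := hηF x hx
    exact ⟨h.choose, by simp only [hpick]; rw [dif_pos h], h.choose_spec⟩
  set label : (Fin (m + 1) → ℝ) → ℕ := fun x => 2 * (pick fun i => |F x i|) +
    (if ∃ j : Fin m, (pick fun i => |F x i|) = j ∧ 0 < F x j then 0 else 1) with hlabel
  have hdiv : ∀ x, label x / 2 = pick fun i => |F x i| := by
    intro x; simp only [hlabel]; split_ifs <;> omega
  have hflip : ∀ x ∈ A, label (-x) = flipLabel (label x) := by
    intro x hx
    obtain ⟨j, hj, hjη⟩ := hpick_spec x hx
    have hne : F x j ≠ 0 := by intro h; rw [h] at hjη; simp at hjη; linarith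
    have e : (fun i => |F (-x) i|) = fun i => |F x i| := by funext i; simp [hodd]
    simp only [hlabel, e, hj, flipLabel]
    have c1 : ∀ y, (∃ j' : Fin m, (j : ℕ) = j' ∧ 0 < F y j') ↔ 0 < F y j := by
      intro y
      constructor
      · rintro ⟨j', h1, h2⟩
        rwa [Fin.ext h1]
      · exact fun h => ⟨j, rfl, h⟩
    simp only [c1]
    rw [hodd, Pi.neg_apply]
    rcases lt_or_gt_of_ne hne with h | h
    · have h1 : 0 < -F x j := by linarith
      have h2 : ¬ 0 < F x j := by linarith
      rw [if_pos h1, if_neg h2]; split_ifs <;> omega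
    · have h1 : ¬ 0 < -F x j := by linarith
      rw [if_neg h1, if_pos h]; split_ifs <;> omega
  have hnoopp : ∀ l : List (Fin (m + 1) → ℝ), (∀ x ∈ l, x ∈ A) →
      (∀ x ∈ l, ∀ y ∈ l, dist x y ≤ δ) → NoOpposite (l.map label) := by
    intro l hlA hd a ha b hb hab
    obtain ⟨x, hx, rfl⟩ := List.mem_map.1 ha
    obtain ⟨y, hy, rfl⟩ := List.mem_map.1 hb
    rw [hdiv, hdiv] at hab
    obtain ⟨j, hj, hjη⟩ := hpick_spec x (hlA x hx)
    obtain ⟨j', hj', hjη'⟩ := hpick_spec y (hlA y hy)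
    have hjj : j = j' := Fin.ext (by rw [← hj, ← hj', hab])
    subst hjj
    have c1 : ∀ z, (∃ j' : Fin m, (j : ℕ) = j' ∧ 0 < F z j') ↔ 0 < F z j := by
      intro y
      constructor
      · rintro ⟨j', h1, h2⟩
        rwa [Fin.ext h1]
      · exact fun h => ⟨j, rfl, h⟩
    have hdist := (dist_le_pi_dist (F x) (F y) j).trans_lt
      (hunif x (hlA x hx) y (hlA y hy) (hd x hx y hy))
    rw [Real.dist_eq, abs_lt] at hdist
    simp only [hlabel, hj, hj', c1]
    congr 1
    rcases le_abs.1 hjη with h1 | h1 <;> rcases le_abs.1 hjη' with h2 | h2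
    · rw [if_pos (by linarith), if_pos (by linarith)]
    · linarith
    · linarith
    · rw [if_neg (by linarith), if_neg (by linarith)]
  obtain ⟨J, hJ⟩ : ∃ J : ℕ, (1 - ((m + 1 : ℕ) : ℝ)⁻¹) ^ J < δ / 2 := by
    refine exists_pow_lt_of_lt_one (by positivity) ?_
    have : (0 : ℝ) < ((m + 1 : ℕ) : ℝ)⁻¹ := by positivity
    linarith
  set c : ℕ → List (Fin (m + 1) → ℝ) →₀ ZMod 2 := fun k => (subdiv (k + 1))^[J] (hemisphere m k)
    with hc
  have hlen : ∀ k, hemisphere m k ∈ chainsIn {l | l.length = k + 1} := fun k =>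
    chainsIn_mono (fun l hl => hl.1) (hemisphere_mem m k)
  have hfaceA : ∀ ε : ℕ → ℝ, (∀ i, ε i * ε i = 1) → octantFace m ε ⊆ A := by
    rintro ε hε x ⟨hx, hx'⟩
    refine ⟨?_, hx'⟩
    simp only [Set.mem_ofPred_eq] at hx ⊢
    rw [← hx]
    refine Finset.sum_le_sum fun i _ => (le_abs_self _).trans ?_
    rw [abs_mul]
    rcases mul_self_eq_one_iff.1 (hε i) with h | h <;> simp [h]
  have hcmem : ∀ k ≤ m, c k ∈
      chainsIn {l | l.length = k + 1 ∧ (∀ x ∈ l, x ∈ A) ∧ NoOpposite (l.map label)} := by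
    intro k hk
    have h1 : hemisphere m k ∈ chainsIn {l | ∃ K ∈ {K | ∃ ε : ℕ → ℝ, (∀ i, ε i * ε i = 1) ∧
        K = octantFace m ε}, l ∈ smallSimplices (k + 1) K 2} := by
      refine chainsIn_mono ?_ (hemisphere_mem m k)
      rintro l ⟨hl, ε, hε, hx⟩
      have hmem : ∀ x ∈ l, x ∈ octantFace m ε := by
        intro x hxl
        obtain ⟨i, hi, rfl⟩ := hx x hxl
        exact smul_basisVec_mem_octantFace m ε hε i (by omega)
      refine ⟨_, ⟨ε, hε, rfl⟩, hl, hmem, fun x hx y hy => ?_⟩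
      have h1 := (hmem x hx).2
      have h2 := (hmem y hy).2
      rw [Metric.mem_closedBall] at h1 h2
      linarith [dist_triangle_right x y 0]
    have h2 := subdiv_iterate_mem (by
      rintro K ⟨ε, -, rfl⟩
      exact convex_octantFace m ε) (k + 1) zero_le_two J h1
    refine chainsIn_mono ?_ h2
    rintro l ⟨K, ⟨ε, hε, rfl⟩, l1, l2, l3⟩
    have hlA : ∀ x ∈ l, x ∈ A := fun x hx => hfaceA ε hε (l2 x hx)
    refine ⟨l1, hlA, hnoopp l hlA fun x hx y hy => (l3 x hx y hy).trans ?_⟩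
    have h3 : (1 - ((k + 1 : ℕ) : ℝ)⁻¹) ^ J ≤ (1 - ((m + 1 : ℕ) : ℝ)⁻¹) ^ J := by
      refine pow_le_pow_left₀ ?_ ?_ J
      · rw [sub_nonneg]; exact inv_le_one_of_one_le₀ (by simp)
      · have : ((m + 1 : ℕ) : ℝ)⁻¹ ≤ ((k + 1 : ℕ) : ℝ)⁻¹ :=
          inv_anti₀ (by positivity) (by exact_mod_cast Nat.succ_le_succ hk)
        linarith
    linarith
  have hone := chainSum_altProd_eq_one (fun x => -x) label A hflip c m hcmem (by
    intro k _
    simp only [hc]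
    rw [(bdry_subdiv_iterate (k + 1) J (hlen (k + 1))).1, bdry_hemisphere_succ,
      mapChain_neg_subdiv_iterate, iterate_map_add]) (basisVec m 0) (by
    simp only [hc, hemisphere]
    exact Function.iterate_fixed (subdiv_one_single _) J) m le_rfl
  obtain ⟨l, ⟨l1, l2, l3⟩, l4⟩ := exists_ne_zero_of_chainSum_ne_zero (hcmem m le_rfl)
    (by rw [hone]; exact one_ne_zero)
  set s := (l.map label).insertionSort (· ≤ ·) with hs
  have hperm : s.Perm (l.map label) := List.perm_insertionSort _ _
  have hpw := pairwise_lt_of_altProd_ne_zero s (List.pairwise_insertionSort _ _)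
    (fun a ha b hb => l3 a (hperm.subset ha) b (hperm.subset hb)) l4
  have hnd : (s.map (· / 2)).Nodup := by
    rw [List.Nodup, List.pairwise_map]
    exact hpw.imp fun h => h.ne
  have hsub : (s.map (· / 2)).toFinset ⊆ Finset.range m := by
    intro a ha
    rw [List.mem_toFinset, List.mem_map] at ha
    obtain ⟨b, hb, rfl⟩ := ha
    obtain ⟨x, hx, rfl⟩ := List.mem_map.1 (hperm.subset hb)
    obtain ⟨j, hj, -⟩ := hpick_spec x (l2 x hx)
    rw [Finset.mem_range, hdiv, hj]
    exact j.2
  have := Finset.card_le_card hsub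
  rw [List.toFinset_card_of_nodup hnd, List.length_map, hperm.length_eq, List.length_map, l1,
    Finset.card_range] at this
  omega

end BorsukUlam

section HamSandwich

/-- Truncation of a real number to the interval `[-r, r]`. -/
noncomputable def clampAbs (r x : ℝ) : ℝ := max (-r) (min r x)

theorem clampAbs_neg {r : ℝ} (hr : 0 ≤ r) (x : ℝ) : clampAbs r (-x) = -clampAbs r x := by
  simp only [clampAbs]
  rcases le_total r x with h | h <;> rcases le_total (-r) x with h' | h'
  · rw [min_eq_left h, min_eq_right (by linarith), max_eq_left (by linarith),
      max_eq_right (by linarith)]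
  · have : r = 0 := by linarith
    subst this
    simp at *
  · rw [min_eq_right h, min_eq_right (by linarith), max_eq_right (by linarith), max_eq_right h']
  · rw [min_eq_right h, max_eq_left h', min_eq_left (by linarith), max_eq_right (by linarith)]
    ring

theorem clampAbs_mul {a : ℝ} (ha : 0 ≤ a) (r x : ℝ) :
    clampAbs (a * r) (a * x) = a * clampAbs r x := by
  simp only [clampAbs, ← mul_min_of_nonneg _ _ ha, ← mul_max_of_nonneg _ _ ha, ← mul_neg]

theorem neg_le_clampAbs (r x : ℝ) : -r ≤ clampAbs r x := le_max_left _ _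

theorem clampAbs_of_le {r x : ℝ} (hr : 0 ≤ r) (h : r ≤ x) : clampAbs r x = r := by
  simp only [clampAbs]; rw [min_eq_left h, max_eq_right (by linarith)]

theorem two_mul_card_le_of_sum_clamp {X : Type*} (S : Finset X) (u w : X → ℝ)
    (h0 : ∑ p ∈ S, clampAbs 1 (u p) = 0) (hw : ∀ p ∈ S, 0 < w p → 1 ≤ u p) :
    2 * (S.filter fun p => 0 < w p).card ≤ S.card := by
  have h1 : ∑ p ∈ S, ((if 0 < w p then (2 : ℝ) else 0) - 1) ≤ ∑ p ∈ S, clampAbs 1 (u p) := by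
    refine Finset.sum_le_sum fun p hp => ?_
    split_ifs with h
    · rw [clampAbs_of_le zero_le_one (hw p hp h)]; norm_num
    · rw [zero_sub]; exact neg_le_clampAbs 1 _
  rw [h0, Finset.sum_sub_distrib, ← Finset.sum_filter] at h1
  simp only [Finset.sum_const, nsmul_eq_mul, mul_one] at h1
  have : (2 : ℝ) * (S.filter fun p => 0 < w p).card ≤ S.card := by linarith
  exact_mod_cast this

/-- **Discrete ham sandwich theorem** for a linear family of functions. -/
theorem ham_sandwich_fin {X : Type*} (m : ℕ) (S : Fin m → Finset X)
    (φ : X → (Fin (m + 1) → ℝ) →ₗ[ℝ] ℝ) :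
    ∃ c : Fin (m + 1) → ℝ, c ≠ 0 ∧ ∀ j,
      2 * ((S j).filter fun p => 0 < φ p c).card ≤ (S j).card ∧
      2 * ((S j).filter fun p => φ p c < 0).card ≤ (S j).card := by
  have hcont : ∀ p, Continuous (φ p) := fun p => (φ p).continuous_of_finiteDimensional
  have hex : ∀ n : ℕ, ∃ c : Fin (m + 1) → ℝ, c ∈ Metric.sphere (0 : Fin (m + 1) → ℝ) 1 ∧
      ∀ j, ∑ p ∈ S j, clampAbs 1 (n * φ p c) = 0 := by
    intro n
    obtain ⟨x, hx, hFx⟩ := exists_ne_zero_eq_zero_of_odd m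
      (fun c j => ∑ p ∈ S j, clampAbs ‖c‖ (n * φ p c))
      (by
        refine continuous_pi fun j => continuous_finsetSum _ fun p _ => ?_
        have := hcont p
        unfold clampAbs
        fun_prop)
      (by
        intro c; funext j
        simp only [norm_neg, map_neg, mul_neg, Pi.neg_apply, ← Finset.sum_neg_distrib]
        exact Finset.sum_congr rfl fun p _ => clampAbs_neg (norm_nonneg _) _)
    have hpos : 0 < ‖x‖ := norm_pos_iff.2 hx
    refine ⟨‖x‖⁻¹ • x, ?_, fun j => ?_⟩
    · simp [norm_smul, hpos.ne']
    · have h1 : ∀ p, clampAbs 1 (n * φ p (‖x‖⁻¹ • x)) = ‖x‖⁻¹ * clampAbs ‖x‖ (n * φ p x) := by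
        intro p
        rw [← clampAbs_mul (inv_nonneg.2 hpos.le), inv_mul_cancel₀ hpos.ne', map_smul, smul_eq_mul]
        congr 1; ring
      simp only [h1, ← Finset.mul_sum]
      have := congrFun hFx j
      simp only [Pi.zero_apply] at this
      rw [this, mul_zero]
  choose x hx hxs using hex
  obtain ⟨c, hc, ψ, hψ, hlim⟩ := (isCompact_sphere (0 : Fin (m + 1) → ℝ) 1).tendsto_subseq hx
  have key : ∀ p, 0 < φ p c → ∀ᶠ i in Filter.atTop, 1 ≤ (ψ i : ℝ) * φ p (x (ψ i)) := by
    intro p hp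
    have h1 : Filter.Tendsto (fun i => φ p (x (ψ i))) Filter.atTop (nhds (φ p c)) :=
      ((hcont p).tendsto c).comp hlim
    have h2 : Filter.Tendsto (fun i => (ψ i : ℝ)) Filter.atTop Filter.atTop :=
      tendsto_natCast_atTop_atTop.comp hψ.tendsto_atTop
    exact (h2.atTop_mul_pos hp h1).eventually_ge_atTop 1
  have key' : ∀ p, φ p c < 0 → ∀ᶠ i in Filter.atTop, 1 ≤ -((ψ i : ℝ) * φ p (x (ψ i))) := by
    intro p hp
    have h1 : Filter.Tendsto (fun i => φ p (x (ψ i))) Filter.atTop (nhds (φ p c)) :=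
      ((hcont p).tendsto c).comp hlim
    have h2 : Filter.Tendsto (fun i => (ψ i : ℝ)) Filter.atTop Filter.atTop :=
      tendsto_natCast_atTop_atTop.comp hψ.tendsto_atTop
    have := (h2.atTop_mul_pos (neg_pos.2 hp) h1.neg).eventually_ge_atTop 1
    filter_upwards [this] with i hi
    linarith
  refine ⟨c, ?_, fun j => ?_⟩
  · rintro rfl; simp at hc
  have e1 : ∀ᶠ i in Filter.atTop, ∀ p ∈ S j, 0 < φ p c → 1 ≤ (ψ i : ℝ) * φ p (x (ψ i)) := by
    rw [Filter.eventually_all_finset]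
    intro p _
    by_cases hp : 0 < φ p c
    · filter_upwards [key p hp] with i hi _ using hi
    · exact Filter.Eventually.of_forall fun i h => absurd h hp
  have e2 : ∀ᶠ i in Filter.atTop, ∀ p ∈ S j, φ p c < 0 → 1 ≤ -((ψ i : ℝ) * φ p (x (ψ i))) := by
    rw [Filter.eventually_all_finset]
    intro p _
    by_cases hp : φ p c < 0
    · filter_upwards [key' p hp] with i hi _ using hi
    · exact Filter.Eventually.of_forall fun i h => absurd h hp
  obtain ⟨i, h1, h2⟩ := (e1.and e2).exists
  refine ⟨two_mul_card_le_of_sum_clamp (S j) _ (fun p => φ p c) (hxs (ψ i) j) h1, ?_⟩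
  have h3 : ∑ p ∈ S j, clampAbs 1 (-((ψ i : ℝ) * φ p (x (ψ i)))) = 0 := by
    simp only [clampAbs_neg zero_le_one, Finset.sum_neg_distrib, hxs (ψ i) j, neg_zero]
  have := two_mul_card_le_of_sum_clamp (S j) _ (fun p => -φ p c) h3
    (fun p hp h => h2 p hp (by linarith))
  simpa only [neg_pos] using this

theorem ham_sandwich {X ι κ : Type*} [Fintype ι] [Fintype κ]
    (hcard : Fintype.card κ < Fintype.card ι) (S : κ → Finset X) (φ : X → (ι → ℝ) →ₗ[ℝ] ℝ) :
    ∃ c : ι → ℝ, c ≠ 0 ∧ ∀ j,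
      2 * ((S j).filter fun p => 0 < φ p c).card ≤ (S j).card ∧
      2 * ((S j).filter fun p => φ p c < 0).card ≤ (S j).card := by
  obtain ⟨m, hm⟩ : ∃ m, Fintype.card ι = m + 1 := ⟨Fintype.card ι - 1, by omega⟩
  let e : Fin (m + 1) ≃ ι := (Fintype.equivFinOfCardEq hm).symm
  obtain ⟨g⟩ : Nonempty (κ ↪ Fin m) :=
    Function.Embedding.nonempty_of_card_le (by rw [Fintype.card_fin]; omega)
  let E : (Fin (m + 1) → ℝ) ≃ₗ[ℝ] (ι → ℝ) := LinearEquiv.funCongrLeft ℝ ℝ e.symm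
  obtain ⟨c, hc, h⟩ := ham_sandwich_fin m (Function.extend g S fun _ => ∅)
    (fun p => φ p ∘ₗ E.toLinearMap)
  refine ⟨E c, by simpa using hc, fun j => ?_⟩
  have := h (g j)
  rw [g.injective.extend_apply] at this
  exact this

end HamSandwich

section Partition

open MvPolynomial

/-- The exponent vector supported on `T` with prescribed entries. -/
noncomputable def boxExponent {T : Finset (Fin 3)} {a : ℕ} (e : T → Fin a) : Fin 3 →₀ ℕ :=
  Finsupp.equivFunOnFinite.symm fun i => if h : i ∈ T then (e ⟨i, h⟩ : ℕ) else 0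

theorem boxExponent_apply {T : Finset (Fin 3)} {a : ℕ} (e : T → Fin a) (i : Fin 3) :
    boxExponent e i = if h : i ∈ T then (e ⟨i, h⟩ : ℕ) else 0 := rfl

theorem boxExponent_injective {T : Finset (Fin 3)} {a : ℕ} :
    Function.Injective (boxExponent : (T → Fin a) → Fin 3 →₀ ℕ) := by
  intro e e' h
  funext i
  have := DFunLike.congr_fun h (i : Fin 3)
  simp only [boxExponent_apply, i.2, dite_true] at this
  exact Fin.ext this

/-- The polynomial in the variables in `T`, of degree less than `a` in each of them, with given
coefficients. -/
noncomputable def boxPoly (T : Finset (Fin 3)) (a : ℕ) :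
    ((T → Fin a) → ℝ) →ₗ[ℝ] MvPolynomial (Fin 3) ℝ :=
  ∑ e : T → Fin a, (monomial (boxExponent e)).comp (LinearMap.proj e)

theorem boxPoly_apply (T : Finset (Fin 3)) (a : ℕ) (c : (T → Fin a) → ℝ) :
    boxPoly T a c = ∑ e : T → Fin a, monomial (boxExponent e) (c e) := by
  simp [boxPoly]

theorem coeff_boxPoly (T : Finset (Fin 3)) (a : ℕ) (c : (T → Fin a) → ℝ) (e : T → Fin a) :
    coeff (boxExponent e) (boxPoly T a c) = c e := by
  rw [boxPoly_apply, coeff_sum, Finset.sum_eq_single e]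
  · simp
  · intro b _ hb
    rw [coeff_monomial, if_neg fun h => hb (boxExponent_injective h)]
  · simp

theorem boxPoly_ne_zero (T : Finset (Fin 3)) (a : ℕ) (c : (T → Fin a) → ℝ) (hc : c ≠ 0) :
    boxPoly T a c ≠ 0 := by
  intro h
  refine hc (funext fun e => ?_)
  rw [← coeff_boxPoly T a c e, h]; simp

theorem totalDegree_boxPoly_le (T : Finset (Fin 3)) (a : ℕ) (c : (T → Fin a) → ℝ) :
    (boxPoly T a c).totalDegree ≤ T.card * a := by
  rw [boxPoly_apply]
  refine (totalDegree_finsetSum_le fun e _ => (totalDegree_monomial_le _ _).trans ?_)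
  rw [Finsupp.sum_fintype _ _ (fun _ => rfl)]
  calc ∑ i, boxExponent e i ≤ ∑ i, if i ∈ T then a else 0 := by
        refine Finset.sum_le_sum fun i _ => ?_
        rw [boxExponent_apply]
        split_ifs
        · exact (e _).2.le
        · exact le_rfl
    _ = T.card * a := by simp

theorem degreeOf_boxPoly (T : Finset (Fin 3)) (a : ℕ) (c : (T → Fin a) → ℝ) (k : Fin 3)
    (hk : k ∉ T) : degreeOf k (boxPoly T a c) = 0 := by
  rw [boxPoly_apply, ← Nat.le_zero]
  refine (degreeOf_sum_le _ _ _).trans (Finset.sup_le fun e _ => ?_)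
  by_cases h : c e = 0
  · simp [h]
  · rw [degreeOf_monomial_eq _ _ h, boxExponent_apply, dif_neg hk]

/-- The sign vector of a point with respect to a list of polynomials. -/
noncomputable def signCell (fs : List (MvPolynomial (Fin 3) ℝ)) (p : Fin 3 → ℝ) : List Bool :=
  fs.map fun f => decide (0 < eval p f)

/-- **Polynomial partitioning**, using polynomials in the variables in `T`. -/
theorem exists_partition_list (T : Finset (Fin 3)) (hT : T.Nonempty) (P : Finset (Fin 3 → ℝ))
    (J : ℕ) : ∃ fs : List (MvPolynomial (Fin 3) ℝ), fs.length = J ∧ (∀ f ∈ fs, f ≠ 0) ∧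
      (∀ f ∈ fs, ∀ k ∉ T, degreeOf k f = 0) ∧
      (fs.map totalDegree).sum ≤ ∑ j ∈ Finset.range J, T.card * 2 ^ (j / T.card + 1) ∧
      ∀ σ : List Bool, σ.length = J →
        2 ^ J * (P.filter fun p => (∀ f ∈ fs, eval p f ≠ 0) ∧ signCell fs p = σ).card
          ≤ P.card := by
  induction J with
  | zero =>
    refine ⟨[], rfl, by simp, by simp, by simp, fun σ _ => ?_⟩
    simpa using Finset.card_filter_le _ _
  | succ J ih =>
    obtain ⟨fs, h1, h2, h3, h4, h5⟩ := ih
    set a := 2 ^ (J / T.card + 1) with ha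
    have hcard : Fintype.card (List.Vector Bool J) < Fintype.card (T → Fin a) := by
      rw [card_vector, Fintype.card_bool, Fintype.card_fun, Fintype.card_fin, Fintype.card_coe, ha,
        ← pow_mul]
      refine Nat.pow_lt_pow_right (by norm_num) ?_
      have hpos := Finset.card_pos.2 hT
      rw [mul_comm]
      exact Nat.lt_mul_div_succ J hpos
    obtain ⟨c, hc, hcut⟩ := ham_sandwich hcard
      (fun σ => P.filter fun p => (∀ f ∈ fs, eval p f ≠ 0) ∧ signCell fs p = σ.1)
      (fun p => (aeval (R := ℝ) p).toLinearMap ∘ₗ boxPoly T a)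
    set f := boxPoly T a c with hf
    have hev : ∀ p, ((aeval (R := ℝ) p).toLinearMap ∘ₗ boxPoly T a) c = eval p f := by
      intro p
      simp [hf, aeval_eq_eval]
    simp only [hev] at hcut
    refine ⟨f :: fs, by simp [h1], ?_, ?_, ?_, ?_⟩
    · intro g hg
      rcases List.mem_cons.1 hg with rfl | hg
      · exact boxPoly_ne_zero T a c hc
      · exact h2 g hg
    · intro g hg k hk
      rcases List.mem_cons.1 hg with rfl | hg
      · exact degreeOf_boxPoly T a c k hk
      · exact h3 g hg k hk
    · rw [List.map_cons, List.sum_cons, Finset.sum_range_succ, add_comm]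
      exact add_le_add h4 (totalDegree_boxPoly_le T a c)
    · intro σ hσ
      match σ, hσ with
      | b :: σ, hσ =>
        have hσ' : σ.length = J := by simpa using hσ
        have hc' := hcut ⟨σ, hσ'⟩
        simp only at hc'
        have h6 := h5 σ hσ'
        set Q := P.filter fun p => (∀ f ∈ fs, eval p f ≠ 0) ∧ signCell fs p = σ with hQ
        have hsub : 2 * (P.filter fun p => (∀ g ∈ f :: fs, eval p g ≠ 0) ∧
            signCell (f :: fs) p = b :: σ).card ≤ Q.card := by
          cases b with
          | true =>
            refine le_trans (Nat.mul_le_mul_left 2 (Finset.card_le_card ?_)) hc'.1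
            intro p hp
            rw [Finset.mem_filter, signCell, List.map_cons, List.cons.injEq,
              decide_eq_true_eq, List.forall_mem_cons] at hp
            rw [Finset.mem_filter, hQ, Finset.mem_filter]
            exact ⟨⟨hp.1, hp.2.1.2, hp.2.2.2⟩, hp.2.2.1⟩
          | false =>
            refine le_trans (Nat.mul_le_mul_left 2 (Finset.card_le_card ?_)) hc'.2
            intro p hp
            rw [Finset.mem_filter, signCell, List.map_cons, List.cons.injEq,
              decide_eq_false_iff_not, List.forall_mem_cons] at hp
            rw [Finset.mem_filter, hQ, Finset.mem_filter]
            exact ⟨⟨hp.1, hp.2.1.2, hp.2.2.2⟩, lt_of_le_of_ne (not_lt.1 hp.2.2.1) hp.2.1.1⟩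
        calc 2 ^ (J + 1) * _ = 2 ^ J * (2 * _) := by rw [pow_succ, mul_assoc]
          _ ≤ 2 ^ J * Q.card := Nat.mul_le_mul_left _ hsub
          _ ≤ P.card := h6

theorem sum_two_pow_div_le (n b : ℕ) (hn : 0 < n) :
    ∑ j ∈ Finset.range (n * b), n * 2 ^ (j / n + 1) ≤ 2 * n ^ 2 * 2 ^ b := by
  induction b with
  | zero => simp
  | succ b ih =>
    rw [Nat.mul_succ, Finset.sum_range_add]
    have : ∑ j ∈ Finset.range n, n * 2 ^ ((n * b + j) / n + 1) = n ^ 2 * 2 ^ (b + 1) := by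
      rw [Finset.sum_congr rfl (g := fun _ => n * 2 ^ (b + 1))]
      · simp; ring
      · intro j hj
        rw [Nat.mul_add_div hn, Nat.div_eq_of_lt (Finset.mem_range.1 hj), add_zero]
    rw [this]
    calc _ ≤ 2 * n ^ 2 * 2 ^ b + n ^ 2 * 2 ^ (b + 1) := Nat.add_le_add_right ih _
      _ = 2 * n ^ 2 * 2 ^ (b + 1) := by ring

end Partition

section Lines

open MvPolynomial

/-- The restriction of a polynomial to the parametrized line `t ↦ p + t v`. -/
noncomputable def restrictLine (p v : Fin 3 → ℝ) : MvPolynomial (Fin 3) ℝ →ₐ[ℝ] Polynomial ℝ :=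
  aeval fun i => Polynomial.C (p i) + Polynomial.C (v i) * Polynomial.X

theorem eval_restrictLine (p v : Fin 3 → ℝ) (f : MvPolynomial (Fin 3) ℝ) (t : ℝ) :
    (restrictLine p v f).eval t = eval (p + t • v) f := by
  have : ((Polynomial.evalRingHom t).comp (restrictLine p v).toRingHom) = eval (p + t • v) := by
    refine MvPolynomial.ringHom_ext ?_ ?_
    · intro r; simp [restrictLine]
    · intro i; simp [restrictLine, mul_comm t]
  exact RingHom.congr_fun this f

theorem natDegree_restrictLine_le (p v : Fin 3 → ℝ) (f : MvPolynomial (Fin 3) ℝ) :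
    (restrictLine p v f).natDegree ≤ f.totalDegree := by
  have h := aeval_natDegree_le (R := ℝ) (n := 1) f (le_refl f.totalDegree)
    (fun i => Polynomial.C (p i) + Polynomial.C (v i) * Polynomial.X) (fun i => by
      refine (Polynomial.natDegree_add_le _ _).trans (max_le (by simp) ?_)
      exact (Polynomial.natDegree_C_mul_le _ _).trans Polynomial.natDegree_X_le)
  simpa [restrictLine] using h

end Lines

section LineIncidences

open MvPolynomial

/-- The real zero set of a polynomial in three variables. -/
def polyZeros (f : MvPolynomial (Fin 3) ℝ) : Set (Fin 3 → ℝ) := {x | eval x f = 0}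

theorem mem_polyZeros {f : MvPolynomial (Fin 3) ℝ} {x : Fin 3 → ℝ} :
    x ∈ polyZeros f ↔ eval x f = 0 := Iff.rfl

theorem add_smul_injective {p v : Fin 3 → ℝ} (hv : v ≠ 0) :
    Function.Injective fun t : ℝ => p + t • v := by
  intro s t h
  exact smul_left_injective ℝ hv (add_left_cancel h)

theorem IsLine.exists_param {l : Set (Fin 3 → ℝ)} (hl : IsLine l) :
    ∃ p v : Fin 3 → ℝ, v ≠ 0 ∧ ∀ x, x ∈ l ↔ ∃ t : ℝ, x = p + t • v := by
  obtain ⟨p, v, hv, rfl⟩ := hl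
  exact ⟨p, v, hv, fun x => Iff.rfl⟩

theorem IsLine.exists_param_of_mem {l : Set (Fin 3 → ℝ)} (hl : IsLine l) {p : Fin 3 → ℝ}
    (hp : p ∈ l) : ∃ v : Fin 3 → ℝ, v ≠ 0 ∧ ∀ x, x ∈ l ↔ ∃ t : ℝ, x = p + t • v := by
  obtain ⟨q, v, hv, h⟩ := hl.exists_param
  obtain ⟨s, rfl⟩ := (h p).1 hp
  refine ⟨v, hv, fun x => (h x).trans ⟨?_, ?_⟩⟩
  · rintro ⟨t, rfl⟩; exact ⟨t - s, by module⟩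
  · rintro ⟨t, rfl⟩; exact ⟨t + s, by module⟩

theorem IsLine.eq_of_mem {l l' : Set (Fin 3 → ℝ)} (hl : IsLine l) (hl' : IsLine l')
    {p q : Fin 3 → ℝ} (hpq : p ≠ q) (hp : p ∈ l) (hq : q ∈ l) (hp' : p ∈ l') (hq' : q ∈ l') :
    l = l' := by
  obtain ⟨v, hv, h⟩ := hl.exists_param_of_mem hp
  obtain ⟨v', hv', h'⟩ := hl'.exists_param_of_mem hp'
  obtain ⟨t, ht⟩ := (h q).1 hq
  obtain ⟨t', ht'⟩ := (h' q).1 hq'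
  have ht0 : t ≠ 0 := by rintro rfl; simp at ht; exact hpq ht.symm
  have ht0' : t' ≠ 0 := by rintro rfl; simp at ht'; exact hpq ht'.symm
  have hvv : t • v = t' • v' := add_left_cancel (ht ▸ ht')
  have e1 : v = (t⁻¹ * t') • v' := by
    rw [mul_smul, ← hvv, smul_smul, inv_mul_cancel₀ ht0, one_smul]
  have e2 : v' = (t'⁻¹ * t) • v := by
    rw [mul_smul, hvv, smul_smul, inv_mul_cancel₀ ht0', one_smul]
  ext x
  rw [h, h']
  constructor
  · rintro ⟨s, rfl⟩; exact ⟨s * (t⁻¹ * t'), by rw [mul_smul, ← e1]⟩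
  · rintro ⟨s, rfl⟩; exact ⟨s * (t'⁻¹ * t), by rw [mul_smul, ← e2]⟩

theorem restrictLine_eq_zero_iff (p v : Fin 3 → ℝ) (f : MvPolynomial (Fin 3) ℝ) :
    restrictLine p v f = 0 ↔ ∀ t : ℝ, eval (p + t • v) f = 0 := by
  constructor
  · intro h t; rw [← eval_restrictLine, h, Polynomial.eval_zero]
  · intro h
    exact Polynomial.funext fun t => by rw [eval_restrictLine, h, Polynomial.eval_zero]

/-- A polynomial with more zeros on a line than its degree vanishes on the line. -/
theorem IsLine.subset_polyZeros_of_card {l : Set (Fin 3 → ℝ)} (hl : IsLine l)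
    {f : MvPolynomial (Fin 3) ℝ} {S : Finset (Fin 3 → ℝ)} (hS : ∀ x ∈ S, x ∈ l)
    (hf : ∀ x ∈ S, eval x f = 0) (hcard : f.totalDegree < S.card) : l ⊆ polyZeros f := by
  obtain ⟨p, v, hv, h⟩ := hl.exists_param
  have hpar : ∀ x ∈ S, ∃ t : ℝ, x = p + t • v := fun x hx => (h x).1 (hS x hx)
  choose! t ht using hpar
  have hinj : Set.InjOn t S := by
    intro x hx y hy hxy
    rw [ht x hx, ht y hy, hxy]
  have h0 : restrictLine p v f = 0 := by
    by_contra hne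
    have h1 : (S.image t) ⊆ (restrictLine p v f).roots.toFinset := by
      intro s hs
      obtain ⟨x, hx, rfl⟩ := Finset.mem_image.1 hs
      rw [Multiset.mem_toFinset, Polynomial.mem_roots hne, Polynomial.IsRoot, eval_restrictLine,
        ← ht x hx]
      exact hf x hx
    have h2 := Finset.card_le_card h1
    rw [Finset.card_image_of_injOn hinj] at h2
    have h3 := Multiset.toFinset_card_le (restrictLine p v f).roots
    have h4 := Polynomial.card_roots' (restrictLine p v f)
    have h5 := natDegree_restrictLine_le p v f
    omega
  intro x hx
  obtain ⟨s, rfl⟩ := (h x).1 hx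
  exact (restrictLine_eq_zero_iff p v f).1 h0 s

theorem card_image_le_of_factor {α β γ : Type*} [DecidableEq β] [DecidableEq γ] (s : Finset α)
    (f : α → β) (g : α → γ) (h : ∀ x ∈ s, ∀ y ∈ s, g x = g y → f x = f y) : (s.image f).card ≤ (s.image g).card := by
  have hex : ∀ b ∈ s.image f, ∃ x, x ∈ s ∧ f x = b := fun b hb => by
    simpa using Finset.mem_image.1 hb
  rcases s.eq_empty_or_nonempty with rfl | ⟨x₀, _⟩
  · simp
  have : Nonempty α := ⟨x₀⟩
  choose! r hr hfr using hex
  refine Finset.card_le_card_of_injOn (fun b => g (r b))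
    (fun b hb => Finset.mem_image_of_mem _ (hr b hb)) ?_
  intro b hb b' hb' hbb
  rw [← hfr b hb, ← hfr b' hb']
  exact h _ (hr b hb) _ (hr b' hb') hbb

theorem card_le_image_add_offDiag {α β : Type*} [DecidableEq α] [DecidableEq β] (s : Finset α)
    (c : α → β) :
    s.card ≤ (s.image c).card + (s.offDiag.filter fun x => c x.1 = c x.2).card := by
  rcases s.eq_empty_or_nonempty with rfl | ⟨x₀, _⟩
  · simp
  have : Nonempty α := ⟨x₀⟩
  have hex : ∀ b ∈ s.image c, ∃ x, x ∈ s ∧ c x = b := fun b hb => by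
    simpa using Finset.mem_image.1 hb
  choose! r hr hcr using hex
  have hri : ∀ x ∈ s, r (c x) ∈ s ∧ c (r (c x)) = c x := fun x hx =>
    ⟨hr _ (Finset.mem_image_of_mem _ hx), hcr _ (Finset.mem_image_of_mem _ hx)⟩
  rw [← Finset.card_filter_add_card_filter_not (s := s) (fun x => r (c x) = x)]
  refine add_le_add ?_ ?_
  · refine Finset.card_le_card_of_injOn c ?_ ?_
    · intro x hx
      exact Finset.mem_image_of_mem _ (Finset.mem_filter.1 hx).1
    · intro x hx y hy hxy
      rw [← (Finset.mem_filter.1 hx).2, ← (Finset.mem_filter.1 hy).2, hxy]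
  · refine Finset.card_le_card_of_injOn (fun x => (x, r (c x))) ?_ ?_
    · intro x hx
      have hx' := Finset.mem_filter.1 hx
      simp only [Finset.coe_filter, Set.mem_ofPred_eq, Finset.mem_offDiag]
      exact ⟨⟨hx'.1, (hri x hx'.1).1, fun h => hx'.2 h.symm⟩, (hri x hx'.1).2.symm⟩
    · intro x _ y _ hxy
      exact (Prod.ext_iff.1 hxy).1

theorem totalDegree_list_prod_le (fs : List (MvPolynomial (Fin 3) ℝ)) :
    fs.prod.totalDegree ≤ (fs.map totalDegree).sum := by
  induction fs with
  | nil => simp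
  | cons f fs ih =>
    rw [List.prod_cons, List.map_cons, List.sum_cons]
    exact (totalDegree_mul _ _).trans (Nat.add_le_add_left ih _)

/-- A polynomial without roots between two points has the same sign at both. -/
theorem pos_of_pos_of_no_root {g : Polynomial ℝ} {s t : ℝ}
    (h : ∀ r ∈ Set.uIcc s t, g.eval r ≠ 0) (hs : 0 < g.eval s) : 0 < g.eval t := by
  by_contra hcon
  have hc : ContinuousOn (fun x => g.eval x) (Set.uIcc s t) := g.continuous.continuousOn
  have h0 : (0 : ℝ) ∈ Set.uIcc (g.eval s) (g.eval t) := by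
    rw [Set.mem_uIcc]; right; exact ⟨not_lt.1 hcon, hs.le⟩
  obtain ⟨r, hr, hr0⟩ := intermediate_value_uIcc hc h0
  exact h r hr hr0

/-- A line not contained in the zero set meets few sign cells. -/
theorem card_image_signCell_le {l : Set (Fin 3 → ℝ)} (hl : IsLine l)
    (fs : List (MvPolynomial (Fin 3) ℝ)) (hnl : ¬ l ⊆ polyZeros fs.prod)
    (Q : Finset (Fin 3 → ℝ)) (hQ : ∀ x ∈ Q, x ∈ l) (hQ0 : ∀ x ∈ Q, ∀ f ∈ fs, eval x f ≠ 0) :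
    (Q.image (signCell fs)).card ≤ (fs.map totalDegree).sum + 1 := by
  obtain ⟨p, v, hv, h⟩ := hl.exists_param
  have hpar : ∀ x ∈ Q, ∃ t : ℝ, x = p + t • v := fun x hx => (h x).1 (hQ x hx)
  choose! t ht using hpar
  set g := restrictLine p v fs.prod with hg
  have hg0 : g ≠ 0 := by
    intro h0
    refine hnl fun x hx => ?_
    obtain ⟨s, rfl⟩ := (h x).1 hx
    exact (restrictLine_eq_zero_iff p v _).1 h0 s
  set R := g.roots.toFinset with hR
  have hRcard : R.card ≤ (fs.map totalDegree).sum :=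
    (Multiset.toFinset_card_le _).trans ((Polynomial.card_roots' g).trans
      ((natDegree_restrictLine_le p v _).trans (totalDegree_list_prod_le fs)))
  have hstep : ∀ x ∈ Q, ∀ y ∈ Q, t x ≤ t y →
      (R.filter (· < t x)).card = (R.filter (· < t y)).card → signCell fs x = signCell fs y := by
    intro x hx y hy hxy hcard
    have hsub : R.filter (· < t x) ⊆ R.filter (· < t y) := by
      intro r hr
      rw [Finset.mem_filter] at hr ⊢
      exact ⟨hr.1, hr.2.trans_le hxy⟩
    have heq := Finset.eq_of_subset_of_card_le hsub hcard.ge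
    have hne : ∀ z ∈ Q, g.eval (t z) ≠ 0 := by
      intro z hz
      rw [hg, eval_restrictLine, ← ht z hz, map_list_prod]
      rw [Ne, List.prod_eq_zero_iff, List.mem_map]
      rintro ⟨f, hf, h0⟩
      exact hQ0 z hz f hf h0
    have hnoroot : ∀ r ∈ Set.uIcc (t x) (t y), g.eval r ≠ 0 := by
      intro r hr hr0
      rw [Set.uIcc_of_le hxy, Set.mem_Icc] at hr
      have hrR : r ∈ R := by rw [hR, Multiset.mem_toFinset, Polynomial.mem_roots hg0]; exact hr0
      have hry : r < t y := lt_of_le_of_ne hr.2 fun h => hne y hy (h ▸ hr0)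
      have : r ∈ R.filter (· < t x) := by rw [heq, Finset.mem_filter]; exact ⟨hrR, hry⟩
      exact absurd (Finset.mem_filter.1 this).2 (not_lt.2 hr.1)
    have hnoroot' : ∀ f ∈ fs, ∀ r ∈ Set.uIcc (t x) (t y), (restrictLine p v f).eval r ≠ 0 := by
      intro f hf r hr h0
      refine hnoroot r hr ?_
      rw [hg, map_list_prod, ← Polynomial.coe_evalRingHom, map_list_prod, List.prod_eq_zero_iff,
        List.mem_map]
      exact ⟨restrictLine p v f, List.mem_map_of_mem hf, h0⟩
    refine List.map_congr_left fun f hf => ?_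
    rw [decide_eq_decide, ht x hx, ht y hy, ← eval_restrictLine, ← eval_restrictLine]
    exact ⟨pos_of_pos_of_no_root (hnoroot' f hf),
      pos_of_pos_of_no_root (by rw [Set.uIcc_comm]; exact hnoroot' f hf)⟩
  refine (card_image_le_of_factor Q (signCell fs) (fun x => (R.filter (· < t x)).card) ?_).trans ?_
  · intro x hx y hy hxy
    rcases le_total (t x) (t y) with h' | h'
    · exact hstep x hx y hy h' hxy
    · exact (hstep y hy x hx h' hxy.symm).symm
  · have : Q.image (fun x => (R.filter (· < t x)).card) ⊆
        Finset.range ((fs.map totalDegree).sum + 1) := by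
      intro n hn
      obtain ⟨x, -, rfl⟩ := Finset.mem_image.1 hn
      rw [Finset.mem_range]
      have := Finset.card_filter_le R (· < t x)
      omega
    simpa using Finset.card_le_card this

theorem degreeOf_list_prod_eq_zero (k : Fin 3) (fs : List (MvPolynomial (Fin 3) ℝ))
    (h : ∀ f ∈ fs, degreeOf k f = 0) : degreeOf k fs.prod = 0 := by
  induction fs with
  | nil => simp
  | cons f fs ih =>
    rw [List.prod_cons, ← Nat.le_zero]
    refine (degreeOf_mul_le _ _ _).trans ?_
    rw [h f (by simp), ih fun g hg => h g (by simp [hg])]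

/-- Incidences off the zero set of a partitioning polynomial. -/
theorem exists_partition_incidences (T : Finset (Fin 3)) (hT : T.Nonempty)
    (P : Finset (Fin 3 → ℝ)) (b : ℕ) :
    ∃ f : MvPolynomial (Fin 3) ℝ, f ≠ 0 ∧ (∀ k ∉ T, degreeOf k f = 0) ∧
      f.totalDegree ≤ 2 * T.card ^ 2 * 2 ^ b ∧
      ∀ M : Finset (Set (Fin 3 → ℝ)), (∀ m ∈ M, IsLine m ∧ ¬ m ⊆ polyZeros f) →
        2 ^ (T.card * b) * ∑ m ∈ M, (P.filter fun p => p ∈ m ∧ eval p f ≠ 0).card ≤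
          P.card ^ 2 + 2 ^ (T.card * b) * ((2 * T.card ^ 2 * 2 ^ b + 1) * M.card) := by
  obtain ⟨fs, hlen, h2, h3, h4, h5⟩ := exists_partition_list T hT P (T.card * b)
  have hD : (fs.map totalDegree).sum ≤ 2 * T.card ^ 2 * 2 ^ b :=
    h4.trans (sum_two_pow_div_le _ _ (Finset.card_pos.2 hT))
  refine ⟨fs.prod, ?_, fun k hk => degreeOf_list_prod_eq_zero k fs fun f hf => h3 f hf k hk,
    (totalDegree_list_prod_le fs).trans hD, fun M hM => ?_⟩
  · rw [Ne, List.prod_eq_zero_iff]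
    exact fun h => h2 0 h rfl
  have hev : ∀ p, eval p fs.prod ≠ 0 ↔ ∀ f ∈ fs, eval p f ≠ 0 := by
    intro p
    rw [map_list_prod, Ne, List.prod_eq_zero_iff, List.mem_map]
    push Not
    rfl
  set P' := P.filter fun p => ∀ f ∈ fs, eval p f ≠ 0 with hP'
  set pairs := P'.offDiag.filter fun x => signCell fs x.1 = signCell fs x.2 with hpairs
  have hline : ∀ m ∈ M, (P.filter fun p => p ∈ m ∧ eval p fs.prod ≠ 0).card ≤
      (2 * T.card ^ 2 * 2 ^ b + 1) + (pairs.filter fun x => x.1 ∈ m ∧ x.2 ∈ m).card := by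
    intro m hm
    refine (card_le_image_add_offDiag _ (signCell fs)).trans (add_le_add ?_ ?_)
    · refine (card_image_signCell_le (hM m hm).1 fs (hM m hm).2 _ ?_ ?_).trans
        (Nat.add_le_add_right hD 1)
      · intro x hx; exact (Finset.mem_filter.1 hx).2.1
      · intro x hx; exact (hev x).1 (Finset.mem_filter.1 hx).2.2
    · refine Finset.card_le_card ?_
      intro x hx
      rw [Finset.mem_filter, Finset.mem_offDiag, Finset.mem_filter, Finset.mem_filter, hev,
        hev] at hx
      rw [Finset.mem_filter, hpairs, Finset.mem_filter, Finset.mem_offDiag, hP', Finset.mem_filter,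
        Finset.mem_filter]
      tauto
  have hpairsum : ∑ m ∈ M, (pairs.filter fun x => x.1 ∈ m ∧ x.2 ∈ m).card ≤ pairs.card := by
    rw [← Finset.card_biUnion]
    · exact Finset.card_le_card (Finset.biUnion_subset.2 fun m _ => Finset.filter_subset _ _)
    · intro m hm m' hm' hne
      refine Finset.disjoint_left.2 fun x hx hx' => ?_
      rw [Finset.mem_filter] at hx hx'
      have hxp := hx.1
      rw [hpairs, Finset.mem_filter, Finset.mem_offDiag] at hxp
      exact hne ((hM m hm).1.eq_of_mem (hM m' hm').1 hxp.1.2.2 hx.2.1 hx.2.2 hx'.2.1 hx'.2.2)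
  have hpc : 2 ^ (T.card * b) * pairs.card ≤ P.card ^ 2 := by
    have h6 : pairs.card ≤ ∑ p ∈ P, (P.filter fun q => (∀ f ∈ fs, eval q f ≠ 0) ∧
        signCell fs q = signCell fs p).card := by
      rw [← Finset.card_sigma]
      refine Finset.card_le_card_of_injOn (fun x => ⟨x.1, x.2⟩) ?_ ?_
      · intro x hx
        rw [Finset.mem_coe, hpairs, Finset.mem_filter, Finset.mem_offDiag, hP', Finset.mem_filter,
          Finset.mem_filter] at hx
        rw [Finset.mem_coe, Finset.mem_sigma, Finset.mem_filter]
        exact ⟨hx.1.1.1, hx.1.2.1.1, hx.1.2.1.2, hx.2.symm⟩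
      · intro x _ y _ hxy
        simp only [Sigma.mk.injEq, heq_eq_eq] at hxy
        exact Prod.ext hxy.1 hxy.2
    calc 2 ^ (T.card * b) * pairs.card
        ≤ ∑ p ∈ P, 2 ^ (T.card * b) * (P.filter fun q => (∀ f ∈ fs, eval q f ≠ 0) ∧
            signCell fs q = signCell fs p).card := by
          rw [← Finset.mul_sum]; exact Nat.mul_le_mul_left _ h6
      _ ≤ ∑ _p ∈ P, P.card := Finset.sum_le_sum fun p _ => h5 _ (by simp [signCell, hlen])
      _ = P.card ^ 2 := by simp [sq]
  calc 2 ^ (T.card * b) * ∑ m ∈ M, (P.filter fun p => p ∈ m ∧ eval p fs.prod ≠ 0).card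
      ≤ 2 ^ (T.card * b) * ∑ m ∈ M, ((2 * T.card ^ 2 * 2 ^ b + 1) +
          (pairs.filter fun x => x.1 ∈ m ∧ x.2 ∈ m).card) :=
        Nat.mul_le_mul_left _ (Finset.sum_le_sum hline)
    _ = 2 ^ (T.card * b) * ∑ m ∈ M, (pairs.filter fun x => x.1 ∈ m ∧ x.2 ∈ m).card +
        2 ^ (T.card * b) * ((2 * T.card ^ 2 * 2 ^ b + 1) * M.card) := by
        rw [Finset.sum_add_distrib, Finset.sum_const, smul_eq_mul]; ring
    _ ≤ _ := by
        refine Nat.add_le_add_right ?_ _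
        exact (Nat.mul_le_mul_left _ hpairsum).trans hpc

end LineIncidences

section VanishingAndBezout

open MvPolynomial

theorem IsLine.exists_finset_card {l : Set (Fin 3 → ℝ)} (hl : IsLine l) (n : ℕ) :
    ∃ S : Finset (Fin 3 → ℝ), S.card = n ∧ ∀ x ∈ S, x ∈ l := by
  obtain ⟨p, v, hv, h⟩ := hl.exists_param
  have hinj : Function.Injective fun j : ℕ => p + (j : ℝ) • v :=
    (add_smul_injective hv).comp Nat.cast_injective
  refine ⟨(Finset.range n).map ⟨_, hinj⟩, by simp, ?_⟩
  intro x hx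
  obtain ⟨j, -, rfl⟩ := Finset.mem_map.1 hx
  exact (h _).2 ⟨j, rfl⟩

/-- Parameter counting: a few lines lie on a surface of low degree. -/
theorem exists_vanishing_on_lines (a : ℕ) (T : Finset (Set (Fin 3 → ℝ)))
    (hT : ∀ l ∈ T, IsLine l) (h : (3 * a + 1) * T.card < a ^ 3) :
    ∃ f : MvPolynomial (Fin 3) ℝ, f ≠ 0 ∧ f.totalDegree ≤ 3 * a ∧
      ∀ l ∈ T, l ⊆ polyZeros f := by
  choose! S hScard hS using fun l (hl : l ∈ T) => (hT l hl).exists_finset_card (3 * a + 1)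
  let W : Finset (Fin 3 → ℝ) := T.biUnion S
  have hW : W.card < a ^ 3 := by
    refine lt_of_le_of_lt (Finset.card_biUnion_le_card_mul _ _ (3 * a + 1) ?_) (by linarith)
    intro l hl
    exact (hScard l hl).le
  let φ : (((↥(Finset.univ : Finset (Fin 3))) → Fin a) → ℝ) →ₗ[ℝ] (W → ℝ) :=
    LinearMap.pi fun x => ((MvPolynomial.aeval x.1).toLinearMap).comp (boxPoly Finset.univ a)
  have hker : LinearMap.ker φ ≠ ⊥ := by
    apply LinearMap.ker_ne_bot_of_finrank_lt
    simpa using hW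
  obtain ⟨c, hc, hc0⟩ := Submodule.exists_mem_ne_zero_of_ne_bot hker
  refine ⟨boxPoly Finset.univ a c, boxPoly_ne_zero _ _ _ hc0, ?_, ?_⟩
  · simpa using totalDegree_boxPoly_le Finset.univ a c
  · intro l hl
    refine (hT l hl).subset_polyZeros_of_card (S := S l) (hS l hl) ?_ ?_
    · intro x hx
      have := congrFun (LinearMap.mem_ker.1 hc) ⟨x, Finset.mem_biUnion.2 ⟨l, hl, hx⟩⟩
      simpa [φ, MvPolynomial.aeval_eq_eval] using this
    · rw [hScard l hl]
      have := totalDegree_boxPoly_le Finset.univ a c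
      simp at this
      omega

theorem card_degree_le (D : ℕ) :
    Nat.card {n : Fin 3 →₀ ℕ | (n.sum fun _ e => e) ≤ D} = (D + 3).choose 3 := by
  have hset : {n : Fin 3 →₀ ℕ | (n.sum fun _ e => e) ≤ D} =
      ((Finset.range (D + 1)).biUnion fun m =>
        (Finset.univ : Finset (Fin 3)).finsuppAntidiag m : Finset (Fin 3 →₀ ℕ)) := by
    ext n
    simp only [Set.mem_ofPred_eq, Finset.coe_biUnion, Set.mem_iUnion, Finset.mem_coe,
      Finset.mem_range, Finset.mem_finsuppAntidiag, Finset.subset_univ, and_true, exists_prop]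
    rw [Finsupp.sum_fintype _ _ (by simp)]
    constructor
    · intro h; exact ⟨∑ i, n i, by omega, rfl⟩
    · rintro ⟨m, hm, hs⟩
      have : ∑ i, n i = m := hs
      omega
  rw [hset, Nat.card_coe_set_eq, Set.ncard_coe_finset, Finset.card_biUnion]
  · simp only [Finset.card_finsuppAntidiag_nat_eq_choose, Finset.card_univ, Fintype.card_fin]
    have := Nat.sum_range_add_choose D 2
    rw [← this]
    refine Finset.sum_congr rfl fun i _ => ?_
    rw [show 3 + i - 1 = i + 2 by omega]
    exact (Nat.choose_symm_add (a := i) (b := 2)).symm ▸ rfl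
  · intro i _ j _ hij
    rw [Function.onFun, Finset.disjoint_left]
    intro n h1 h2
    rw [Finset.mem_finsuppAntidiag] at h1 h2
    exact hij (h1.1.symm.trans h2.1)

theorem finrank_restrictTotalDegree (D : ℕ) :
    Module.finrank ℝ (restrictTotalDegree (Fin 3) ℝ D) = (D + 3).choose 3 := by
  rw [← card_degree_le]
  exact Module.finrank_eq_nat_card_basis (basisRestrictSupport ℝ _)

theorem finrank_map_mul (f : MvPolynomial (Fin 3) ℝ) (hf : f ≠ 0) (D : ℕ) :
    Module.finrank ℝ ((restrictTotalDegree (Fin 3) ℝ D).map (LinearMap.mulLeft ℝ f)) =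
      (D + 3).choose 3 := by
  rw [← finrank_restrictTotalDegree]
  exact (Submodule.equivMapOfInjective _
    (by intro x y h; exact mul_left_cancel₀ hf h) _).finrank_eq.symm

theorem six_mul_choose_three (D : ℕ) : 6 * (D + 3).choose 3 = (D + 1) * (D + 2) * (D + 3) := by
  have := Nat.descFactorial_eq_factorial_mul_choose (D + 3) 3
  simp [Nat.descFactorial, Nat.factorial] at this
  rw [← this]; ring

theorem second_difference_choose_le (a b m : ℕ) :
    (m + a + b + 3).choose 3 + (m + 3).choose 3 ≤
      (m + b + 3).choose 3 + (m + a + 3).choose 3 + a * b * (m + a + b + 2) := by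
  have h1 := six_mul_choose_three (m + a + b)
  have h2 := six_mul_choose_three m
  have h3 := six_mul_choose_three (m + b)
  have h4 := six_mul_choose_three (m + a)
  suffices 6 * ((m + a + b + 3).choose 3 + (m + 3).choose 3) ≤
      6 * ((m + b + 3).choose 3 + (m + a + 3).choose 3 + a * b * (m + a + b + 2)) by omega
  rw [mul_add, mul_add, mul_add, h1, h2, h3, h4]
  nlinarith [Nat.zero_le (a * b * a), Nat.zero_le (a * b * b), Nat.zero_le (a * b)]

/-- A family of polynomials of degree at most `D`, independent modulo `(f, g)` with `f` irreducible
not dividing `g`, has dimension growing at most linearly in `D`. -/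
theorem finrank_le_of_disjoint_span {V : Type*} [AddCommGroup V] [Module ℝ V]
    [FiniteDimensional ℝ V] {f g : MvPolynomial (Fin 3) ℝ} (hf : Irreducible f) (hfg : ¬ f ∣ g)
    (D : ℕ) (hD : f.totalDegree + g.totalDegree ≤ D) (φ : V →ₗ[ℝ] MvPolynomial (Fin 3) ℝ)
    (hφ : ∀ x, (φ x).totalDegree ≤ D) (hspan : ∀ x, φ x ∈ Ideal.span {f, g} → x = 0) :
    Module.finrank ℝ V ≤ f.totalDegree * g.totalDegree * (D + 2) := by
  have hf0 : f ≠ 0 := hf.ne_zero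
  have hg0 : g ≠ 0 := by rintro rfl; exact hfg (dvd_zero _)
  have hprime : Prime f := hf.prime
  obtain ⟨m, rfl⟩ : ∃ m, D = m + f.totalDegree + g.totalDegree :=
    ⟨D - (f.totalDegree + g.totalDegree), by omega⟩
  set a := f.totalDegree with ha
  set b := g.totalDegree with hb
  let A := (restrictTotalDegree (Fin 3) ℝ (m + b)).map (LinearMap.mulLeft ℝ f)
  let B := (restrictTotalDegree (Fin 3) ℝ (m + a)).map (LinearMap.mulLeft ℝ g)
  let I := (restrictTotalDegree (Fin 3) ℝ m).map (LinearMap.mulLeft ℝ (f * g))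
  have hinf : A ⊓ B ≤ I := by
    rintro x ⟨⟨u, hu, rfl⟩, ⟨w, hw, hwe⟩⟩
    simp only [LinearMap.mulLeft_apply] at hwe
    have hdvd : f ∣ g * w := ⟨u, hwe⟩
    obtain ⟨c, rfl⟩ := (hprime.dvd_or_dvd hdvd).resolve_left hfg
    refine ⟨c, ?_, by simp only [LinearMap.mulLeft_apply]; rw [← hwe]; ring⟩
    rw [SetLike.mem_coe, mem_restrictTotalDegree] at hw ⊢
    by_cases hc : c = 0
    · simp [hc]
    · rw [totalDegree_mul_of_isDomain hf0 hc] at hw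
      omega
  have hAB := Submodule.finrank_sup_add_finrank_inf_eq A B
  rw [finrank_map_mul f hf0, finrank_map_mul g hg0] at hAB
  have hI : Module.finrank ℝ (A ⊓ B : Submodule ℝ _) ≤ (m + 3).choose 3 := by
    rw [← finrank_map_mul (f * g) (mul_ne_zero hf0 hg0)]
    exact Submodule.finrank_mono hinf
  have hsup : ∀ x ∈ A ⊔ B, x ∈ Ideal.span {f, g} ∧ x.totalDegree ≤ m + a + b := by
    intro x hx
    obtain ⟨y, ⟨u, hu, rfl⟩, z, ⟨w, hw, rfl⟩, rfl⟩ := Submodule.mem_sup.1 hx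
    rw [SetLike.mem_coe, mem_restrictTotalDegree] at hu hw
    simp only [LinearMap.mulLeft_apply]
    constructor
    · exact Ideal.mem_span_pair.2 ⟨u, w, by ring⟩
    · refine (totalDegree_add _ _).trans (max_le ?_ ?_)
      · refine (totalDegree_mul _ _).trans ?_; omega
      · refine (totalDegree_mul _ _).trans ?_; omega
  have hinj : Function.Injective φ := by
    rw [← LinearMap.ker_eq_bot, LinearMap.ker_eq_bot']
    intro x hx
    exact hspan x (hx ▸ Ideal.zero_mem _)
  have hdisj : LinearMap.range φ ⊓ (A ⊔ B) = ⊥ := by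
    rw [eq_bot_iff]
    rintro x ⟨⟨y, rfl⟩, hy⟩
    rw [hspan y (hsup _ hy).1]; simp
  have hle : LinearMap.range φ ⊔ (A ⊔ B) ≤ restrictTotalDegree (Fin 3) ℝ (m + a + b) := by
    refine sup_le ?_ ?_
    · rintro x ⟨y, rfl⟩
      exact (mem_restrictTotalDegree _ _ _).2 (hφ y)
    · intro x hx
      exact (mem_restrictTotalDegree _ _ _).2 (hsup x hx).2
  have hU := Submodule.finrank_sup_add_finrank_inf_eq (LinearMap.range φ) (A ⊔ B)
  rw [hdisj, finrank_bot, LinearMap.finrank_range_of_inj hinj] at hU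
  have hU2 := Submodule.finrank_mono hle
  rw [finrank_restrictTotalDegree] at hU2
  have := second_difference_choose_le a b m
  omega

/-- Elimination: two coprime polynomials have a nonzero combination not involving a given
variable. -/
theorem exists_mem_span_degreeOf_eq_zero {f g : MvPolynomial (Fin 3) ℝ} (hf : Irreducible f)
    (hfg : ¬ f ∣ g) (k : Fin 3) :
    ∃ h : MvPolynomial (Fin 3) ℝ, h ≠ 0 ∧ h ∈ Ideal.span {f, g} ∧ h.degreeOf k = 0 := by
  by_contra hcon
  push Not at hcon
  set ab := f.totalDegree * g.totalDegree
  let n := 2 * ab + 2 + f.totalDegree + g.totalDegree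
  have hcard : ({k}ᶜ : Finset (Fin 3)).card = 2 := by
    rw [Finset.card_compl]; simp
  have := finrank_le_of_disjoint_span hf hfg (2 * n) (by omega) (boxPoly {k}ᶜ n)
    (fun x => (totalDegree_boxPoly_le _ _ _).trans (by rw [hcard]))
    (fun x hx => by
      by_contra hx0
      exact hcon _ (boxPoly_ne_zero _ _ _ hx0) hx (degreeOf_boxPoly _ _ _ _ (by simp)))
  rw [Module.finrank_fintype_fun_eq_card] at this
  simp only [Fintype.card_fun, Fintype.card_fin, Fintype.card_coe, hcard] at this
  change n ^ 2 ≤ ab * (2 * n + 2) at this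
  have hn : 2 * ab + 2 ≤ n := by omega
  nlinarith

theorem IsLine.exists_affine_separating {l l' : Set (Fin 3 → ℝ)} (hl : IsLine l) (hl' : IsLine l')
    (hne : l ≠ l') : ∃ h : MvPolynomial (Fin 3) ℝ, h.totalDegree ≤ 1 ∧ l' ⊆ polyZeros h ∧
      ¬ l ⊆ polyZeros h := by
  obtain ⟨x, hx, hx'⟩ : ∃ x ∈ l, x ∉ l' := by
    by_contra hcon
    push Not at hcon
    obtain ⟨p, v, hv, h⟩ := hl.exists_param
    have h0 : p ∈ l := (h _).2 ⟨0, by simp⟩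
    have h1 : p + v ∈ l := (h _).2 ⟨1, by simp⟩
    exact hne (hl.eq_of_mem hl' (by simpa using hv) h0 h1 (hcon _ h0) (hcon _ h1))
  obtain ⟨p, v, hv, h⟩ := hl'.exists_param
  let H : Fin 3 → Fin 3 → MvPolynomial (Fin 3) ℝ := fun i k =>
    C (v k) * X i - C (v i) * X k + C (p k * v i - p i * v k)
  have hH : ∀ i k y, eval y (H i k) = (y i - p i) * v k - (y k - p k) * v i := by
    intro i k y; simp [H]; ring
  by_contra hcon
  push Not at hcon
  obtain ⟨k, hk⟩ := Function.ne_iff.1 hv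
  simp only [Pi.zero_apply] at hk
  apply hx'
  refine (h x).2 ⟨(x k - p k) / v k, ?_⟩
  funext i
  have hdeg : (H i k).totalDegree ≤ 1 := by
    refine (totalDegree_add _ _).trans (max_le ((totalDegree_sub _ _).trans (max_le ?_ ?_)) ?_)
    · refine (totalDegree_mul _ _).trans ?_
      rw [totalDegree_C, totalDegree_X]
    · refine (totalDegree_mul _ _).trans ?_
      rw [totalDegree_C, totalDegree_X]
    · rw [totalDegree_C]; omega
  have hsub : l' ⊆ polyZeros (H i k) := by
    intro y hy
    obtain ⟨t, rfl⟩ := (h y).1 hy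
    rw [mem_polyZeros, hH]
    simp; ring
  have := hcon (H i k) hdeg hsub hx
  rw [mem_polyZeros, hH] at this
  simp only [Pi.add_apply, Pi.smul_apply, smul_eq_mul]
  field_simp
  linarith

theorem IsLine.exists_coord {l : Set (Fin 3 → ℝ)} (hl : IsLine l) :
    ∃ p v : Fin 3 → ℝ, ∃ c : Fin 3, v c ≠ 0 ∧ ∀ x, x ∈ l ↔ ∃ t : ℝ, x = p + t • v := by
  obtain ⟨p, v, hv, h⟩ := hl.exists_param
  obtain ⟨c, hc⟩ := Function.ne_iff.1 hv
  exact ⟨p, v, c, hc, h⟩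

/-- Bezout for lines: two coprime surfaces of degrees `a`, `b` share at most `a * b` lines. -/
theorem card_lines_le_of_not_dvd {f g : MvPolynomial (Fin 3) ℝ} (hf : Irreducible f)
    (hfg : ¬ f ∣ g) (T : Finset (Set (Fin 3 → ℝ))) (hT : ∀ l ∈ T, IsLine l)
    (hTf : ∀ l ∈ T, l ⊆ polyZeros f) (hTg : ∀ l ∈ T, l ⊆ polyZeros g) :
    T.card ≤ f.totalDegree * g.totalDegree := by
  by_contra hcon
  push Not at hcon
  choose! p v c hc hpar using fun l (hl : l ∈ T) => (hT l hl).exists_coord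
  have hsep : ∀ l ∈ T, ∀ l' ∈ T, l ≠ l' → ∃ h : MvPolynomial (Fin 3) ℝ, h.totalDegree ≤ 1 ∧
      l' ⊆ polyZeros h ∧ ¬ l ⊆ polyZeros h :=
    fun l hl l' hl' hne => (hT l hl).exists_affine_separating (hT l' hl') hne
  choose! h hdeg hvan hnvan using hsep
  have hres : ∀ l ∈ T, ∀ F, restrictLine (p l) (v l) F = 0 ↔ l ⊆ polyZeros F := by
    intro l hl F
    rw [restrictLine_eq_zero_iff]
    constructor
    · intro h0 x hx
      obtain ⟨t, rfl⟩ := (hpar l hl x).1 hx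
      exact h0 t
    · intro h0 t
      exact h0 ((hpar l hl _).2 ⟨t, rfl⟩)
  let H : Set (Fin 3 → ℝ) → MvPolynomial (Fin 3) ℝ := fun l => ∏ l' ∈ T.erase l, h l l'
  set ab := f.totalDegree * g.totalDegree
  set t := T.card with ht
  let n := f.totalDegree + g.totalDegree + ab * (t + 2) + 1
  let ψ : ∀ l : T, Polynomial.degreeLT ℝ n →ₗ[ℝ] MvPolynomial (Fin 3) ℝ := fun l =>
    (LinearMap.mulLeft ℝ (H l)).comp
      (((Polynomial.aeval (X (c l) : MvPolynomial (Fin 3) ℝ)).toLinearMap).comp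
        (Polynomial.degreeLT ℝ n).subtype)
  let φ : (T → Polynomial.degreeLT ℝ n) →ₗ[ℝ] MvPolynomial (Fin 3) ℝ :=
    ∑ l : T, (ψ l).comp (LinearMap.proj l)
  have hφ : ∀ q, φ q = ∑ l : T, H l * Polynomial.aeval (X (c l)) (q l : Polynomial ℝ) := by
    intro q; simp [φ, ψ, LinearMap.sum_apply]
  have : Module.finrank ℝ (T → Polynomial.degreeLT ℝ n) ≤ ab * ((n + t) + 2) := by
    refine finrank_le_of_disjoint_span hf hfg (n + t) (by omega) φ ?_ ?_
    · intro q
      rw [hφ]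
      refine totalDegree_finsetSum_le fun l _ => (totalDegree_mul _ _).trans ?_
      have h1 : (H l).totalDegree ≤ t := by
        refine (totalDegree_finsetProd _ _).trans ?_
        refine (Finset.sum_le_card_nsmul _ _ 1 ?_).trans ?_
        · intro l' hl'
          rw [Finset.mem_erase] at hl'
          exact hdeg _ l.2 _ hl'.2 hl'.1.symm
        · rw [smul_eq_mul, mul_one]; exact Finset.card_le_card (Finset.erase_subset _ _)
      have h2 : (Polynomial.aeval (X (c l) : MvPolynomial (Fin 3) ℝ)
          (q l : Polynomial ℝ)).totalDegree ≤ n := by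
        rw [Polynomial.aeval_eq_sum_range]
        refine totalDegree_finsetSum_le fun i hi => ?_
        refine (totalDegree_smul_le _ _).trans ?_
        rw [totalDegree_X_pow]
        have := Polynomial.mem_degreeLT.1 (q l).2
        by_cases h0 : (q l : Polynomial ℝ) = 0
        · simp [h0] at hi; omega
        · have := (Polynomial.natDegree_lt_iff_degree_lt h0).2 this
          simp at hi; omega
      omega
    · intro q hq
      have hzero : ∀ l ∈ T, l ⊆ polyZeros (φ q) := by
        intro l hl x hx
        obtain ⟨u, w, hu⟩ := Ideal.mem_span_pair.1 hq
        rw [mem_polyZeros, ← hu, map_add, map_mul, map_mul, mem_polyZeros.1 (hTf l hl hx),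
          mem_polyZeros.1 (hTg l hl hx)]
        ring
      funext l
      have h0 := (hres l l.2 _).2 (hzero l l.2)
      rw [hφ, map_sum, Finset.sum_eq_single l] at h0
      · rw [map_mul] at h0
        have hne : restrictLine (p l) (v l) (H l) ≠ 0 := by
          rw [map_prod, Finset.prod_ne_zero_iff]
          intro l' hl' h1
          rw [Finset.mem_erase] at hl'
          exact hnvan _ l.2 _ hl'.2 hl'.1.symm ((hres l l.2 _).1 h1)
        have h1 := (mul_eq_zero.1 h0).resolve_left hne
        rw [← Polynomial.aeval_algHom_apply] at h1
        have h2 : restrictLine (p l) (v l) (X (c l)) =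
            Polynomial.C (v l (c l)) * Polynomial.X + Polynomial.C (p l (c l)) := by
          refine Polynomial.funext fun s => ?_
          rw [eval_restrictLine]; simp; ring
        have h3 : Polynomial.aeval (Polynomial.C (v l (c l)) * Polynomial.X +
            Polynomial.C (p l (c l))) (q l : Polynomial ℝ) = 0 := h2 ▸ h1
        apply Subtype.ext
        change (q l : Polynomial ℝ) = 0
        rw [← Polynomial.comp_eq_aeval, Polynomial.comp_eq_zero_iff] at h3
        rcases h3 with h3 | ⟨-, h3⟩
        · exact h3
        · exfalso
          have := congrArg (fun r => Polynomial.coeff r 1) h3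
          simp [Polynomial.coeff_C] at this
          exact hc l l.2 this
      · intro l' _ hne
        rw [map_mul]
        have : restrictLine (p l) (v l) (H l') = 0 := by
          rw [map_prod]
          have hmem : (l : Set (Fin 3 → ℝ)) ∈ T.erase l' :=
            Finset.mem_erase.2 ⟨fun he => hne (Subtype.ext he.symm), l.2⟩
          refine Finset.prod_eq_zero hmem ?_
          exact (hres l l.2 _).2 (hvan _ l'.2 _ l.2 (fun he => hne (Subtype.ext he)))
        rw [this, zero_mul]
      · simp
  rw [Module.finrank_pi_fintype] at this
  simp only [Finset.sum_const, Finset.card_univ, Fintype.card_coe, smul_eq_mul,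
    (Polynomial.degreeLTEquiv ℝ n).finrank_eq, Module.finrank_fintype_fun_eq_card,
    Fintype.card_fin] at this
  rw [← ht] at this
  have hn : ab * (t + 2) + 1 ≤ n := by omega
  nlinarith

end VanishingAndBezout

section FlatIdeals

open MvPolynomial

theorem totalDegree_pderiv_le (i : Fin 3) (h : MvPolynomial (Fin 3) ℝ) :
    (pderiv i h).totalDegree ≤ h.totalDegree - 1 := by
  rw [totalDegree, Finset.sup_le_iff]
  intro m hm
  rw [mem_support_iff, coeff_pderiv] at hm
  have h1 : m + Finsupp.single i 1 ∈ h.support := by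
    rw [mem_support_iff]; intro h0; simp [h0] at hm
  have h2 := le_totalDegree h1
  rw [Finsupp.sum_add_index' (by simp) (by simp), Finsupp.sum_single_index rfl] at h2
  omega

theorem eq_C_of_pderiv_eq_zero (h : MvPolynomial (Fin 3) ℝ) (h0 : ∀ i, pderiv i h = 0) :
    h = C (coeff 0 h) := by
  ext m
  rw [coeff_C]
  split_ifs with hm
  · rw [← hm]
  · obtain ⟨i, hi⟩ := Finsupp.ne_iff.1 (Ne.symm hm)
    have h1 := congrArg (coeff (m - Finsupp.single i 1)) (h0 i)
    rw [coeff_pderiv, coeff_zero] at h1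
    have h2 : m - Finsupp.single i 1 + Finsupp.single i 1 = m := by
      apply tsub_add_cancel_of_le
      rw [Finsupp.single_le_iff]
      simp at hi; omega
    rw [h2] at h1
    refine (mul_eq_zero.1 h1).resolve_right ?_
    positivity

theorem pderiv_eq_zero_of_degreeOf_eq_zero (i : Fin 3) (h : MvPolynomial (Fin 3) ℝ)
    (h0 : h.degreeOf i = 0) : pderiv i h = 0 := by
  apply pderiv_eq_zero_of_notMem_vars
  intro hi
  obtain ⟨m, hm, hmi⟩ := (mem_vars_iff_mem_support i).1 hi
  have := monomial_le_degreeOf i hm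
  rw [Finsupp.mem_support_iff] at hmi
  omega

/-- Polynomials all of whose iterated derivatives of order at most `n` along `D₁`, `D₂` vanish
at `p`. -/
noncomputable def flatIdeal (D₁ D₂ : Derivation ℝ (MvPolynomial (Fin 3) ℝ) (MvPolynomial (Fin 3) ℝ))
    (p : Fin 3 → ℝ) : ℕ → Ideal (MvPolynomial (Fin 3) ℝ)
  | 0 => RingHom.ker (eval p)
  | n + 1 =>
    { carrier := {g | g ∈ flatIdeal D₁ D₂ p n ∧ D₁ g ∈ flatIdeal D₁ D₂ p n ∧
        D₂ g ∈ flatIdeal D₁ D₂ p n}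
      add_mem' := by
        rintro a b ⟨ha, ha1, ha2⟩ ⟨hb, hb1, hb2⟩
        refine ⟨add_mem ha hb, ?_, ?_⟩
        · rw [map_add]; exact add_mem ha1 hb1
        · rw [map_add]; exact add_mem ha2 hb2
      zero_mem' := by simp
      smul_mem' := by
        rintro c g ⟨hg, hg1, hg2⟩
        refine ⟨Ideal.mul_mem_left _ _ hg, ?_, ?_⟩
        · rw [smul_eq_mul, Derivation.leibniz]
          exact add_mem (Ideal.mul_mem_left _ _ hg1) (Ideal.mul_mem_right _ _ hg)
        · rw [smul_eq_mul, Derivation.leibniz]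
          exact add_mem (Ideal.mul_mem_left _ _ hg2) (Ideal.mul_mem_right _ _ hg) }

variable {D₁ D₂ : Derivation ℝ (MvPolynomial (Fin 3) ℝ) (MvPolynomial (Fin 3) ℝ)}
  {p : Fin 3 → ℝ}

theorem mem_flatIdeal_zero {g : MvPolynomial (Fin 3) ℝ} :
    g ∈ flatIdeal D₁ D₂ p 0 ↔ eval p g = 0 := Iff.rfl

theorem mem_flatIdeal_succ {n : ℕ} {g : MvPolynomial (Fin 3) ℝ} :
    g ∈ flatIdeal D₁ D₂ p (n + 1) ↔ g ∈ flatIdeal D₁ D₂ p n ∧ D₁ g ∈ flatIdeal D₁ D₂ p n ∧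
      D₂ g ∈ flatIdeal D₁ D₂ p n := Iff.rfl

theorem mem_flatIdeal_of_mul_mem {n : ℕ} {u g : MvPolynomial (Fin 3) ℝ} (hu : eval p u ≠ 0)
    (h : u * g ∈ flatIdeal D₁ D₂ p n) : g ∈ flatIdeal D₁ D₂ p n := by
  induction n generalizing g with
  | zero =>
    rw [mem_flatIdeal_zero, map_mul] at h
    exact (mul_eq_zero.1 h).resolve_left hu
  | succ n ih =>
    obtain ⟨h0, h1, h2⟩ := mem_flatIdeal_succ.1 h
    have hg := ih h0
    rw [Derivation.leibniz, smul_eq_mul, smul_eq_mul] at h1 h2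
    refine mem_flatIdeal_succ.2 ⟨hg, ih ?_, ih ?_⟩
    · exact (Ideal.add_mem_iff_left _ (Ideal.mul_mem_right _ _ hg)).1 h1
    · exact (Ideal.add_mem_iff_left _ (Ideal.mul_mem_right _ _ hg)).1 h2

theorem mem_flatIdeal_of_derivation_eq_zero {f : MvPolynomial (Fin 3) ℝ} (hf : eval p f = 0)
    (h1 : D₁ f = 0) (h2 : D₂ f = 0) (n : ℕ) : f ∈ flatIdeal D₁ D₂ p n := by
  induction n with
  | zero => exact hf
  | succ n ih => exact mem_flatIdeal_succ.2 ⟨ih, by simp [h1], by simp [h2]⟩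

theorem mem_flatIdeal_of_mul_derivation_mem {f w c : MvPolynomial (Fin 3) ℝ}
    (hf : ∀ n, f ∈ flatIdeal D₁ D₂ p n) (hw : eval p w = 0) (hc : eval p c ≠ 0)
    (h1 : c * D₁ w ∈ Ideal.span {w, f}) (h2 : c * D₂ w ∈ Ideal.span {w, f}) (n : ℕ) :
    w ∈ flatIdeal D₁ D₂ p n := by
  induction n with
  | zero => exact hw
  | succ n ih =>
    have hle : Ideal.span {w, f} ≤ flatIdeal D₁ D₂ p n := by
      rw [Ideal.span_le]
      rintro x (rfl | rfl)
      · exact ih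
      · exact hf n
    exact mem_flatIdeal_succ.2 ⟨ih, mem_flatIdeal_of_mul_mem hc (hle h1),
      mem_flatIdeal_of_mul_mem hc (hle h2)⟩

/-- The derivation `f_i ∂_k - f_k ∂_i`, tangent to the level sets of `f`. -/
noncomputable def tangentDerivation (f : MvPolynomial (Fin 3) ℝ) (i k : Fin 3) :
    Derivation ℝ (MvPolynomial (Fin 3) ℝ) (MvPolynomial (Fin 3) ℝ) :=
  pderiv i f • pderiv k - pderiv k f • pderiv i

theorem tangentDerivation_apply (f : MvPolynomial (Fin 3) ℝ) (i k : Fin 3)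
    (g : MvPolynomial (Fin 3) ℝ) : tangentDerivation f i k g =
      pderiv i f * pderiv k g - pderiv k f * pderiv i g := by
  simp [tangentDerivation, Derivation.sub_apply, Derivation.smul_apply]

theorem tangentDerivation_self (f : MvPolynomial (Fin 3) ℝ) (i k : Fin 3) :
    tangentDerivation f i k f = 0 := by
  rw [tangentDerivation_apply]; ring

theorem eq_zero_of_mem_flatIdeal {f : MvPolynomial (Fin 3) ℝ} {i j k : Fin 3}
    (hijk : ∀ a : Fin 3, a = i ∨ a = j ∨ a = k) (hp : eval p (pderiv i f) ≠ 0)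
    (h : MvPolynomial (Fin 3) ℝ) (hi : pderiv i h = 0)
    (hh : ∀ n, h ∈ flatIdeal (tangentDerivation f i j) (tangentDerivation f i k) p n) :
    h = 0 := by
  induction hd : h.totalDegree using Nat.strong_induction_on generalizing h with
  | _ d ih =>
    have hcomm : ∀ a, pderiv i (pderiv a h) = 0 := by
      intro a
      have : pderiv i (pderiv a h) = pderiv a (pderiv i h) := by
        ext m
        simp only [coeff_pderiv]
        rcases eq_or_ne i a with rfl | hne
        · rfl
        · rw [add_right_comm]
          simp [hne, hne.symm]
          ring
      rw [this, hi, map_zero]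
    have hzero : ∀ a, pderiv a h = 0 := by
      rcases Nat.eq_zero_or_pos d with h0 | hpos
      · intro a
        rw [totalDegree_eq_zero_iff_eq_C.1 (hd.trans h0), pderiv_C]
      intro a
      have hlt : (pderiv a h).totalDegree < d := by
        have := totalDegree_pderiv_le a h
        omega
      refine ih _ hlt _ (hcomm a) ?_ rfl
      rcases hijk a with rfl | rfl | rfl
      · intro n; rw [hi]; exact zero_mem _
      · intro n
        have := (mem_flatIdeal_succ.1 (hh (n + 1))).2.1
        rw [tangentDerivation_apply, hi, mul_zero, sub_zero] at this
        exact mem_flatIdeal_of_mul_mem hp this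
      · intro n
        have := (mem_flatIdeal_succ.1 (hh (n + 1))).2.2
        rw [tangentDerivation_apply, hi, mul_zero, sub_zero] at this
        exact mem_flatIdeal_of_mul_mem hp this
    have hC := eq_C_of_pderiv_eq_zero h hzero
    have := mem_flatIdeal_zero.1 (hh 0)
    rw [hC, eval_C] at this
    rw [hC, this, C_0]

/-- A polynomial flat at a regular zero of the irreducible polynomial `f` is a multiple of `f`. -/
theorem dvd_of_mem_flatIdeal {f : MvPolynomial (Fin 3) ℝ} (hf : Irreducible f) {i j k : Fin 3}
    (hijk : ∀ a : Fin 3, a = i ∨ a = j ∨ a = k) (hpf : eval p f = 0)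
    (hp : eval p (pderiv i f) ≠ 0) (g : MvPolynomial (Fin 3) ℝ)
    (hg : ∀ n, g ∈ flatIdeal (tangentDerivation f i j) (tangentDerivation f i k) p n) :
    f ∣ g := by
  by_contra hfg
  obtain ⟨h, h0, hspan, hdeg⟩ := exists_mem_span_degreeOf_eq_zero hf hfg i
  refine h0 (eq_zero_of_mem_flatIdeal hijk hp h (pderiv_eq_zero_of_degreeOf_eq_zero i h hdeg) ?_)
  intro n
  have hle : Ideal.span {f, g} ≤ flatIdeal (tangentDerivation f i j) (tangentDerivation f i k) p n := by
    rw [Ideal.span_le]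
    rintro x (rfl | rfl)
    · exact mem_flatIdeal_of_derivation_eq_zero hpf (tangentDerivation_self _ _ _)
        (tangentDerivation_self _ _ _) n
    · exact hg n
  exact hle hspan

/-- If the coefficients `c a` are proportional, modulo `f`, to constants and `∑ c a * g a`
vanishes modulo `f`, then `f` divides a constant-coefficient combination of the `g a`. -/
theorem dvd_sum_of_proportional {f : MvPolynomial (Fin 3) ℝ} (hf : Irreducible f)
    {i j k : Fin 3} (hijk : ∀ a : Fin 3, a = i ∨ a = j ∨ a = k) (hpf : eval p f = 0)
    (hp : eval p (pderiv i f) ≠ 0) {ι : Type*} [Fintype ι]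
    (c g : ι → MvPolynomial (Fin 3) ℝ) (b : ι) (hcb : eval p (c b) ≠ 0)
    (hprop : ∀ m, m = j ∨ m = k → ∀ a,
      f ∣ c b * tangentDerivation f i m (c a) - c a * tangentDerivation f i m (c b))
    (hsum : f ∣ ∑ a, c a * g a) :
    f ∣ ∑ a, C (eval p (c a)) * g a := by
  have hfmem := mem_flatIdeal_of_derivation_eq_zero hpf (tangentDerivation_self f i j)
    (tangentDerivation_self f i k)
  set J := flatIdeal (tangentDerivation f i j) (tangentDerivation f i k) p with hJ
  let w : ι → MvPolynomial (Fin 3) ℝ := fun a => eval p (c b) • c a - eval p (c a) • c b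
  have hw : ∀ a, ∀ n, w a ∈ J n := by
    intro a
    have key : ∀ m, m = j ∨ m = k → c b * tangentDerivation f i m (w a) ∈ Ideal.span {w a, f} := by
      intro m hm
      obtain ⟨u, hu⟩ := hprop m hm a
      refine Ideal.mem_span_pair.2 ⟨tangentDerivation f i m (c b), C (eval p (c b)) * u, ?_⟩
      simp only [w, map_sub, Derivation.map_smul]
      simp only [smul_eq_C_mul]
      linear_combination (-C (eval p (c b))) * hu
    refine mem_flatIdeal_of_mul_derivation_mem hfmem ?_ hcb (key j (Or.inl rfl))
      (key k (Or.inr rfl))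
    simp [w, smul_eval]; ring
  refine dvd_of_mem_flatIdeal hf hijk hpf hp _ fun n => ?_
  refine mem_flatIdeal_of_mul_mem hcb ?_
  have h1 : c b * ∑ a, C (eval p (c a)) * g a =
      C (eval p (c b)) * (∑ a, c a * g a) - ∑ a, w a * g a := by
    rw [Finset.mul_sum, Finset.mul_sum, ← Finset.sum_sub_distrib]
    refine Finset.sum_congr rfl fun a _ => ?_
    simp only [w, smul_eq_C_mul]
    ring
  rw [h1]
  refine sub_mem (Ideal.mul_mem_left _ _ ?_) (Ideal.sum_mem _ fun a ha =>
    Ideal.mul_mem_right _ _ (hw a n))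
  exact Ideal.mem_of_dvd _ hsum (hfmem n)

end FlatIdeals

section RegularZeros

open MvPolynomial

theorem derivative_restrictLine (p v : Fin 3 → ℝ) (f : MvPolynomial (Fin 3) ℝ) :
    Polynomial.derivative (restrictLine p v f) =
      ∑ a, Polynomial.C (v a) * restrictLine p v (pderiv a f) := by
  induction f using MvPolynomial.induction_on with
  | C c =>
    have : restrictLine p v (C c) = Polynomial.C c :=
      Polynomial.funext fun t => by rw [eval_restrictLine]; simp
    simp [this]
  | add f g hf hg => simp only [map_add, hf, hg, mul_add, Finset.sum_add_distrib]
  | mul_X f n hf =>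
    have hX : restrictLine p v (X n) = Polynomial.C (p n) + Polynomial.C (v n) * Polynomial.X :=
      Polynomial.funext fun t => by rw [eval_restrictLine]; simp; ring
    have hterm : ∀ a, Polynomial.C (v a) * restrictLine p v (pderiv a (f * X n)) =
        Polynomial.C (v a) * restrictLine p v (pderiv a f) * restrictLine p v (X n) +
          if a = n then restrictLine p v f * Polynomial.C (v n) else 0 := by
      intro a
      rw [pderiv_mul, map_add, map_mul, map_mul]
      split_ifs with ha
      · subst ha; rw [pderiv_X_self, map_one]; ring
      · rw [pderiv_X_of_ne (Ne.symm ha), map_zero]; ring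
    rw [Finset.sum_congr rfl fun a _ => hterm a, Finset.sum_add_distrib, ← Finset.sum_mul,
      Finset.sum_ite_eq' Finset.univ n, map_mul, Polynomial.derivative_mul, hf, hX]
    simp

theorem eval_eq_of_degreeOf_eq_zero {i : Fin 3} {h : MvPolynomial (Fin 3) ℝ}
    (hi : h.degreeOf i = 0) (x : Fin 3 → ℝ) (t : ℝ) : eval (Function.update x i t) h = eval x h := by
  rw [eval_eq', eval_eq']
  refine Finset.sum_congr rfl fun d hd => ?_
  congr 1
  refine Finset.prod_congr rfl fun a _ => ?_
  rcases eq_or_ne a i with rfl | ha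
  · have := monomial_le_degreeOf a hd
    rw [hi] at this
    simp [Nat.le_zero.1 this]
  · rw [Function.update_of_ne ha]

theorem exists_neg_of_pderiv_ne_zero {f : MvPolynomial (Fin 3) ℝ} {i : Fin 3} {p : Fin 3 → ℝ}
    (hpf : eval p f = 0) (hp : eval p (pderiv i f) ≠ 0) :
    ∃ t, eval (Function.update p i t) f < 0 := by
  by_contra hcon
  push Not at hcon
  set φ := restrictLine p (Pi.single i 1) f with hφ
  have hupd : ∀ t : ℝ, p + t • Pi.single i (1 : ℝ) = Function.update p i (p i + t) := by
    intro t
    funext a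
    rcases eq_or_ne a i with rfl | ha
    · simp
    · simp [ha]
  have hmin : IsLocalMin (fun t => φ.eval t) 0 := by
    refine Filter.Eventually.of_forall fun t => ?_
    simp only [hφ, eval_restrictLine, zero_smul, add_zero, hpf, hupd]
    exact hcon _
  have := hmin.deriv_eq_zero
  rw [Polynomial.deriv, hφ, derivative_restrictLine, Polynomial.eval_finsetSum,
    Finset.sum_eq_single i] at this
  · rw [Polynomial.eval_mul, eval_restrictLine] at this
    simp at this
    exact hp this
  · intro b _ hb; simp [hb]
  · simp

/-- A polynomial vanishing on all zeros of an irreducible `f` that has a regular zero is a multiple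
of `f`. -/
theorem dvd_of_forall_zero {f g : MvPolynomial (Fin 3) ℝ} (hf : Irreducible f) {i : Fin 3}
    {p : Fin 3 → ℝ} (hpf : eval p f = 0) (hp : eval p (pderiv i f) ≠ 0)
    (hg : ∀ x, eval x f = 0 → eval x g = 0) : f ∣ g := by
  by_contra hfg
  obtain ⟨h, h0, hspan, hdeg⟩ := exists_mem_span_degreeOf_eq_zero hf hfg i
  have hvan : ∀ x, eval x f = 0 → eval x h = 0 := by
    intro x hx
    obtain ⟨u, w, hu⟩ := Ideal.mem_span_pair.1 hspan
    rw [← hu]; simp [hx, hg x hx]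
  obtain ⟨t₁, ht₁⟩ := exists_neg_of_pderiv_ne_zero hpf hp
  obtain ⟨t₂, ht₂⟩ := exists_neg_of_pderiv_ne_zero (f := -f) (i := i) (p := p) (by simp [hpf])
    (by simpa using hp)
  rw [map_neg, neg_lt_zero] at ht₂
  have hc : ∀ t, Continuous fun x : Fin 3 → ℝ => eval (Function.update x i t) f := by
    intro t
    exact (MvPolynomial.continuous_eval f).comp (continuous_id.update i continuous_const)
  have hev : ∀ᶠ x in nhds p, eval (Function.update x i t₁) f < 0 ∧
      0 < eval (Function.update x i t₂) f :=
    ((hc t₁).continuousAt.eventually_lt_const ht₁).and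
      ((hc t₂).continuousAt.eventually_const_lt ht₂)
  obtain ⟨η, hη, hball⟩ := Metric.eventually_nhds_iff.1 hev
  apply h0
  refine MvPolynomial.funext_set (fun a => Set.Ioo (p a - η) (p a + η))
    (fun a => Set.Ioo_infinite (by linarith)) fun x hx => ?_
  rw [map_zero]
  have hxd : dist x p < η := by
    rw [dist_pi_lt_iff hη]
    intro a
    have := hx a (Set.mem_univ a)
    rw [Real.dist_eq, abs_lt]
    constructor <;> linarith [this.1, this.2]
  obtain ⟨h1, h2⟩ := hball hxd
  have hcont : Continuous fun t : ℝ => eval (Function.update x i t) f :=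
    (MvPolynomial.continuous_eval f).comp (continuous_const.update i continuous_id)
  obtain ⟨t, ht⟩ := mem_range_of_exists_le_of_exists_ge (c := (0 : ℝ)) hcont ⟨t₁, h1.le⟩ ⟨t₂, h2.le⟩
  rw [← eval_eq_of_degreeOf_eq_zero hdeg x t]
  exact hvan _ ht

end RegularZeros

section DifferentialFields

/-- A derivation into the fraction field extends to the fraction field. -/
theorem exists_derivation_extension {R K : Type*} [CommRing R] [Algebra ℝ R] [Field K]
    [Algebra ℝ K] [Algebra R K] [IsScalarTower ℝ R K]
    (hK : ∀ z : K, ∃ a b : R, algebraMap R K b ≠ 0 ∧ z * algebraMap R K b = algebraMap R K a)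
    (d : Derivation ℝ R K) (hd : ∀ a, algebraMap R K a = 0 → d a = 0) :
    ∃ δ : Derivation ℝ K K, ∀ a, δ (algebraMap R K a) = d a := by
  choose num den hden hnum using hK
  let F : K → K := fun z => (d (num z) - z * d (den z)) / algebraMap R K (den z)
  have hF : ∀ z a b, algebraMap R K b ≠ 0 → z * algebraMap R K b = algebraMap R K a →
      F z * algebraMap R K b = d a - z * d b := by
    intro z a b hb hz
    have h0 : d (num z * b - a * den z) = 0 := by
      apply hd
      rw [map_sub, map_mul, map_mul, ← hnum, ← hz]; ring
    rw [map_sub, Derivation.leibniz, Derivation.leibniz] at h0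
    simp only [Algebra.smul_def] at h0
    rw [← hnum, ← hz] at h0
    have hdz := hden z
    simp only [F]
    rw [div_mul_eq_mul_div, div_eq_iff hdz]
    linear_combination h0
  have hFadd : ∀ z w, F (z + w) = F z + F w := by
    intro z w
    have hz := hF z _ _ (hden z) (hnum z)
    have hw := hF w _ _ (hden w) (hnum w)
    have hzw := hF (z + w) (num z * den w + num w * den z) (den z * den w)
      (by rw [map_mul]; exact mul_ne_zero (hden z) (hden w))
      (by simp only [map_mul, map_add]; rw [← hnum, ← hnum]; ring)
    simp only [map_add, map_mul, Derivation.leibniz, Algebra.smul_def] at hzw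
    apply mul_right_cancel₀ (mul_ne_zero (hden z) (hden w))
    rw [hzw, ← hnum, ← hnum]
    linear_combination (-algebraMap R K (den w)) * hz - (algebraMap R K (den z)) * hw
  have hFmul : ∀ z w, F (z * w) = z * F w + w * F z := by
    intro z w
    have hz := hF z _ _ (hden z) (hnum z)
    have hw := hF w _ _ (hden w) (hnum w)
    have hzw := hF (z * w) (num z * num w) (den z * den w)
      (by rw [map_mul]; exact mul_ne_zero (hden z) (hden w))
      (by simp only [map_mul]; rw [← hnum, ← hnum]; ring)
    simp only [map_mul, Derivation.leibniz, Algebra.smul_def] at hzw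
    apply mul_right_cancel₀ (mul_ne_zero (hden z) (hden w))
    rw [hzw, ← hnum, ← hnum]
    linear_combination (-w * algebraMap R K (den w)) * hz - (z * algebraMap R K (den z)) * hw
  have hFalg : ∀ a, F (algebraMap R K a) = d a := by
    intro a
    have := hF (algebraMap R K a) a 1 (by simp) (by simp)
    simpa using this
  have hFsmul : ∀ (c : ℝ) z, F (c • z) = c • F z := by
    intro c z
    have h1 : algebraMap ℝ K c = algebraMap R K (algebraMap ℝ R c) :=
      IsScalarTower.algebraMap_apply ℝ R K c
    rw [Algebra.smul_def, Algebra.smul_def, hFmul, h1, hFalg, Derivation.map_algebraMap]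
    ring
  exact ⟨Derivation.mk' { toFun := F, map_add' := hFadd, map_smul' := hFsmul } hFmul, hFalg⟩

/-- Integrability: a nondegenerate Hessian whose derivative is a multiple of itself modulo the
cubic form identities satisfies the structure equations of a quadric. -/
theorem exists_quadric_structure {K : Type*} [Field K] [CharZero K] [Algebra ℝ K]
    (δ₁ δ₂ : Derivation ℝ K K) (hcomm : ∀ x, δ₁ (δ₂ x) = δ₂ (δ₁ x))
    (r s t : K) (hs : δ₁ s = δ₂ r) (ht : δ₁ t = δ₂ s) (H : K) (hH : H = r * t - s ^ 2) (hH0 : H ≠ 0)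
    (h1 : 4 * H * δ₁ r = 3 * δ₁ H * r) (h2 : 4 * H * δ₂ r = δ₂ H * r + 2 * δ₁ H * s)
    (h3 : 4 * H * δ₂ s = δ₁ H * t + 2 * δ₂ H * s) (h4 : 4 * H * δ₂ t = 3 * δ₂ H * t) :
    ∃ u v σ : K, δ₁ r = 3 * u * r ∧ δ₂ r = v * r + 2 * u * s ∧ δ₂ s = u * t + 2 * v * s ∧
      δ₂ t = 3 * v * t ∧ δ₁ u = u ^ 2 - σ * r ∧ δ₂ u = u * v - σ * s ∧ δ₁ v = u * v - σ * s ∧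
      δ₂ v = v ^ 2 - σ * t ∧ δ₁ σ = u * σ ∧ δ₂ σ = v * σ := by
  obtain ⟨u, hu⟩ : ∃ u, δ₁ H = 4 * H * u := ⟨δ₁ H / (4 * H), by field_simp⟩
  obtain ⟨v, hv⟩ : ∃ v, δ₂ H = 4 * H * v := ⟨δ₂ H / (4 * H), by field_simp⟩
  have hH_four : (4 * H : K) ≠ 0 := mul_ne_zero (by norm_num) hH0
  have d4 : ∀ δ : Derivation ℝ K K, δ 4 = 0 := fun δ => by
    simpa using δ.map_natCast 4
  have d3 : ∀ δ : Derivation ℝ K K, δ 3 = 0 := fun δ => by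
    simpa using δ.map_natCast 3
  have d2 : ∀ δ : Derivation ℝ K K, δ 2 = 0 := fun δ => by
    simpa using δ.map_natCast 2
  have e1 : δ₁ r = 3 * u * r := mul_left_cancel₀ hH_four (by rw [h1, hu]; ring)
  have e2 : δ₂ r = v * r + 2 * u * s := mul_left_cancel₀ hH_four (by rw [h2, hu, hv]; ring)
  have e3 : δ₂ s = u * t + 2 * v * s := mul_left_cancel₀ hH_four (by rw [h3, hu, hv]; ring)
  have e4 : δ₂ t = 3 * v * t := mul_left_cancel₀ hH_four (by rw [h4, hv]; ring)
  have hs' : δ₁ s = v * r + 2 * u * s := hs.trans e2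
  have ht' : δ₁ t = u * t + 2 * v * s := ht.trans e3
  have huv : δ₁ v = δ₂ u := by
    have := hcomm H
    rw [hu, hv] at this
    simp only [Derivation.leibniz, smul_eq_mul, d4, hu, hv] at this
    apply mul_left_cancel₀ hH_four
    linear_combination this
  have c1 : (δ₂ u - u * v) * r = (δ₁ u - u ^ 2) * s := by
    have := hcomm r
    rw [e1, e2] at this
    simp only [Derivation.leibniz, smul_eq_mul, d3, d2, map_add, e1, e2, hs', huv] at this
    have h2 : (2 : K) ≠ 0 := by norm_num
    apply mul_left_cancel₀ h2
    linear_combination -this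
  have c2 : (δ₂ v - v ^ 2) * r = (δ₁ u - u ^ 2) * t := by
    have := hcomm s
    rw [hs', e3] at this
    simp only [Derivation.leibniz, smul_eq_mul, d2, map_add, e2, e3, ht', hs', huv] at this
    linear_combination -this
  have c3 : (δ₂ v - v ^ 2) * s = (δ₂ u - u * v) * t := by
    have := hcomm t
    rw [ht', e4] at this
    simp only [Derivation.leibniz, smul_eq_mul, d3, d2, map_add, e3, e4, ht', huv] at this
    have h2 : (2 : K) ≠ 0 := by norm_num
    apply mul_left_cancel₀ h2
    linear_combination -this
  obtain ⟨σ, hσ⟩ : ∃ σ, 2 * H * σ = -((δ₁ u - u ^ 2) * t - 2 * (δ₂ u - u * v) * s +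
      (δ₂ v - v ^ 2) * r) :=
    ⟨-((δ₁ u - u ^ 2) * t - 2 * (δ₂ u - u * v) * s + (δ₂ v - v ^ 2) * r) / (2 * H), by field_simp⟩
  have hH_two : (2 * H : K) ≠ 0 := mul_ne_zero (by norm_num) hH0
  have f1 : δ₁ u = u ^ 2 - σ * r := by
    apply mul_left_cancel₀ hH_two
    rw [hH] at hσ ⊢
    linear_combination r * hσ + 2 * s * c1 - r * c2
  have f2 : δ₂ u = u * v - σ * s := by
    apply mul_left_cancel₀ hH_two
    rw [hH] at hσ ⊢
    linear_combination s * hσ + t * c1 - r * c3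
  have f3 : δ₂ v = v ^ 2 - σ * t := by
    apply mul_left_cancel₀ hH_two
    rw [hH] at hσ ⊢
    linear_combination t * hσ + t * c2 - 2 * s * c3
  have f2' : δ₁ v = u * v - σ * s := huv.trans f2
  have g1 : (δ₁ σ - u * σ) * s = (δ₂ σ - v * σ) * r := by
    have := hcomm u
    rw [f1, f2] at this
    simp only [Derivation.leibniz, Derivation.leibniz_pow, smul_eq_mul, nsmul_eq_mul, map_sub, e2,
      hs', f1, f2, f2'] at this
    push_cast at this
    linear_combination -this
  have g2 : (δ₁ σ - u * σ) * t = (δ₂ σ - v * σ) * s := by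
    have := hcomm v
    rw [f3, f2'] at this
    simp only [Derivation.leibniz, Derivation.leibniz_pow, smul_eq_mul, nsmul_eq_mul, map_sub, e3,
      ht', f2, f3, f2'] at this
    push_cast at this
    linear_combination -this
  refine ⟨u, v, σ, e1, e2, e3, e4, f1, f2, f2', f3, ?_, ?_⟩
  · apply mul_left_cancel₀ hH0
    rw [hH]
    linear_combination r * g2 - s * g1
  · apply mul_left_cancel₀ hH0
    rw [hH]
    linear_combination s * g2 - t * g1

/-- Coefficients of the osculating quadric of a graph `z = z(x, y)`, in the basis
`1, z, x, y, z², zx, zy, x², xy, y²`. -/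
def quadricCoeff {K : Type*} [Field K] (z x y a b r s t u v σ : K) : Fin 10 → K :=
  ![-(z - a * x - b * y) * (1 + u * x + v * y) + σ * (z - a * x - b * y) ^ 2 / 2 -
      (r * x ^ 2 + 2 * s * x * y + t * y ^ 2) / 2,
    1 + u * x + v * y - σ * (z - a * x - b * y),
    -a * (1 + u * x + v * y) + u * (z - a * x - b * y) + σ * a * (z - a * x - b * y) +
      r * x + s * y,
    -b * (1 + u * x + v * y) + v * (z - a * x - b * y) + σ * b * (z - a * x - b * y) +
      s * x + t * y,
    σ / 2, -u - σ * a, -v - σ * b, a * u + σ * a ^ 2 / 2 - r / 2,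
    a * v + b * u + σ * a * b - s, b * v + σ * b ^ 2 / 2 - t / 2]

/-- Values of the basis `1, z, x, y, z², zx, zy, x², xy, y²`. -/
def quadricBasis {A : Type*} [CommRing A] (z x y : A) : Fin 10 → A :=
  ![1, z, x, y, z ^ 2, z * x, z * y, x ^ 2, x * y, y ^ 2]

theorem sum_quadricCoeff_mul_quadricBasis {K : Type*} [Field K] (z x y a b r s t u v σ : K)
    (h2 : (2 : K) ≠ 0) :
    ∑ n, quadricCoeff z x y a b r s t u v σ n * quadricBasis z x y n = 0 := by
  simp [Fin.sum_univ_succ, quadricCoeff, quadricBasis]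
  field_simp
  ring

theorem exists_quadricCoeff_ne_zero {K : Type*} [Field K] [CharZero K] (z x y a b r s t u v σ : K) :
    ∃ n, quadricCoeff z x y a b r s t u v σ n ≠ 0 := by
  by_contra hcon
  push Not at hcon
  have h4 : σ / 2 = 0 := hcon 4
  have h5 : -u - σ * a = 0 := hcon 5
  have h6 : -v - σ * b = 0 := hcon 6
  have h1 : 1 + u * x + v * y - σ * (z - a * x - b * y) = 0 := hcon 1
  have hσ : σ = 0 := by
    rcases div_eq_zero_iff.1 h4 with h | h
    · exact h
    · norm_num at h
  have hu : u = 0 := by rw [hσ] at h5; simpa using h5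
  have hv : v = 0 := by rw [hσ] at h6; simpa using h6
  rw [hσ, hu, hv] at h1
  simp at h1

theorem derivation_quadricCoeff_eq {K : Type*} [Field K] [CharZero K] [Algebra ℝ K]
    (δ : Derivation ℝ K K) {z x y a b r s t u v σ α β w : K}
    (hz : δ z = a * α + b * β) (hx : δ x = α) (hy : δ y = β) (ha : δ a = r * α + s * β)
    (hb : δ b = s * α + t * β) (hw : w = u * α + v * β)
    (hr : δ r = w * r + 2 * u * (r * α + s * β))
    (hs : δ s = w * s + u * (s * α + t * β) + v * (r * α + s * β))
    (ht : δ t = w * t + 2 * v * (s * α + t * β))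
    (hu : δ u = u * w - σ * (r * α + s * β)) (hv : δ v = v * w - σ * (s * α + t * β))
    (hσ : δ σ = w * σ) (n : Fin 10) :
    δ (quadricCoeff z x y a b r s t u v σ n) = w * quadricCoeff z x y a b r s t u v σ n := by
  have d2 : δ 2 = 0 := by simpa using δ.map_natCast 2
  have hdiv : ∀ e : K, δ (e / 2) = δ e / 2 := by
    intro e
    rw [Derivation.leibniz_div_const _ _ _ d2, smul_eq_mul]; ring
  subst hw
  fin_cases n <;>
  simp [quadricCoeff, Derivation.leibniz, Derivation.leibniz_pow, hdiv, d2, hz, hx, hy, ha, hb, hr,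
    hs, ht, hu, hv, hσ] <;> ring

end DifferentialFields

section TangentDerivations

open MvPolynomial

theorem pderiv_comm (a b : Fin 3) (h : MvPolynomial (Fin 3) ℝ) :
    pderiv a (pderiv b h) = pderiv b (pderiv a h) := by
  ext m
  simp only [coeff_pderiv]
  rcases eq_or_ne a b with rfl | hne
  · rfl
  · rw [add_right_comm]
    simp [hne, hne.symm]
    ring

/-- The second fundamental form of `f = 0` over the coordinate plane `x_i = 0`, scaled by
`f_i ^ 3`. -/
noncomputable def hessForm (f : MvPolynomial (Fin 3) ℝ) (i a b : Fin 3) :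
    MvPolynomial (Fin 3) ℝ :=
  pderiv b f * tangentDerivation f i a (pderiv i f) -
    pderiv i f * tangentDerivation f i a (pderiv b f)

theorem hessForm_comm (f : MvPolynomial (Fin 3) ℝ) (i a b : Fin 3) :
    hessForm f i a b = hessForm f i b a := by
  simp only [hessForm, tangentDerivation_apply, pderiv_comm b a, pderiv_comm i]
  ring

/-- The derivative of `hessForm`, scaled by `f_i ^ 5`. -/
noncomputable def cubicForm (f : MvPolynomial (Fin 3) ℝ) (i c a b : Fin 3) :
    MvPolynomial (Fin 3) ℝ :=
  pderiv i f * tangentDerivation f i c (hessForm f i a b) -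
    3 * (hessForm f i a b * tangentDerivation f i c (pderiv i f))

/-- The function field of an irreducible surface. -/
theorem exists_function_field {f : MvPolynomial (Fin 3) ℝ} (hf : Irreducible f) :
    ∃ (K : Type) (_ : Field K) (_ : CharZero K) (_ : Algebra ℝ K)
      (π : MvPolynomial (Fin 3) ℝ →ₐ[ℝ] K),
      (∀ g, π g = 0 ↔ f ∣ g) ∧ ∀ z, ∃ a b, π b ≠ 0 ∧ z * π b = π a := by
  have hprime : (Ideal.span {f}).IsPrime := (Ideal.span_singleton_prime hf.ne_zero).2 hf.prime
  let A := MvPolynomial (Fin 3) ℝ ⧸ Ideal.span {f}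
  let K := FractionRing A
  let π : MvPolynomial (Fin 3) ℝ →ₐ[ℝ] K := IsScalarTower.toAlgHom ℝ (MvPolynomial (Fin 3) ℝ) K
  have hπalg : ∀ g, π g = algebraMap (MvPolynomial (Fin 3) ℝ) K g := fun g => rfl
  have hπ' : ∀ g, π g = algebraMap A K (Ideal.Quotient.mk _ g) := fun g =>
    (hπalg g).trans (IsScalarTower.algebraMap_apply (MvPolynomial (Fin 3) ℝ) A K g)
  have hπ : ∀ g, π g = 0 ↔ f ∣ g := by
    intro g
    rw [hπ', map_eq_zero_iff _ (IsFractionRing.injective A K), Ideal.Quotient.eq_zero_iff_mem,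
      Ideal.mem_span_singleton]
  refine ⟨K, inferInstance, algebraRat.charZero K, inferInstance, π, hπ, ?_⟩
  intro z
  obtain ⟨a, b, hb, rfl⟩ := IsFractionRing.div_surjective (A := A) z
  obtain ⟨a, rfl⟩ := Ideal.Quotient.mk_surjective a
  obtain ⟨b, rfl⟩ := Ideal.Quotient.mk_surjective b
  have hb0 : π b ≠ 0 := by
    rw [hπ']
    exact IsFractionRing.to_map_ne_zero_of_mem_nonZeroDivisors hb
  refine ⟨a, b, hb0, ?_⟩
  rw [← hπ', ← hπ', div_mul_cancel₀ _ hb0]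

/-- The function field of an irreducible surface with its two commuting coordinate
derivations. -/
theorem exists_tangent_derivations {f : MvPolynomial (Fin 3) ℝ} (hf : Irreducible f) (i : Fin 3)
    (hi : ¬ f ∣ pderiv i f) :
    ∃ (K : Type) (_ : Field K) (_ : CharZero K) (_ : Algebra ℝ K)
      (π : MvPolynomial (Fin 3) ℝ →ₐ[ℝ] K) (δ : Fin 3 → Derivation ℝ K K),
      (∀ g, π g = 0 ↔ f ∣ g) ∧ (∀ z, ∃ a b, π b ≠ 0 ∧ z * π b = π a) ∧
      (∀ k g, π (pderiv i f) * δ k (π g) = π (tangentDerivation f i k g)) ∧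
      ∀ j k x, δ j (δ k x) = δ k (δ j x) := by
  obtain ⟨K, _, hchar, _, π, hπ, hfrac⟩ := exists_function_field hf
  let _ : Algebra (MvPolynomial (Fin 3) ℝ) K := π.toRingHom.toAlgebra
  have hπalg : ∀ g, π g = algebraMap (MvPolynomial (Fin 3) ℝ) K g := fun g => rfl
  have _ : IsScalarTower ℝ (MvPolynomial (Fin 3) ℝ) K :=
    IsScalarTower.of_algebraMap_eq fun c => by
      rw [← hπalg, AlgHom.commutes]
  have hF0 : π (pderiv i f) ≠ 0 := fun h => hi ((hπ _).1 h)
  have hext : ∀ k : Fin 3, ∃ δ : Derivation ℝ K K, ∀ g,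
      π (pderiv i f) * δ (π g) = π (tangentDerivation f i k g) := by
    intro k
    let d : Derivation ℝ (MvPolynomial (Fin 3) ℝ) K :=
      (π (pderiv i f))⁻¹ • (Algebra.linearMap (MvPolynomial (Fin 3) ℝ) K).compDer
        (tangentDerivation f i k)
    have hd : ∀ g, d g = (π (pderiv i f))⁻¹ * π (tangentDerivation f i k g) := fun g => rfl
    obtain ⟨δ, hδ⟩ := exists_derivation_extension (R := MvPolynomial (Fin 3) ℝ) (K := K) hfrac d
      (by
        intro g hg
        obtain ⟨u, rfl⟩ := (hπ g).1 hg
        rw [hd, Derivation.leibniz, tangentDerivation_self, smul_zero, add_zero, smul_eq_mul,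
          mul_comm, (hπ _).2 (dvd_mul_right _ _), zero_mul] )
    refine ⟨δ, fun g => ?_⟩
    rw [hπalg g, hδ, hd, mul_inv_cancel_left₀ hF0]
  choose δ hδ using hext
  refine ⟨K, inferInstance, hchar, inferInstance, π, δ, hπ, hfrac, hδ, ?_⟩
  · intro j k
    have hX : ∀ (k a : Fin 3), δ k (π (X a)) = (if k = a then 1 else 0) -
        (if i = a then π (pderiv k f) / π (pderiv i f) else 0) := by
      intro k a
      apply mul_left_cancel₀ hF0
      rw [hδ, tangentDerivation_apply]
      split_ifs with h1 h2 h2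
      · subst h1; subst h2; simp [hF0]
      · subst h1; rw [pderiv_X_self, pderiv_X_of_ne (Ne.symm h2)]; simp
      · subst h2; rw [pderiv_X_self, pderiv_X_of_ne (Ne.symm h1)]
        simp; field_simp
      · rw [pderiv_X_of_ne (Ne.symm h1), pderiv_X_of_ne (Ne.symm h2)]; simp
    have hdiv : ∀ j k : Fin 3, δ j (π (pderiv k f) / π (pderiv i f)) =
        - π (hessForm f i j k) / π (pderiv i f) ^ 3 := by
      intro j k
      rw [Derivation.leibniz_div, eq_div_iff (pow_ne_zero _ hF0), hessForm, map_sub, map_mul,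
        map_mul, ← hδ, ← hδ]
      simp only [smul_eq_mul]
      field_simp
      ring
    have hcX : ∀ a, ⁅δ j, δ k⁆ (π (X a)) = 0 := by
      intro a
      rw [Derivation.commutator_apply, hX, hX]
      have hone : ∀ (m : Fin 3) (P : Prop) [Decidable P], δ m (if P then (1 : K) else 0) = 0 := by
        intro m P _; split_ifs <;> simp
      rw [map_sub, map_sub, hone, hone]
      split_ifs with h
      · rw [hdiv, hdiv, hessForm_comm]; ring
      · simp
    have hcπ : ∀ g, ⁅δ j, δ k⁆ (π g) = 0 := by
      intro g
      induction g using MvPolynomial.induction_on with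
      | C c => rw [← algebraMap_eq, AlgHom.commutes, Derivation.map_algebraMap]
      | add g h hg hh => rw [map_add, map_add, hg, hh, add_zero]
      | mul_X g a hg => rw [map_mul, Derivation.leibniz, hg, hcX]; simp
    intro x
    obtain ⟨a, b, hb, hab⟩ := hfrac x
    have h1 := hcπ a
    rw [← hab, Derivation.leibniz, hcπ b, smul_zero, zero_add, smul_eq_mul] at h1
    have h2 := (mul_eq_zero.1 h1).resolve_left hb
    rw [Derivation.commutator_apply] at h2
    exact sub_eq_zero.1 h2

end TangentDerivations

section LinesInSurfaces

open MvPolynomial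

theorem sum_pderiv_eq_zero_of_line {g : MvPolynomial (Fin 3) ℝ} {p v : Fin 3 → ℝ}
    (hg : ∀ t : ℝ, eval (p + t • v) g = 0) (t : ℝ) :
    eval (p + t • v) (∑ a, C (v a) * pderiv a g) = 0 := by
  have h := derivative_restrictLine p v g
  rw [(restrictLine_eq_zero_iff p v g).2 hg, Polynomial.derivative_zero] at h
  have h2 := congrArg (Polynomial.eval t) h
  simp only [Polynomial.eval_zero, Polynomial.eval_finsetSum, Polynomial.eval_mul,
    Polynomial.eval_C, eval_restrictLine] at h2
  simp only [map_sum, map_mul, eval_C]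
  exact h2.symm

theorem sum_tangentDerivation_eq_zero_of_line {f g : MvPolynomial (Fin 3) ℝ} {p v : Fin 3 → ℝ}
    (i : Fin 3) (hf : ∀ t : ℝ, eval (p + t • v) f = 0) (hg : ∀ t : ℝ, eval (p + t • v) g = 0)
    (t : ℝ) : eval (p + t • v) (∑ a, C (v a) * tangentDerivation f i a g) = 0 := by
  have h1 := sum_pderiv_eq_zero_of_line hf t
  have h2 := sum_pderiv_eq_zero_of_line hg t
  simp only [Fin.sum_univ_three, tangentDerivation_apply, map_add, map_mul, map_sub,
    eval_C] at h1 h2 ⊢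
  linear_combination eval (p + t • v) (pderiv i f) * h2 - eval (p + t • v) (pderiv i g) * h1

theorem sum_hessForm_eq_zero_of_line {f : MvPolynomial (Fin 3) ℝ} {p v : Fin 3 → ℝ}
    (i : Fin 3) (hf : ∀ t : ℝ, eval (p + t • v) f = 0) (t : ℝ) :
    eval (p + t • v) (∑ a, ∑ b, C (v a) * (C (v b) * hessForm f i a b)) = 0 := by
  have hu := sum_pderiv_eq_zero_of_line hf
  have h2 := sum_tangentDerivation_eq_zero_of_line i hf hu t
  have h1 := hu t
  have hC : ∀ a (c : ℝ), tangentDerivation f i a (C c) = 0 := fun a c =>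
    Derivation.map_algebraMap _ c
  simp only [Fin.sum_univ_three, map_add, map_mul, Derivation.leibniz, hC, smul_eq_mul, eval_C,
    hessForm, map_sub, mul_zero, add_zero] at h1 h2 ⊢
  linear_combination (-eval (p + t • v) (pderiv i f)) * h2 +
    (v 0 * eval (p + t • v) (tangentDerivation f i 0 (pderiv i f)) +
     v 1 * eval (p + t • v) (tangentDerivation f i 1 (pderiv i f)) +
     v 2 * eval (p + t • v) (tangentDerivation f i 2 (pderiv i f))) * h1

theorem sum_cubicForm_eq_zero_of_line {f : MvPolynomial (Fin 3) ℝ} {p v : Fin 3 → ℝ}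
    (i : Fin 3) (hf : ∀ t : ℝ, eval (p + t • v) f = 0) (t : ℝ) :
    eval (p + t • v) (∑ c, ∑ a, ∑ b, C (v c) * (C (v a) * (C (v b) * cubicForm f i c a b))) =
      0 := by
  have hu := sum_hessForm_eq_zero_of_line i hf
  have h2 := sum_tangentDerivation_eq_zero_of_line i hf hu t
  have h1 := hu t
  have hC : ∀ a (c : ℝ), tangentDerivation f i a (C c) = 0 := fun a c =>
    Derivation.map_algebraMap _ c
  simp only [Fin.sum_univ_three, map_add, map_mul, Derivation.leibniz, hC, smul_eq_mul, eval_C,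
    cubicForm, map_sub, mul_zero, add_zero, map_ofNat] at h1 h2 ⊢
  linear_combination (eval (p + t • v) (pderiv i f)) * h2 -
    3 * (v 0 * eval (p + t • v) (tangentDerivation f i 0 (pderiv i f)) +
     v 1 * eval (p + t • v) (tangentDerivation f i 1 (pderiv i f)) +
     v 2 * eval (p + t • v) (tangentDerivation f i 2 (pderiv i f))) * h1

/-- The covariants of a quadratic form `(r, s, t)` and a cubic form `(a, b, c, d)` that vanish
when the quadratic form divides the cubic form. -/
def apolarity {A : Type*} [CommRing A] (r s t a b c d : A) : Fin 4 → A :=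
  ![4 * (r * t - s ^ 2) * a - (3 * a * t + r * c - 2 * s * b) * r,
    4 * (r * t - s ^ 2) * b -
      ((b * t + 3 * r * d - 2 * s * c) * r + 2 * (3 * a * t + r * c - 2 * s * b) * s),
    4 * (r * t - s ^ 2) * c -
      ((3 * a * t + r * c - 2 * s * b) * t + 2 * (b * t + 3 * r * d - 2 * s * c) * s),
    4 * (r * t - s ^ 2) * d - (b * t + 3 * r * d - 2 * s * c) * t]

theorem apolarity_eq_zero_of_two_roots {r s t a b c d v₁ v₂ w₁ w₂ : ℝ}
    (hΔ : v₁ * w₂ - v₂ * w₁ ≠ 0)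
    (hv : r * v₁ ^ 2 + 2 * s * v₁ * v₂ + t * v₂ ^ 2 = 0)
    (hw : r * w₁ ^ 2 + 2 * s * w₁ * w₂ + t * w₂ ^ 2 = 0)
    (cv : a * v₁ ^ 3 + b * v₁ ^ 2 * v₂ + c * v₁ * v₂ ^ 2 + d * v₂ ^ 3 = 0)
    (cw : a * w₁ ^ 3 + b * w₁ ^ 2 * w₂ + c * w₁ * w₂ ^ 2 + d * w₂ ^ 3 = 0) :
    (∀ n, apolarity r s t a b c d n = 0) ∧ (r * t - s ^ 2 = 0 → r = 0 ∧ s = 0 ∧ t = 0) := by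
  set Δ := v₁ * w₂ - v₂ * w₁ with hΔdef
  obtain ⟨β, hβ⟩ : ∃ β, Δ ^ 2 * β =
      -(r * v₁ * w₁ + s * (v₁ * w₂ + v₂ * w₁) + t * v₂ * w₂) :=
    ⟨-(r * v₁ * w₁ + s * (v₁ * w₂ + v₂ * w₁) + t * v₂ * w₂) / Δ ^ 2, by field_simp⟩
  obtain ⟨m, hm⟩ : ∃ m, Δ ^ 3 * m = 3 * a * v₁ ^ 2 * w₁ + b * (v₁ ^ 2 * w₂ + 2 * v₁ * v₂ * w₁) +
      c * (2 * v₁ * v₂ * w₂ + v₂ ^ 2 * w₁) + 3 * d * v₂ ^ 2 * w₂ :=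
    ⟨(3 * a * v₁ ^ 2 * w₁ + b * (v₁ ^ 2 * w₂ + 2 * v₁ * v₂ * w₁) +
      c * (2 * v₁ * v₂ * w₂ + v₂ ^ 2 * w₁) + 3 * d * v₂ ^ 2 * w₂) / Δ ^ 3, by field_simp⟩
  obtain ⟨n, hn⟩ : ∃ n, Δ ^ 3 * n = 3 * a * w₁ ^ 2 * v₁ + b * (w₁ ^ 2 * v₂ + 2 * w₁ * w₂ * v₁) +
      c * (2 * w₁ * w₂ * v₂ + w₂ ^ 2 * v₁) + 3 * d * w₂ ^ 2 * v₂ :=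
    ⟨(3 * a * w₁ ^ 2 * v₁ + b * (w₁ ^ 2 * v₂ + 2 * w₁ * w₂ * v₁) +
      c * (2 * w₁ * w₂ * v₂ + w₂ ^ 2 * v₁) + 3 * d * w₂ ^ 2 * v₂) / Δ ^ 3, by field_simp⟩
  have hΔ2 : Δ ^ 2 ≠ 0 := pow_ne_zero _ hΔ
  have hΔ3 : Δ ^ 3 ≠ 0 := pow_ne_zero _ hΔ
  have hr : r = 2 * β * v₂ * w₂ := mul_left_cancel₀ hΔ2 (by
    rw [hΔdef] at *
    linear_combination w₂ ^ 2 * hv + v₂ ^ 2 * hw - 2 * v₂ * w₂ * hβ)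
  have hs : s = -β * (v₁ * w₂ + v₂ * w₁) := mul_left_cancel₀ hΔ2 (by
    rw [hΔdef] at *
    linear_combination (-w₂ * w₁) * hv + (-v₁ * v₂) * hw + (v₁ * w₂ + v₂ * w₁) * hβ)
  have ht : t = 2 * β * v₁ * w₁ := mul_left_cancel₀ hΔ2 (by
    rw [hΔdef] at *
    linear_combination w₁ ^ 2 * hv + v₁ ^ 2 * hw - 2 * v₁ * w₁ * hβ)
  have ha : a = -m * w₂ ^ 2 * v₂ + n * w₂ * v₂ ^ 2 := mul_left_cancel₀ hΔ3 (by
    rw [hΔdef] at *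
    linear_combination w₂ ^ 3 * cv - v₂ ^ 3 * cw + w₂ ^ 2 * v₂ * hm - w₂ * v₂ ^ 2 * hn)
  have hb : b = m * (v₁ * w₂ ^ 2 + 2 * v₂ * w₁ * w₂) - n * (2 * v₁ * v₂ * w₂ + w₁ * v₂ ^ 2) :=
    mul_left_cancel₀ hΔ3 (by
    rw [hΔdef] at *
    linear_combination (-3 * w₂ ^ 2 * w₁) * cv + 3 * v₂ ^ 2 * v₁ * cw -
      (v₁ * w₂ ^ 2 + 2 * v₂ * w₁ * w₂) * hm + (2 * v₁ * v₂ * w₂ + w₁ * v₂ ^ 2) * hn)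
  have hc : c = -m * (v₂ * w₁ ^ 2 + 2 * v₁ * w₁ * w₂) + n * (2 * v₁ * v₂ * w₁ + w₂ * v₁ ^ 2) :=
    mul_left_cancel₀ hΔ3 (by
    rw [hΔdef] at *
    linear_combination (3 * w₂ * w₁ ^ 2) * cv - 3 * v₂ * v₁ ^ 2 * cw +
      (v₂ * w₁ ^ 2 + 2 * v₁ * w₁ * w₂) * hm - (2 * v₁ * v₂ * w₁ + w₂ * v₁ ^ 2) * hn)
  have hd : d = m * w₁ ^ 2 * v₁ - n * w₁ * v₁ ^ 2 := mul_left_cancel₀ hΔ3 (by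
    rw [hΔdef] at *
    linear_combination (-w₁ ^ 3) * cv + v₁ ^ 3 * cw - w₁ ^ 2 * v₁ * hm + w₁ * v₁ ^ 2 * hn)
  constructor
  · rw [hr, hs, ht, ha, hb, hc, hd]
    intro n
    fin_cases n <;> simp [apolarity] <;> ring
  · intro h
    have h1 : β ^ 2 * Δ ^ 2 = 0 := by
      rw [hr, hs, ht] at h
      rw [hΔdef]
      linear_combination -h
    have h2 : β = 0 := by
      rcases mul_eq_zero.1 h1 with h | h
      · exact pow_eq_zero_iff (two_ne_zero) |>.1 h
      · exact absurd h hΔ2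
    rw [hr, hs, ht, h2]
    simp

end LinesInSurfaces

section PickTheorem

open MvPolynomial

/-- The equations expressing that the second fundamental form of the surface `f = 0` divides
the cubic form. -/
noncomputable def pickForm (f : MvPolynomial (Fin 3) ℝ) (i : Fin 3) :
    Fin 4 → MvPolynomial (Fin 3) ℝ :=
  apolarity (hessForm f i (i + 1) (i + 1)) (hessForm f i (i + 1) (i + 2))
    (hessForm f i (i + 2) (i + 2)) (cubicForm f i (i + 1) (i + 1) (i + 1))
    (2 * cubicForm f i (i + 1) (i + 1) (i + 2) + cubicForm f i (i + 2) (i + 1) (i + 1))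
    (cubicForm f i (i + 1) (i + 2) (i + 2) + 2 * cubicForm f i (i + 2) (i + 1) (i + 2))
    (cubicForm f i (i + 2) (i + 2) (i + 2))

/-- The discriminant of the second fundamental form. -/
noncomputable def hessDet (f : MvPolynomial (Fin 3) ℝ) (i : Fin 3) : MvPolynomial (Fin 3) ℝ :=
  hessForm f i (i + 1) (i + 1) * hessForm f i (i + 2) (i + 2) - hessForm f i (i + 1) (i + 2) ^ 2

theorem sum_fin_three_shift {A : Type*} [AddCommMonoid A] (i : Fin 3) (g : Fin 3 → A) :
    ∑ a, g a = g i + g (i + 1) + g (i + 2) := by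
  rw [← Equiv.sum_comp (Equiv.addLeft i) g, Fin.sum_univ_three]
  simp

theorem eq_or_eq_shift (i a : Fin 3) : a = i ∨ a = i + 1 ∨ a = i + 2 := by
  revert i a; decide

theorem map_apolarity {A B : Type*} [CommRing A] [CommRing B] (φ : A →+* B) (r s t a b c d : A)
    (n : Fin 4) : φ (apolarity r s t a b c d n) =
      apolarity (φ r) (φ s) (φ t) (φ a) (φ b) (φ c) (φ d) n := by
  fin_cases n <;> simp [apolarity, map_ofNat φ]

theorem tangentDerivation_same (f g : MvPolynomial (Fin 3) ℝ) (i : Fin 3) :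
    tangentDerivation f i i g = 0 := by
  rw [tangentDerivation_apply, sub_self]

theorem hessForm_left (f : MvPolynomial (Fin 3) ℝ) (i b : Fin 3) : hessForm f i i b = 0 := by
  simp [hessForm, tangentDerivation_same]

theorem hessForm_right (f : MvPolynomial (Fin 3) ℝ) (i b : Fin 3) : hessForm f i b i = 0 := by
  rw [hessForm_comm, hessForm_left]

theorem cubicForm_eq_zero (f : MvPolynomial (Fin 3) ℝ) (i c a b : Fin 3)
    (h : c = i ∨ a = i ∨ b = i) : cubicForm f i c a b = 0 := by
  rcases h with rfl | rfl | rfl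
  · simp [cubicForm, tangentDerivation_same]
  · simp [cubicForm, hessForm_left]
  · simp [cubicForm, hessForm_right]

theorem quadratic_of_line {f : MvPolynomial (Fin 3) ℝ} {x v : Fin 3 → ℝ} (i : Fin 3)
    (hf : ∀ t : ℝ, eval (x + t • v) f = 0) :
    eval x (hessForm f i (i + 1) (i + 1)) * v (i + 1) ^ 2 +
      2 * eval x (hessForm f i (i + 1) (i + 2)) * v (i + 1) * v (i + 2) +
      eval x (hessForm f i (i + 2) (i + 2)) * v (i + 2) ^ 2 = 0 := by
  have h := sum_hessForm_eq_zero_of_line i hf 0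
  simp only [zero_smul, add_zero] at h
  simp only [sum_fin_three_shift i, hessForm_left, hessForm_right, map_add, map_mul, eval_C,
    mul_zero, add_zero, zero_add, hessForm_comm f i (i + 2) (i + 1)] at h
  linear_combination h

theorem cubic_of_line {f : MvPolynomial (Fin 3) ℝ} {x v : Fin 3 → ℝ} (i : Fin 3)
    (hf : ∀ t : ℝ, eval (x + t • v) f = 0) :
    eval x (cubicForm f i (i + 1) (i + 1) (i + 1)) * v (i + 1) ^ 3 +
    eval x (2 * cubicForm f i (i + 1) (i + 1) (i + 2) + cubicForm f i (i + 2) (i + 1) (i + 1)) *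
      v (i + 1) ^ 2 * v (i + 2) +
    eval x (cubicForm f i (i + 1) (i + 2) (i + 2) + 2 * cubicForm f i (i + 2) (i + 1) (i + 2)) *
      v (i + 1) * v (i + 2) ^ 2 +
    eval x (cubicForm f i (i + 2) (i + 2) (i + 2)) * v (i + 2) ^ 3 = 0 := by
  have h := sum_cubicForm_eq_zero_of_line i hf 0
  have hsymm : ∀ c, cubicForm f i c (i + 2) (i + 1) = cubicForm f i c (i + 1) (i + 2) := by
    intro c; rw [cubicForm, cubicForm, hessForm_comm]
  have h1 : ∀ a b, cubicForm f i i a b = 0 := fun a b => cubicForm_eq_zero f i _ _ _ (by simp)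
  have h2 : ∀ a b, cubicForm f i a i b = 0 := fun a b => cubicForm_eq_zero f i _ _ _ (by simp)
  have h3 : ∀ a b, cubicForm f i a b i = 0 := fun a b => cubicForm_eq_zero f i _ _ _ (by simp)
  simp only [zero_smul, add_zero] at h
  simp only [sum_fin_three_shift i, h1, h2, h3, map_add, map_mul, eval_C,
    mul_zero, add_zero, zero_add, hsymm] at h
  simp only [map_add, map_mul, map_ofNat]
  linear_combination h

theorem tangent_det_ne_zero {f : MvPolynomial (Fin 3) ℝ} {i : Fin 3} {x v w : Fin 3 → ℝ}
    {l m : Set (Fin 3 → ℝ)} (hl : IsLine l) (hm : IsLine m) (hlm : l ≠ m)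
    (hxl : ∀ y, y ∈ l ↔ ∃ t : ℝ, y = x + t • v) (hxm : ∀ y, y ∈ m ↔ ∃ t : ℝ, y = x + t • w)
    (hv : v ≠ 0) (hw : w ≠ 0) (hfl : l ⊆ polyZeros f) (hfm : m ⊆ polyZeros f)
    (hF : eval x (pderiv i f) ≠ 0) :
    v (i + 1) * w (i + 2) - v (i + 2) * w (i + 1) ≠ 0 := by
  intro hdet
  have key : ∀ u : Fin 3 → ℝ, (∀ t : ℝ, eval (x + t • u) f = 0) →
      u i * eval x (pderiv i f) + u (i + 1) * eval x (pderiv (i + 1) f) +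
        u (i + 2) * eval x (pderiv (i + 2) f) = 0 := by
    intro u hu
    have h := sum_pderiv_eq_zero_of_line hu 0
    simpa only [zero_smul, add_zero, sum_fin_three_shift i, map_add, map_mul, eval_C] using h
  have kv := key v fun t => hfl ((hxl _).2 ⟨t, rfl⟩)
  have kw := key w fun t => hfm ((hxm _).2 ⟨t, rfl⟩)
  have hcases := eq_or_eq_shift i
  obtain ⟨c, hc⟩ : ∃ c : ℝ, w = c • v := by
    have hext : ∀ c : ℝ, w (i + 1) = c * v (i + 1) → w (i + 2) = c * v (i + 2) → w = c • v := by
      intro c h1 h2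
      funext a
      rcases hcases a with rfl | rfl | rfl
      · simp only [Pi.smul_apply, smul_eq_mul]
        apply mul_right_cancel₀ hF
        rw [h1, h2] at kw
        linear_combination kw - c * kv
      · simpa using h1
      · simpa using h2
    by_cases h1 : v (i + 1) = 0
    · by_cases h2 : v (i + 2) = 0
      · exfalso
        apply hv
        rw [h1, h2] at kv
        funext a
        rcases hcases a with rfl | rfl | rfl
        · simpa [hF] using kv
        · simpa using h1
        · simpa using h2
      · refine ⟨w (i + 2) / v (i + 2), hext _ ?_ ?_⟩
        · field_simp; linear_combination -hdet
        · field_simp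
    · refine ⟨w (i + 1) / v (i + 1), hext _ ?_ ?_⟩
      · field_simp
      · field_simp; linear_combination hdet
  apply hlm
  refine hl.eq_of_mem hm (p := x) (q := x + w) ?_ ((hxl _).2 ⟨0, by simp⟩)
    ((hxl _).2 ⟨c, by rw [hc]⟩) ((hxm _).2 ⟨0, by simp⟩) ((hxm _).2 ⟨1, by simp⟩)
  simpa using hw

theorem pickForm_eq_zero_of_two_lines {f : MvPolynomial (Fin 3) ℝ} {i : Fin 3} {x : Fin 3 → ℝ}
    {l m : Set (Fin 3 → ℝ)} (hl : IsLine l) (hm : IsLine m) (hlm : l ≠ m) (hxl : x ∈ l)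
    (hxm : x ∈ m) (hfl : l ⊆ polyZeros f) (hfm : m ⊆ polyZeros f)
    (hF : eval x (pderiv i f) ≠ 0) :
    (∀ n, eval x (pickForm f i n) = 0) ∧ (eval x (hessDet f i) = 0 →
      eval x (hessForm f i (i + 1) (i + 1)) = 0 ∧ eval x (hessForm f i (i + 1) (i + 2)) = 0 ∧
        eval x (hessForm f i (i + 2) (i + 2)) = 0) := by
  obtain ⟨v, hv, hvl⟩ := hl.exists_param_of_mem hxl
  obtain ⟨w, hw, hwm⟩ := hm.exists_param_of_mem hxm
  have hΔ := tangent_det_ne_zero hl hm hlm hvl hwm hv hw hfl hfm hF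
  have lv : ∀ t : ℝ, eval (x + t • v) f = 0 := fun t => hfl ((hvl _).2 ⟨t, rfl⟩)
  have lw : ∀ t : ℝ, eval (x + t • w) f = 0 := fun t => hfm ((hwm _).2 ⟨t, rfl⟩)
  have h := apolarity_eq_zero_of_two_roots hΔ (quadratic_of_line i lv) (quadratic_of_line i lw)
    (cubic_of_line i lv) (cubic_of_line i lw)
  refine ⟨fun n => ?_, fun h0 => h.2 ?_⟩
  · rw [pickForm, map_apolarity]
    exact h.1 n
  · simpa [hessDet] using h0

theorem totalDegree_tangentDerivation_le (f g : MvPolynomial (Fin 3) ℝ) (i k : Fin 3) :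
    (tangentDerivation f i k g).totalDegree ≤ f.totalDegree + g.totalDegree := by
  rw [tangentDerivation_apply]
  refine (totalDegree_sub _ _).trans (max_le ?_ ?_) <;>
  refine (totalDegree_mul _ _).trans (add_le_add ?_ ?_) <;>
  exact (totalDegree_pderiv_le _ _).trans (Nat.sub_le _ _)

theorem totalDegree_pderiv_le_self (i : Fin 3) (h : MvPolynomial (Fin 3) ℝ) :
    (pderiv i h).totalDegree ≤ h.totalDegree :=
  (totalDegree_pderiv_le _ _).trans (Nat.sub_le _ _)

theorem totalDegree_sub_le_of_le {n : ℕ} {g h : MvPolynomial (Fin 3) ℝ} (hg : g.totalDegree ≤ n)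
    (hh : h.totalDegree ≤ n) : (g - h).totalDegree ≤ n :=
  (totalDegree_sub _ _).trans (max_le hg hh)

theorem totalDegree_add_le_of_le {n : ℕ} {g h : MvPolynomial (Fin 3) ℝ} (hg : g.totalDegree ≤ n)
    (hh : h.totalDegree ≤ n) : (g + h).totalDegree ≤ n :=
  (totalDegree_add _ _).trans (max_le hg hh)

theorem totalDegree_mul_le_of_le {n a b : ℕ} {g h : MvPolynomial (Fin 3) ℝ}
    (hg : g.totalDegree ≤ a) (hh : h.totalDegree ≤ b) (hn : a + b ≤ n) :
    (g * h).totalDegree ≤ n :=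
  (totalDegree_mul _ _).trans ((add_le_add hg hh).trans hn)

theorem totalDegree_ofNat_mul_le {n : ℕ} (c : ℕ) [c.AtLeastTwo] {g : MvPolynomial (Fin 3) ℝ}
    (hg : g.totalDegree ≤ n) :
    ((OfNat.ofNat c : MvPolynomial (Fin 3) ℝ) * g).totalDegree ≤ n := by
  refine totalDegree_mul_le_of_le (a := 0) ?_ hg (by omega)
  rw [← map_ofNat C c, totalDegree_C]

theorem totalDegree_hessForm_le (f : MvPolynomial (Fin 3) ℝ) (i a b : Fin 3) :
    (hessForm f i a b).totalDegree ≤ 3 * f.totalDegree := by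
  have hd : ∀ k, (tangentDerivation f i a (pderiv k f)).totalDegree ≤ 2 * f.totalDegree :=
    fun k => (totalDegree_tangentDerivation_le _ _ _ _).trans
      (by have := totalDegree_pderiv_le_self k f; omega)
  exact totalDegree_sub_le_of_le
    (totalDegree_mul_le_of_le (totalDegree_pderiv_le_self _ _) (hd _) (by omega))
    (totalDegree_mul_le_of_le (totalDegree_pderiv_le_self _ _) (hd _) (by omega))

theorem totalDegree_cubicForm_le (f : MvPolynomial (Fin 3) ℝ) (i c a b : Fin 3) :
    (cubicForm f i c a b).totalDegree ≤ 5 * f.totalDegree := by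
  have hh := totalDegree_hessForm_le f i a b
  have h1 : (tangentDerivation f i c (hessForm f i a b)).totalDegree ≤ 4 * f.totalDegree :=
    (totalDegree_tangentDerivation_le _ _ _ _).trans (by omega)
  have h2 : (tangentDerivation f i c (pderiv i f)).totalDegree ≤ 2 * f.totalDegree :=
    (totalDegree_tangentDerivation_le _ _ _ _).trans
      (by have := totalDegree_pderiv_le_self i f; omega)
  exact totalDegree_sub_le_of_le
    (totalDegree_mul_le_of_le (totalDegree_pderiv_le_self _ _) h1 (by omega))
    (totalDegree_ofNat_mul_le 3 (totalDegree_mul_le_of_le hh h2 (by omega)))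

theorem totalDegree_pickForm_le (f : MvPolynomial (Fin 3) ℝ) (i : Fin 3) (n : Fin 4) :
    (pickForm f i n).totalDegree ≤ 11 * f.totalDegree := by
  have key : ∀ (e : ℕ) (r s t a b c d : MvPolynomial (Fin 3) ℝ), r.totalDegree ≤ 3 * e →
      s.totalDegree ≤ 3 * e → t.totalDegree ≤ 3 * e → a.totalDegree ≤ 5 * e →
      b.totalDegree ≤ 5 * e → c.totalDegree ≤ 5 * e → d.totalDegree ≤ 5 * e →
      (apolarity r s t a b c d n).totalDegree ≤ 11 * e := by
    intro e r s t a b c d hr hs ht ha hb hc hd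
    have h4 : (4 * (r * t - s ^ 2)).totalDegree ≤ 6 * e := by
      refine totalDegree_ofNat_mul_le 4 ?_
      rw [sq]
      exact totalDegree_sub_le_of_le (totalDegree_mul_le_of_le hr ht (by omega))
        (totalDegree_mul_le_of_le hs hs (by omega))
    have mul8 : ∀ {g h : MvPolynomial (Fin 3) ℝ}, g.totalDegree ≤ 3 * e →
        h.totalDegree ≤ 5 * e → (g * h).totalDegree ≤ 8 * e := fun hg hh =>
      totalDegree_mul_le_of_le hg hh (by omega)
    have mul8' : ∀ {g h : MvPolynomial (Fin 3) ℝ}, g.totalDegree ≤ 5 * e →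
        h.totalDegree ≤ 3 * e → (g * h).totalDegree ≤ 8 * e := fun hg hh =>
      totalDegree_mul_le_of_le hg hh (by omega)
    have hE1 : (3 * a * t + r * c - 2 * s * b).totalDegree ≤ 8 * e :=
      totalDegree_sub_le_of_le (totalDegree_add_le_of_le
        (mul8' (totalDegree_ofNat_mul_le 3 ha) ht) (mul8 hr hc))
        (mul8 (totalDegree_ofNat_mul_le 2 hs) hb)
    have hE2 : (b * t + 3 * r * d - 2 * s * c).totalDegree ≤ 8 * e :=
      totalDegree_sub_le_of_le (totalDegree_add_le_of_le
        (mul8' hb ht) (mul8 (totalDegree_ofNat_mul_le 3 hr) hd))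
        (mul8 (totalDegree_ofNat_mul_le 2 hs) hc)
    have mul11 : ∀ {g h : MvPolynomial (Fin 3) ℝ}, g.totalDegree ≤ 8 * e →
        h.totalDegree ≤ 3 * e → (g * h).totalDegree ≤ 11 * e := fun hg hh =>
      totalDegree_mul_le_of_le hg hh (by omega)
    have mul11' : ∀ {h : MvPolynomial (Fin 3) ℝ}, h.totalDegree ≤ 5 * e →
        (4 * (r * t - s ^ 2) * h).totalDegree ≤ 11 * e := fun hh =>
      totalDegree_mul_le_of_le h4 hh (by omega)
    fin_cases n
    · exact totalDegree_sub_le_of_le (mul11' ha) (mul11 hE1 hr)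
    · exact totalDegree_sub_le_of_le (mul11' hb) (totalDegree_add_le_of_le (mul11 hE2 hr)
        (mul11 (totalDegree_ofNat_mul_le 2 hE1) hs))
    · exact totalDegree_sub_le_of_le (mul11' hc) (totalDegree_add_le_of_le (mul11 hE1 ht)
        (mul11 (totalDegree_ofNat_mul_le 2 hE2) hs))
    · exact totalDegree_sub_le_of_le (mul11' hd) (mul11 hE2 ht)
  have hh := totalDegree_hessForm_le f i
  have hc := totalDegree_cubicForm_le f i
  exact key _ _ _ _ _ _ _ _ (hh _ _) (hh _ _) (hh _ _) (hc _ _ _)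
    (totalDegree_add_le_of_le (totalDegree_ofNat_mul_le 2 (hc _ _ _)) (hc _ _ _))
    (totalDegree_add_le_of_le (hc _ _ _) (totalDegree_ofNat_mul_le 2 (hc _ _ _))) (hc _ _ _)

end PickTheorem

section QuadricCriterion

open MvPolynomial

theorem eq_zero_of_quadricBasis_sum_eq_zero (e : Fin 10 → ℝ)
    (h : ∀ z x y : ℝ, ∑ n, e n * quadricBasis z x y n = 0) (n : Fin 10) : e n = 0 := by
  have h' : ∀ z x y : ℝ, e 0 + e 1 * z + e 2 * x + e 3 * y + e 4 * z ^ 2 + e 5 * (z * x) +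
      e 6 * (z * y) + e 7 * x ^ 2 + e 8 * (x * y) + e 9 * y ^ 2 = 0 := by
    intro z x y
    have := h z x y
    simp only [Fin.sum_univ_succ, quadricBasis] at this
    simp at this
    linear_combination this
  have h0 := h' 0 0 0
  have h1 := h' 1 0 0
  have h2 := h' (-1) 0 0
  have h3 := h' 0 1 0
  have h4 := h' 0 (-1) 0
  have h5 := h' 0 0 1
  have h6 := h' 0 0 (-1)
  have h7 := h' 1 1 0
  have h8 := h' 1 0 1
  have h9 := h' 0 1 1
  fin_cases n <;> simp <;> linarith

theorem shift_ne (i : Fin 3) : i + 1 ≠ i ∧ i + 2 ≠ i ∧ i + 1 ≠ i + 2 := by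
  revert i; decide

theorem map_quadricBasis {A B : Type*} [CommRing A] [CommRing B] (φ : A →+* B) (z x y : A)
    (n : Fin 10) : φ (quadricBasis z x y n) = quadricBasis (φ z) (φ x) (φ y) n := by
  fin_cases n <;> simp [quadricBasis]

theorem totalDegree_quadricBasis_le (i j k : Fin 3) (n : Fin 10) :
    (quadricBasis (X i) (X j) (X k) n : MvPolynomial (Fin 3) ℝ).totalDegree ≤ 2 := by
  have hX : ∀ a : Fin 3, (X a : MvPolynomial (Fin 3) ℝ).totalDegree ≤ 1 := fun a =>
    (totalDegree_X a).le
  have hXX : ∀ a b : Fin 3, (X a * X b : MvPolynomial (Fin 3) ℝ).totalDegree ≤ 2 := fun a b =>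
    totalDegree_mul_le_of_le (hX a) (hX b) le_rfl
  fin_cases n <;> simp only [quadricBasis, sq]
  · simp
  · exact (hX _).trans one_le_two
  · exact (hX _).trans one_le_two
  · exact (hX _).trans one_le_two
  · exact hXX _ _
  · exact hXX _ _
  · exact hXX _ _
  · exact hXX _ _
  · exact hXX _ _
  · exact hXX _ _

/-- A relation of degree two over the function field whose coefficient vector is projectively
constant forces the surface to have degree at most two. -/
theorem totalDegree_le_two_of_quadric_relation {f : MvPolynomial (Fin 3) ℝ} (hf : Irreducible f)
    {i : Fin 3} {p : Fin 3 → ℝ} (hpf : eval p f = 0) (hp : eval p (pderiv i f) ≠ 0)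
    {K : Type} [Field K] [Algebra ℝ K] (π : MvPolynomial (Fin 3) ℝ →ₐ[ℝ] K)
    (δ : Fin 3 → Derivation ℝ K K) (hπ : ∀ g, π g = 0 ↔ f ∣ g)
    (hfrac : ∀ z, ∃ a b, π b ≠ 0 ∧ z * π b = π a)
    (hδ : ∀ k g, π (pderiv i f) * δ k (π g) = π (tangentDerivation f i k g))
    (c : Fin 10 → K) (w : Fin 3 → K) (b : Fin 10) (hb : c b ≠ 0)
    (hc : ∀ m, m = i + 1 ∨ m = i + 2 → ∀ n, δ m (c n) = w m * c n)
    (hsum : ∑ n, c n * quadricBasis (π (X i)) (π (X (i + 1))) (π (X (i + 2))) n = 0) :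
    f.totalDegree ≤ 2 := by
  choose num den hden hnum using fun n => hfrac (c n)
  set U : K := ∏ n, π (den n) with hU
  have hU0 : U ≠ 0 := Finset.prod_ne_zero_iff.2 fun n _ => hden n
  obtain ⟨D, hD⟩ : ∃ D : Fin 10 → MvPolynomial (Fin 3) ℝ, ∀ n, π (D n) = U * c n := by
    refine ⟨fun n => num n * ∏ m ∈ Finset.univ.erase n, den m, fun n => ?_⟩
    have : U = π (den n) * ∏ m ∈ Finset.univ.erase n, π (den m) :=
      (Finset.mul_prod_erase _ _ (Finset.mem_univ n)).symm
    simp only [map_mul, map_prod, this]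
    rw [← hnum]; ring
  have hF0 : π (pderiv i f) ≠ 0 := by
    intro h0
    obtain ⟨u, hu⟩ := (hπ _).1 h0
    rw [hu, map_mul, hpf, zero_mul] at hp
    exact hp rfl
  obtain ⟨q, hqf, hq⟩ : ∃ q, eval q f = 0 ∧ eval q (pderiv i f * D b) ≠ 0 := by
    by_contra hcon
    push Not at hcon
    have := (hπ _).2 (dvd_of_forall_zero hf hpf hp hcon)
    rw [map_mul, hD] at this
    exact mul_ne_zero hF0 (mul_ne_zero hU0 hb) this
  rw [map_mul] at hq
  have hdvd := dvd_sum_of_proportional hf (eq_or_eq_shift i) hqf (left_ne_zero_of_mul hq) D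
    (quadricBasis (X i) (X (i + 1)) (X (i + 2))) b (right_ne_zero_of_mul hq)
    (by
      intro m hm a
      rw [← hπ, map_sub, map_mul, map_mul, ← hδ, ← hδ, hD, hD, Derivation.leibniz,
        Derivation.leibniz, hc m hm, hc m hm]
      simp only [smul_eq_mul]
      ring)
    (by
      rw [← hπ, map_sum]
      have : ∀ n, π (D n * quadricBasis (X i) (X (i + 1)) (X (i + 2)) n) =
          U * (c n * quadricBasis (π (X i)) (π (X (i + 1))) (π (X (i + 2))) n) := by
        intro n
        rw [map_mul, hD, ← mul_assoc]
        congr 1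
        exact map_quadricBasis (π : MvPolynomial (Fin 3) ℝ →+* K) _ _ _ n
      rw [Finset.sum_congr rfl fun n _ => this n, ← Finset.mul_sum, hsum, mul_zero])
  by_contra hdeg
  push Not at hdeg
  set Ψ := ∑ a, C (eval q (D a)) * quadricBasis (X i) (X (i + 1)) (X (i + 2)) a with hΨ
  have hΨdeg : Ψ.totalDegree ≤ 2 := by
    refine totalDegree_finsetSum_le fun n _ => ?_
    exact totalDegree_mul_le_of_le (totalDegree_C _).le (totalDegree_quadricBasis_le _ _ _ n)
      (by omega)
  have hΨ0 : Ψ = 0 := by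
    by_contra h0
    have := totalDegree_le_of_dvd_of_isDomain hdvd h0
    omega
  refine right_ne_zero_of_mul hq (eq_zero_of_quadricBasis_sum_eq_zero (fun n => eval q (D n)) ?_ b)
  intro z x y
  let P : Fin 3 → ℝ := fun a => if a = i then z else if a = i + 1 then x else y
  have e0 : P i = z := by simp [P]
  have e1 : P (i + 1) = x := by simp [P]
  have e2 : P (i + 2) = y := by
    have h1 : i + 2 ≠ i := (shift_ne i).2.1
    have h2 : i + 2 ≠ i + 1 := (shift_ne i).2.2.symm
    simp only [P, if_neg h1, if_neg h2]
  have h := congrArg (eval P) hΨ0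
  rw [hΨ, map_sum, map_zero] at h
  rw [← h]
  refine Finset.sum_congr rfl fun n _ => ?_
  rw [map_mul, eval_C, map_quadricBasis (eval P), eval_X, eval_X, eval_X, e0, e1, e2]

/-- An irreducible surface on which the second fundamental form vanishes, or is nondegenerate
and divides the cubic form, has degree at most two. -/
theorem totalDegree_le_two_of_pickForm {f : MvPolynomial (Fin 3) ℝ} (hf : Irreducible f)
    {i : Fin 3} {p : Fin 3 → ℝ} (hpf : eval p f = 0) (hp : eval p (pderiv i f) ≠ 0)
    (h : (f ∣ hessForm f i (i + 1) (i + 1) ∧ f ∣ hessForm f i (i + 1) (i + 2) ∧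
        f ∣ hessForm f i (i + 2) (i + 2)) ∨
      (¬ f ∣ hessDet f i ∧ ∀ n, f ∣ pickForm f i n)) : f.totalDegree ≤ 2 := by
  have hi : ¬ f ∣ pderiv i f := by
    rintro ⟨u, hu⟩
    rw [hu, map_mul, hpf, zero_mul] at hp
    exact hp rfl
  obtain ⟨K, _, _, _, π, δ, hπ, hfrac, hδ, hcomm⟩ := exists_tangent_derivations hf i hi
  set F := π (pderiv i f) with hF
  have hF0 : F ≠ 0 := fun h => hi ((hπ _).1 h)
  have hδX : ∀ k a, F * δ k (π (X a)) = F * (if a = k then 1 else 0) -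
      (if a = i then π (pderiv k f) else 0) := by
    intro k a
    rw [hδ, tangentDerivation_apply, pderiv_X, pderiv_X, map_sub, map_mul, map_mul]
    congr 1
    · by_cases h : a = k
      · subst h; simp [hF]
      · simp [h]
    · by_cases h : a = i
      · subst h; simp
      · simp [h]
  set z := π (X i)
  set x := π (X (i + 1))
  set y := π (X (i + 2))
  set a := -π (pderiv (i + 1) f) / F with ha
  set b := -π (pderiv (i + 2) f) / F with hb
  have hh : ∀ m k, δ m (-π (pderiv k f) / F) = π (hessForm f i m k) / F ^ 3 := by
    intro m k
    rw [Derivation.leibniz_div, eq_div_iff (pow_ne_zero _ hF0), hessForm, map_sub, map_mul,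
      map_mul, ← hδ, ← hδ, map_neg]
    simp only [smul_eq_mul]
    field_simp
    ring
  have hcub : ∀ m k l, δ m (π (hessForm f i k l) / F ^ 3) = π (cubicForm f i m k l) / F ^ 5 := by
    intro m k l
    rw [Derivation.leibniz_div, eq_div_iff (pow_ne_zero _ hF0), cubicForm, map_sub, map_mul,
      map_mul, map_mul, ← hδ, ← hδ, Derivation.leibniz_pow, map_ofNat]
    simp only [smul_eq_mul, nsmul_eq_mul]
    push_cast
    field_simp
    rw [← hF]
    ring
  set r := π (hessForm f i (i + 1) (i + 1)) / F ^ 3 with hr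
  set s := π (hessForm f i (i + 1) (i + 2)) / F ^ 3 with hs
  set t := π (hessForm f i (i + 2) (i + 2)) / F ^ 3 with ht
  have hn1 : i + 1 ≠ i := (shift_ne i).1
  have hn2 : i + 2 ≠ i := (shift_ne i).2.1
  have hn3 : i + 1 ≠ i + 2 := (shift_ne i).2.2
  have hz1 : δ (i + 1) z = a := by
    apply mul_left_cancel₀ hF0
    rw [hδX, ha, if_neg hn1.symm, if_pos rfl]; field_simp; ring
  have hz2 : δ (i + 2) z = b := by
    apply mul_left_cancel₀ hF0
    rw [hδX, hb, if_neg hn2.symm, if_pos rfl]; field_simp; ring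
  have hx1 : δ (i + 1) x = 1 := by
    apply mul_left_cancel₀ hF0
    rw [hδX, if_pos rfl, if_neg hn1, sub_zero]
  have hx2 : δ (i + 2) x = 0 := by
    apply mul_left_cancel₀ hF0
    rw [hδX, if_neg hn3, if_neg hn1, sub_zero]
  have hy1 : δ (i + 1) y = 0 := by
    apply mul_left_cancel₀ hF0
    rw [hδX, if_neg hn3.symm, if_neg hn2, sub_zero]
  have hy2 : δ (i + 2) y = 1 := by
    apply mul_left_cancel₀ hF0
    rw [hδX, if_pos rfl, if_neg hn2, sub_zero]
  have ha1 : δ (i + 1) a = r := hh _ _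
  have ha2 : δ (i + 2) a = s := by rw [ha, hh, hs, hessForm_comm]
  have hb1 : δ (i + 1) b = s := hh _ _
  have hb2 : δ (i + 2) b = t := hh _ _
  have hsr : δ (i + 1) s = δ (i + 2) r := by rw [← ha2, ← ha1, hcomm]
  have hts : δ (i + 1) t = δ (i + 2) s := by rw [← hb2, ← hb1, hcomm]
  obtain ⟨u, v, σ, e1, e2, e3, e4, f1, f2, f3, f4, g1, g2⟩ : ∃ u v σ : K,
      δ (i + 1) r = 3 * u * r ∧ δ (i + 2) r = v * r + 2 * u * s ∧
      δ (i + 2) s = u * t + 2 * v * s ∧ δ (i + 2) t = 3 * v * t ∧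
      δ (i + 1) u = u ^ 2 - σ * r ∧ δ (i + 2) u = u * v - σ * s ∧
      δ (i + 1) v = u * v - σ * s ∧ δ (i + 2) v = v ^ 2 - σ * t ∧
      δ (i + 1) σ = u * σ ∧ δ (i + 2) σ = v * σ := by
    rcases h with ⟨h1, h2, h3⟩ | ⟨hdet, hpick⟩
    · have r0 : r = 0 := by rw [hr, (hπ _).2 h1, zero_div]
      have s0 : s = 0 := by rw [hs, (hπ _).2 h2, zero_div]
      have t0 : t = 0 := by rw [ht, (hπ _).2 h3, zero_div]
      exact ⟨0, 0, 0, by simp [r0], by simp [r0, s0], by simp [s0], by simp [t0], by simp,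
        by simp, by simp, by simp, by simp, by simp⟩
    · have hA : ∀ n, apolarity (F ^ 3 * r) (F ^ 3 * s) (F ^ 3 * t) (F ^ 5 * δ (i + 1) r)
          (3 * F ^ 5 * δ (i + 2) r) (3 * F ^ 5 * δ (i + 2) s) (F ^ 5 * δ (i + 2) t) n = 0 := by
        intro n
        have hp := (hπ _).2 (hpick n)
        rw [pickForm] at hp
        have hp' := (map_apolarity (π : MvPolynomial (Fin 3) ℝ →+* K) _ _ _ _ _ _ _ n).symm.trans hp
        rw [← hp']
        have hq : ∀ m k l, F ^ 5 * δ m (π (hessForm f i k l) / F ^ 3) =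
            π (cubicForm f i m k l) := by
          intro m k l
          rw [hcub]; field_simp
        congr 1
        · rw [hr]; simp; field_simp
        · rw [hs]; simp; field_simp
        · rw [ht]; simp; field_simp
        · exact hq _ _ _
        · simp only [RingHom.coe_coe, map_add, map_mul, map_ofNat, ← hq]
          rw [← hs, ← hr, hsr]; ring
        · simp only [RingHom.coe_coe, map_add, map_mul, map_ofNat, ← hq]
          rw [← hs, ← ht, hts]; ring
        · exact hq _ _ _
      have hA0 := hA 0
      have hA1 := hA 1
      have hA2 := hA 2
      have hA3 := hA 3
      simp only [apolarity, Matrix.cons_val_zero, Matrix.cons_val_one, Matrix.cons_val] at hA0 hA1 hA2 hA3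
      have hF11 : F ^ 11 ≠ 0 := pow_ne_zero _ hF0
      have h3F : 3 * F ^ 11 ≠ 0 := mul_ne_zero three_ne_zero hF11
      have hH : ∀ m, δ m (r * t - s ^ 2) = r * δ m t + t * δ m r - 2 * s * δ m s := by
        intro m
        simp only [map_sub, Derivation.leibniz, Derivation.leibniz_pow, smul_eq_mul, nsmul_eq_mul]
        push_cast
        ring
      refine exists_quadric_structure (δ (i + 1)) (δ (i + 2)) (hcomm _ _) r s t hsr hts
        (r * t - s ^ 2) rfl ?_ ?_ ?_ ?_ ?_
      · intro h0
        apply hdet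
        rw [← hπ, hessDet, map_sub, map_mul, map_pow]
        have : π (hessForm f i (i + 1) (i + 1)) * π (hessForm f i (i + 2) (i + 2)) -
            π (hessForm f i (i + 1) (i + 2)) ^ 2 = F ^ 6 * (r * t - s ^ 2) := by
          rw [hr, hs, ht]; field_simp
        rw [this, h0, mul_zero]
      · apply mul_left_cancel₀ hF11
        rw [hH, hsr, hts]
        linear_combination hA0
      · apply mul_left_cancel₀ h3F
        rw [hH, hH, hsr, hts]
        linear_combination hA1
      · apply mul_left_cancel₀ h3F
        rw [hH, hH, hsr, hts]
        linear_combination hA2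
      · apply mul_left_cancel₀ hF11
        rw [hH]
        linear_combination hA3
  obtain ⟨n, hn⟩ := exists_quadricCoeff_ne_zero z x y a b r s t u v σ
  refine totalDegree_le_two_of_quadric_relation hf hpf hp π δ hπ hfrac hδ
    (quadricCoeff z x y a b r s t u v σ) (fun m => if m = i + 1 then u else v) n hn ?_
    (sum_quadricCoeff_mul_quadricBasis z x y a b r s t u v σ two_ne_zero)
  rintro m (rfl | rfl) n
  · rw [if_pos rfl]
    apply derivation_quadricCoeff_eq (δ (i + 1)) (α := 1) (β := 0)
    all_goals try simp only [hz1, hx1, hy1, ha1, hb1, e1, hsr, e2, hts, e3, f1, f3, g1]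
    all_goals ring
  · rw [if_neg hn3.symm]
    apply derivation_quadricCoeff_eq (δ (i + 2)) (α := 0) (β := 1)
    all_goals try simp only [hz2, hx2, hy2, ha2, hb2, e2, e3, e4, f2, f4, g2]
    all_goals ring

end QuadricCriterion

section DoublePoints

open MvPolynomial

/-- An irreducible surface of degree `e ≥ 3` contains at most `12 e²` lines carrying more than
`12 e` points each of which lies on a further line of the surface. -/
theorem card_lines_le_of_double_points {f : MvPolynomial (Fin 3) ℝ} (hf : Irreducible f)
    (hdeg : 3 ≤ f.totalDegree) (M : Finset (Set (Fin 3 → ℝ)))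
    (hM : ∀ m ∈ M, IsLine m ∧ m ⊆ polyZeros f ∧ ∃ S : Finset (Fin 3 → ℝ),
      12 * f.totalDegree < S.card ∧
      ∀ x ∈ S, x ∈ m ∧ ∃ l, IsLine l ∧ l ≠ m ∧ x ∈ l ∧ l ⊆ polyZeros f) :
    M.card ≤ 12 * f.totalDegree ^ 2 := by
  by_contra hcard
  push Not at hcard
  obtain ⟨i, hi⟩ : ∃ i, pderiv i f ≠ 0 := by
    by_contra hcon
    push Not at hcon
    have := eq_C_of_pderiv_eq_zero f hcon
    rw [this, totalDegree_C] at hdeg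
    omega
  have hFdeg : (pderiv i f).totalDegree ≤ f.totalDegree - 1 := totalDegree_pderiv_le i f
  have hFdvd : ¬ f ∣ pderiv i f := fun h => by
    have := totalDegree_le_of_dvd_of_isDomain h hi
    omega
  have hdvd : ∀ g : MvPolynomial (Fin 3) ℝ, g.totalDegree ≤ 11 * f.totalDegree →
      (∀ x l m, IsLine l → IsLine m → l ≠ m → x ∈ l → x ∈ m → l ⊆ polyZeros f → m ⊆ polyZeros f →
        eval x (pderiv i f) ≠ 0 → eval x g = 0) → f ∣ g := by
    intro g hg hzero
    have hgdeg : (pderiv i f * g).totalDegree ≤ 12 * f.totalDegree :=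
      totalDegree_mul_le_of_le hFdeg hg (by omega)
    by_contra hfg
    have hmul : ¬ f ∣ pderiv i f * g := fun h => (hf.prime.dvd_or_dvd h).elim hFdvd hfg
    have h := card_lines_le_of_not_dvd hf hmul M (fun l hl => (hM l hl).1)
      (fun l hl => (hM l hl).2.1) (by
        intro m hm
        obtain ⟨hml, hmf, S, hS, hSx⟩ := hM m hm
        refine hml.subset_polyZeros_of_card (S := S) (fun x hx => (hSx x hx).1) ?_ (by omega)
        intro x hx
        obtain ⟨hxm, l, hl, hlm, hxl, hlf⟩ := hSx x hx
        rw [map_mul]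
        by_cases h0 : eval x (pderiv i f) = 0
        · rw [h0, zero_mul]
        · rw [hzero x l m hl hml hlm hxl hxm hlf hmf h0, mul_zero])
    have : f.totalDegree * (pderiv i f * g).totalDegree ≤ f.totalDegree * (12 * f.totalDegree) :=
      Nat.mul_le_mul_left _ hgdeg
    nlinarith
  obtain ⟨p, hpf, hp⟩ : ∃ p, eval p f = 0 ∧ eval p (pderiv i f) ≠ 0 := by
    by_contra hcon
    push Not at hcon
    have h := card_lines_le_of_not_dvd hf hFdvd M (fun l hl => (hM l hl).1)
      (fun l hl => (hM l hl).2.1) (fun l hl x hx => hcon x ((hM l hl).2.1 hx))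
    have : f.totalDegree * (pderiv i f).totalDegree ≤ f.totalDegree * f.totalDegree :=
      Nat.mul_le_mul_left _ (by omega)
    nlinarith
  have h2 : f.totalDegree ≤ 2 := by
    refine totalDegree_le_two_of_pickForm hf hpf hp ?_
    by_cases hdet : f ∣ hessDet f i
    · left
      have hdet0 : ∀ x ∈ polyZeros f, eval x (hessDet f i) = 0 := by
        intro x hx
        obtain ⟨u, hu⟩ := hdet
        rw [hu, map_mul, mem_polyZeros.1 hx, zero_mul]
      have hle : ∀ a b, (hessForm f i a b).totalDegree ≤ 11 * f.totalDegree := fun a b =>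
        (totalDegree_hessForm_le f i a b).trans (by omega)
      refine ⟨hdvd _ (hle _ _) ?_, hdvd _ (hle _ _) ?_, hdvd _ (hle _ _) ?_⟩
      · intro x l m hl hm hlm hxl hxm hlf hmf hF
        exact ((pickForm_eq_zero_of_two_lines hl hm hlm hxl hxm hlf hmf hF).2
          (hdet0 x (hlf hxl))).1
      · intro x l m hl hm hlm hxl hxm hlf hmf hF
        exact ((pickForm_eq_zero_of_two_lines hl hm hlm hxl hxm hlf hmf hF).2
          (hdet0 x (hlf hxl))).2.1
      · intro x l m hl hm hlm hxl hxm hlf hmf hF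
        exact ((pickForm_eq_zero_of_two_lines hl hm hlm hxl hxm hlf hmf hF).2
          (hdet0 x (hlf hxl))).2.2
    · right
      refine ⟨hdet, fun n => hdvd _ (totalDegree_pickForm_le f i n) ?_⟩
      intro x l m hl hm hlm hxl hxm hlf hmf hF
      exact (pickForm_eq_zero_of_two_lines hl hm hlm hxl hxm hlf hmf hF).1 n
  omega

end DoublePoints

section RichLines

open MvPolynomial

theorem card_filter_mem_inter_le_one {l m : Set (Fin 3 → ℝ)} (hl : IsLine l) (hm : IsLine m)
    (hlm : l ≠ m) (J : Finset (Fin 3 → ℝ)) : (J.filter fun x => x ∈ l ∧ x ∈ m).card ≤ 1 := by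
  rw [Finset.card_le_one]
  intro x hx y hy
  simp only [Finset.mem_filter] at hx hy
  by_contra hxy
  exact hlm (hl.eq_of_mem hm hxy hx.2.1 hy.2.1 hx.2.2 hy.2.2)

/-- Cauchy–Schwarz bound for the incidences between points and lines. -/
theorem sq_incidences_le (J : Finset (Fin 3 → ℝ)) (M : Finset (Set (Fin 3 → ℝ)))
    (hM : ∀ m ∈ M, IsLine m) :
    (∑ m ∈ M, (J.filter fun x => x ∈ m).card) ^ 2 ≤
      J.card * (∑ m ∈ M, (J.filter fun x => x ∈ m).card + M.card ^ 2) := by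
  have hswap : ∑ m ∈ M, (J.filter fun x => x ∈ m).card =
      ∑ x ∈ J, (M.filter fun m => x ∈ m).card :=
    Finset.sum_card_bipartiteAbove_eq_sum_card_bipartiteBelow (fun m x => x ∈ m)
  have hcs : (∑ x ∈ J, (M.filter fun m => x ∈ m).card) ^ 2 ≤
      J.card * ∑ x ∈ J, (M.filter fun m => x ∈ m).card ^ 2 := sq_sum_le_card_mul_sum_sq
  have hpairs : ∑ x ∈ J, (M.filter fun m => x ∈ m).card ^ 2 ≤
      ∑ m ∈ M, (J.filter fun x => x ∈ m).card + M.card ^ 2 := by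
    have h1 : ∀ x, (M.filter fun m => x ∈ m).card ^ 2 =
        ((M ×ˢ M).filter fun q => x ∈ q.1 ∧ x ∈ q.2).card := by
      intro x
      rw [sq, ← Finset.card_product, ← Finset.filter_product]
    calc ∑ x ∈ J, (M.filter fun m => x ∈ m).card ^ 2
        = ∑ x ∈ J, ((M ×ˢ M).filter fun q => x ∈ q.1 ∧ x ∈ q.2).card :=
          Finset.sum_congr rfl fun x _ => h1 x
      _ = ∑ q ∈ M ×ˢ M, (J.filter fun x => x ∈ q.1 ∧ x ∈ q.2).card :=
          (Finset.sum_card_bipartiteAbove_eq_sum_card_bipartiteBelow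
            (fun (q : Set (Fin 3 → ℝ) × Set (Fin 3 → ℝ)) x => x ∈ q.1 ∧ x ∈ q.2)).symm
      _ = ∑ l ∈ M, ∑ m ∈ M, (J.filter fun x => x ∈ l ∧ x ∈ m).card := Finset.sum_product _ _ _
      _ ≤ ∑ l ∈ M, ∑ m ∈ M, ((if l = m then (J.filter fun x => x ∈ l).card else 0) + 1) := by
          refine Finset.sum_le_sum fun l hl => Finset.sum_le_sum fun m hm => ?_
          split_ifs with h
          · subst h; simp
          · rw [zero_add]; exact card_filter_mem_inter_le_one (hM l hl) (hM m hm) h J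
      _ = ∑ m ∈ M, (J.filter fun x => x ∈ m).card + M.card ^ 2 := by
          simp only [Finset.sum_add_distrib]
          congr 1
          · refine Finset.sum_congr rfl fun l hl => ?_
            rw [Finset.sum_ite_eq, if_pos hl]
          · simp [sq]
  rw [hswap] at hpairs ⊢
  exact hcs.trans (Nat.mul_le_mul_left _ hpairs)

theorem card_mul_le_of_card_le {σ : ℕ} (J : Finset (Fin 3 → ℝ)) (M : Finset (Set (Fin 3 → ℝ)))
    (hM : ∀ m ∈ M, IsLine m ∧ σ ≤ (J.filter fun x => x ∈ m).card) (hMσ : M.card ≤ σ) :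
    M.card * σ ≤ 2 * J.card := by
  have h := sq_incidences_le J M fun m hm => (hM m hm).1
  have hI : M.card * σ ≤ ∑ m ∈ M, (J.filter fun x => x ∈ m).card := by
    rw [← smul_eq_mul]
    exact Finset.card_nsmul_le_sum _ _ _ fun m hm => (hM m hm).2
  set I := ∑ m ∈ M, (J.filter fun x => x ∈ m).card
  have h2 : M.card ^ 2 ≤ I := le_trans (by rw [sq]; exact Nat.mul_le_mul_left _ hMσ) hI
  rcases Nat.eq_zero_or_pos I with h0 | h0
  · omega
  · have : I * I ≤ I * (2 * J.card) := by nlinarith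
    exact hI.trans (Nat.le_of_mul_le_mul_left this h0)

theorem card_mul_sq_le {σ : ℕ} (hσ : 2 ≤ σ) (J : Finset (Fin 3 → ℝ))
    (M : Finset (Set (Fin 3 → ℝ)))
    (hM : ∀ m ∈ M, IsLine m ∧ σ ≤ (J.filter fun x => x ∈ m).card) :
    M.card * σ ^ 2 ≤ 2 * J.card ^ 2 := by
  have h1 : M.card * (σ * (σ - 1)) ≤ ∑ m ∈ M, (J.filter fun x => x ∈ m).offDiag.card := by
    rw [← smul_eq_mul]
    refine Finset.card_nsmul_le_sum _ _ _ fun m hm => ?_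
    have := (hM m hm).2
    rw [Finset.offDiag_card]
    obtain ⟨c, hc⟩ := Nat.exists_eq_add_of_le this
    obtain ⟨e, rfl⟩ := Nat.exists_eq_add_of_le hσ
    rw [hc, ← Nat.mul_sub_one]
    exact Nat.mul_le_mul (by omega) (by omega)
  have h2 : ∑ m ∈ M, (J.filter fun x => x ∈ m).offDiag.card ≤ (J ×ˢ J).card := by
    rw [← Finset.card_biUnion]
    · refine Finset.card_le_card fun q hq => ?_
      simp only [Finset.mem_biUnion, Finset.mem_offDiag, Finset.mem_filter] at hq
      obtain ⟨m, _, h⟩ := hq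
      exact Finset.mem_product.2 ⟨h.1.1, h.2.1.1⟩
    · intro l hl m hm hlm
      rw [Function.onFun, Finset.disjoint_left]
      rintro ⟨x, y⟩ h h'
      simp only [Finset.mem_offDiag, Finset.mem_filter] at h h'
      exact hlm ((hM l hl).1.eq_of_mem (hM m hm).1 h.2.2 h.1.2 h.2.1.2 h'.1.2 h'.2.1.2)
  rw [Finset.card_product] at h2
  obtain ⟨e, rfl⟩ := Nat.exists_eq_add_of_le hσ
  have e1 : 2 + e - 1 = 1 + e := by omega
  rw [e1] at h1
  have h3 := h1.trans h2
  nlinarith [Nat.zero_le (M.card * (e * (e + 2)))]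

/-- Points of a line on a surface not containing it. -/
theorem IsLine.card_filter_zero_le {m : Set (Fin 3 → ℝ)} (hm : IsLine m)
    {f : MvPolynomial (Fin 3) ℝ} (hmf : ¬ m ⊆ polyZeros f) (J : Finset (Fin 3 → ℝ)) :
    (J.filter fun x => x ∈ m ∧ eval x f = 0).card ≤ f.totalDegree := by
  by_contra hcon
  push Not at hcon
  exact hmf (hm.subset_polyZeros_of_card (fun x hx => (Finset.mem_filter.1 hx).2.1)
    (fun x hx => (Finset.mem_filter.1 hx).2.2) hcon)

theorem IsLine.card_filter_le_add {m : Set (Fin 3 → ℝ)} (hm : IsLine m)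
    {f : MvPolynomial (Fin 3) ℝ} (hmf : ¬ m ⊆ polyZeros f) (J : Finset (Fin 3 → ℝ)) :
    (J.filter fun x => x ∈ m).card ≤
      (J.filter fun x => x ∈ m ∧ eval x f ≠ 0).card + f.totalDegree := by
  have h := hm.card_filter_zero_le hmf J
  have h2 := Finset.card_filter_add_card_filter_not (s := J.filter fun x => x ∈ m)
    (fun x => eval x f ≠ 0)
  simp only [Finset.filter_filter, not_not] at h2
  omega

/-- Partitioning bound for the lines not contained in the partitioning surface. -/
theorem exists_partition_rich_lines (T : Finset (Fin 3)) (hT : T.Nonempty)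
    (P : Finset (Fin 3 → ℝ)) (b : ℕ) :
    ∃ f : MvPolynomial (Fin 3) ℝ, f ≠ 0 ∧ (∀ k ∉ T, degreeOf k f = 0) ∧
      f.totalDegree ≤ 2 * T.card ^ 2 * 2 ^ b ∧
      ∀ (σ : ℕ) (M : Finset (Set (Fin 3 → ℝ))), 8 * T.card ^ 2 * 2 ^ b ≤ σ → 4 ≤ σ →
        (∀ m ∈ M, IsLine m ∧ ¬ m ⊆ polyZeros f ∧ σ ≤ (P.filter fun x => x ∈ m).card) →
        2 ^ (T.card * b) * (σ * M.card) ≤ 4 * P.card ^ 2 := by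
  obtain ⟨f, hf, hfT, hdeg, h⟩ := exists_partition_incidences T hT P b
  refine ⟨f, hf, hfT, hdeg, fun σ M hσ hσ4 hM => ?_⟩
  have h1 := h M fun m hm => ⟨(hM m hm).1, (hM m hm).2.1⟩
  have h2 : M.card * (σ - 2 * T.card ^ 2 * 2 ^ b) ≤
      ∑ m ∈ M, (P.filter fun p => p ∈ m ∧ eval p f ≠ 0).card := by
    rw [← smul_eq_mul]
    refine Finset.card_nsmul_le_sum _ _ _ fun m hm => ?_
    have := (hM m hm).1.card_filter_le_add (hM m hm).2.1 P
    have := (hM m hm).2.2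
    omega
  set D := 2 * T.card ^ 2 * 2 ^ b
  set E := 2 ^ (T.card * b)
  have hD : 8 * T.card ^ 2 * 2 ^ b = 4 * D := by simp only [D]; ring
  rw [hD] at hσ
  obtain ⟨e, he⟩ := Nat.exists_eq_add_of_le hσ
  have h3 : σ - D = 3 * D + e := by omega
  rw [h3] at h2
  have h4 := (Nat.mul_le_mul_left E h2).trans h1
  have h5 : E * (M.card * (3 * D + e)) = E * M.card * (3 * D + e) := by ring
  have h6 : E * ((D + 1) * M.card) = E * M.card * (D + 1) := by ring
  rw [h5, h6] at h4
  have h7 : E * (σ * M.card) = E * M.card * (4 * D + e) := by rw [he]; ring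
  rw [h7]
  have h8 : 4 * D + e ≥ 4 := by omega
  generalize E * M.card = y at *
  nlinarith

/-- Szemerédi–Trotter bound for lines on an irreducible surface of degree at most two. -/
theorem card_rich_lines_le_of_quadric {g : MvPolynomial (Fin 3) ℝ} (hg : Irreducible g)
    (hdeg : g.totalDegree ≤ 2) {σ : ℕ} (hσ : 2 ≤ σ) (J : Finset (Fin 3 → ℝ))
    (M : Finset (Set (Fin 3 → ℝ)))
    (hM : ∀ m ∈ M, IsLine m ∧ m ⊆ polyZeros g ∧ σ ≤ (J.filter fun x => x ∈ m).card) :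
    M.card * σ ^ 3 ≤ 32768 * (J.card ^ 2 + J.card * σ ^ 2) := by
  by_cases hσ64 : σ < 64
  · have h := card_mul_sq_le hσ J M fun m hm => ⟨(hM m hm).1, (hM m hm).2.2⟩
    calc M.card * σ ^ 3 = M.card * σ ^ 2 * σ := by ring
      _ ≤ 2 * J.card ^ 2 * 64 := Nat.mul_le_mul h hσ64.le
      _ ≤ _ := by nlinarith [Nat.zero_le (J.card * σ ^ 2)]
  push Not at hσ64
  obtain ⟨k, hk⟩ : ∃ k, degreeOf k g ≠ 0 := by
    by_contra hcon
    push Not at hcon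
    have hC := eq_C_of_pderiv_eq_zero g fun i => pderiv_eq_zero_of_degreeOf_eq_zero i g (hcon i)
    apply hg.not_isUnit
    rw [hC]
    refine IsUnit.map C (isUnit_iff_ne_zero.2 fun h0 => hg.ne_zero ?_)
    rw [hC, h0, C_0]
  have hTcard : (Finset.univ.erase k : Finset (Fin 3)).card = 2 := by
    rw [Finset.card_erase_of_mem (Finset.mem_univ _)]; simp
  obtain ⟨b, hb1, hb2⟩ : ∃ b, 32 * 2 ^ b ≤ σ ∧ σ < 64 * 2 ^ b := by
    have h0 : σ / 32 ≠ 0 := by omega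
    refine ⟨Nat.log 2 (σ / 32), ?_, ?_⟩
    · have := Nat.pow_log_le_self 2 h0; omega
    · have := Nat.lt_pow_succ_log_self (b := 2) (by norm_num) (σ / 32)
      rw [pow_succ] at this; omega
  obtain ⟨f, hf, hfT, hfdeg, hpart⟩ := exists_partition_rich_lines (Finset.univ.erase k)
    (Finset.card_pos.1 (by omega)) J b
  rw [hTcard] at hfdeg hpart
  have hfk : degreeOf k f = 0 := hfT k (by simp)
  have hgf : ¬ g ∣ f := by
    rintro ⟨u, hu⟩
    have hu0 : u ≠ 0 := by rintro rfl; simp at hu; exact hf hu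
    rw [hu, degreeOf_mul_eq hg.ne_zero hu0] at hfk
    omega
  have hsplit := Finset.card_filter_add_card_filter_not (s := M) (fun m => m ⊆ polyZeros f)
  have h2 : (M.filter fun m => m ⊆ polyZeros f).card ≤ 16 * 2 ^ b := by
    have h := card_lines_le_of_not_dvd hg hgf (M.filter fun m => m ⊆ polyZeros f)
      (fun l hl => (hM l (Finset.mem_filter.1 hl).1).1)
      (fun l hl => (hM l (Finset.mem_filter.1 hl).1).2.1) (fun l hl => (Finset.mem_filter.1 hl).2)
    refine h.trans ((Nat.mul_le_mul hdeg hfdeg).trans ?_)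
    omega
  have h1 := hpart σ (M.filter fun m => ¬ m ⊆ polyZeros f) (by omega) (by omega) fun m hm =>
    ⟨(hM m (Finset.mem_filter.1 hm).1).1, (Finset.mem_filter.1 hm).2,
      (hM m (Finset.mem_filter.1 hm).1).2.2⟩
  set M₁ := (M.filter fun m => ¬ m ⊆ polyZeros f).card
  set M₂ := (M.filter fun m => m ⊆ polyZeros f).card
  by_cases hcase : M.card ≤ 2 * M₁
  · have hpow : 2 ^ (2 * b) = 2 ^ b * 2 ^ b := by rw [two_mul, pow_add]
    rw [hpow] at h1
    set y := 2 ^ b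
    have hσ2 : σ ^ 2 ≤ 4096 * (y * y) := by nlinarith
    calc M.card * σ ^ 3 ≤ 2 * M₁ * (σ ^ 2 * σ) := by
          rw [← pow_succ]; exact Nat.mul_le_mul_right _ hcase
      _ ≤ 2 * M₁ * (4096 * (y * y) * σ) := by gcongr
      _ = 8192 * (y * y * (σ * M₁)) := by ring
      _ ≤ 8192 * (4 * J.card ^ 2) := by gcongr
      _ ≤ _ := by nlinarith [Nat.zero_le (J.card * σ ^ 2)]
  · have h3 := card_mul_le_of_card_le J M (fun m hm => ⟨(hM m hm).1, (hM m hm).2.2⟩)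
      (by omega : M.card ≤ σ)
    calc M.card * σ ^ 3 = M.card * σ * σ ^ 2 := by ring
      _ ≤ 2 * J.card * σ ^ 2 := Nat.mul_le_mul_right _ h3
      _ ≤ _ := by nlinarith [Nat.zero_le (J.card * σ ^ 2), Nat.zero_le (J.card ^ 2)]

end RichLines

section Components

open MvPolynomial

/-- The distinct irreducible components of a surface. -/
theorem exists_irreducible_components (f : MvPolynomial (Fin 3) ℝ) (hf : f ≠ 0) :
    ∃ G : Finset (MvPolynomial (Fin 3) ℝ), (∀ g ∈ G, Irreducible g) ∧
      (∀ g ∈ G, ∀ g' ∈ G, g ≠ g' → ¬ g ∣ g') ∧ ∑ g ∈ G, g.totalDegree ≤ f.totalDegree ∧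
      ∀ x, eval x f = 0 ↔ ∃ g ∈ G, eval x g = 0 := by
  revert hf
  refine WfDvdMonoid.induction_on_irreducible f ?_ ?_ ?_
  · intro h; exact absurd rfl h
  · intro u hu _
    refine ⟨∅, by simp, by simp, by simp, fun x => ?_⟩
    have := (hu.map (eval x)).ne_zero
    simp [this]
  · intro a i ha hi ih _
    obtain ⟨G, h1, h2, h3, h4⟩ := ih ha
    have hdeg : (i * a).totalDegree = i.totalDegree + a.totalDegree :=
      totalDegree_mul_of_isDomain hi.ne_zero ha
    by_cases hG : ∃ g ∈ G, g ∣ i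
    · obtain ⟨g, hg, c, hc⟩ := hG
      refine ⟨G, h1, h2, by omega, fun x => ?_⟩
      rw [map_mul, mul_eq_zero, h4 x]
      constructor
      · rintro (h | h)
        · have hass : Associated g i := (h1 g hg).associated_of_dvd hi ⟨c, hc⟩
          obtain ⟨b, hb⟩ := hass.symm.dvd
          exact ⟨g, hg, by rw [hb, map_mul, h, zero_mul]⟩
        · exact h
      · exact Or.inr
    · push Not at hG
      have hiG : i ∉ G := fun h => hG i h dvd_rfl
      refine ⟨insert i G, ?_, ?_, ?_, fun x => ?_⟩
      · intro g hg
        rcases Finset.mem_insert.1 hg with rfl | hg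
        exacts [hi, h1 g hg]
      · intro g hg g' hg' hne
        rcases Finset.mem_insert.1 hg with rfl | hgG <;>
          rcases Finset.mem_insert.1 hg' with rfl | hgG'
        · exact absurd rfl hne
        · intro hd
          exact hG g' hgG' (hi.associated_of_dvd (h1 g' hgG') hd).symm.dvd
        · exact hG g hgG
        · exact h2 g hgG g' hgG' hne
      · rw [Finset.sum_insert hiG]; omega
      · rw [map_mul, mul_eq_zero, h4 x]
        simp [Finset.mem_insert]

theorem IsLine.subset_component {m : Set (Fin 3 → ℝ)} (hm : IsLine m)
    {f : MvPolynomial (Fin 3) ℝ} {G : Finset (MvPolynomial (Fin 3) ℝ)}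
    (hG : ∀ x, eval x f = 0 ↔ ∃ g ∈ G, eval x g = 0) (hmf : m ⊆ polyZeros f) :
    ∃ g ∈ G, m ⊆ polyZeros g := by
  obtain ⟨p, v, hv, rfl⟩ := hm
  have h : restrictLine p v (∏ g ∈ G, g) = 0 := by
    rw [restrictLine_eq_zero_iff]
    intro t
    have : eval (p + t • v) f = 0 := hmf ⟨t, rfl⟩
    obtain ⟨g, hg, h0⟩ := (hG _).1 this
    rw [map_prod]
    exact Finset.prod_eq_zero hg h0
  rw [map_prod, Finset.prod_eq_zero_iff] at h
  obtain ⟨g, hg, h0⟩ := h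
  refine ⟨g, hg, ?_⟩
  rintro x ⟨t, rfl⟩
  exact (restrictLine_eq_zero_iff p v g).1 h0 t

end Components

section Hitting

/-- The points of `P` on `m` that lie on a line of `T`. -/
noncomputable def hitPoints (P : Finset (Fin 3 → ℝ)) (T : Finset (Set (Fin 3 → ℝ)))
    (m : Set (Fin 3 → ℝ)) : Finset (Fin 3 → ℝ) :=
  P.filter fun x => x ∈ m ∧ ∃ l ∈ T, x ∈ l

theorem sum_unhit_le {L : Finset (Set (Fin 3 → ℝ))} {P : Finset (Fin 3 → ℝ)} {k : ℕ} (hk : 2 ≤ k)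
    (hP : ∀ x ∈ P, k ≤ (L.filter fun l => x ∈ l).card) (m : Set (Fin 3 → ℝ))
    (U : Finset (Fin 3 → ℝ)) (hU : U ⊆ P) :
    k * U.card ≤ 2 * ∑ l ∈ L.filter (fun l => l ≠ m), (U.filter fun x => x ∈ l).card := by
  have hswap : ∑ l ∈ L.filter (fun l => l ≠ m), (U.filter fun x => x ∈ l).card =
      ∑ x ∈ U, ((L.filter fun l => l ≠ m).filter fun l => x ∈ l).card :=
    Finset.sum_card_bipartiteAbove_eq_sum_card_bipartiteBelow (fun l x => x ∈ l)
  rw [hswap, Finset.mul_sum, mul_comm, ← smul_eq_mul]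
  refine Finset.card_nsmul_le_sum _ _ _ fun x hx => ?_
  have h1 := hP x (hU hx)
  have h2 : (L.filter fun l => x ∈ l).card ≤
      ((L.filter fun l => l ≠ m).filter fun l => x ∈ l).card + 1 := by
    have : (L.filter fun l => x ∈ l) ⊆
        insert m ((L.filter fun l => l ≠ m).filter fun l => x ∈ l) := by
      intro l hl
      simp only [Finset.mem_filter, Finset.mem_insert] at hl ⊢
      tauto
    exact (Finset.card_le_card this).trans (Finset.card_insert_le _ _)
  omega

/-- Greedy choice of few lines meeting many of the lines of `M` in many points of `P`. -/
theorem exists_hitting_lines {L M : Finset (Set (Fin 3 → ℝ))} {P : Finset (Fin 3 → ℝ)}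
    (hL : ∀ l ∈ L, IsLine l) (hML : M ⊆ L) {k s D : ℕ} (hk : 2 ≤ k) (hD : 2 * D ≤ s)
    (hP : ∀ x ∈ P, k ≤ (L.filter fun l => x ∈ l).card)
    (hM : ∀ m ∈ M, s ≤ (P.filter fun x => x ∈ m).card) (n : ℕ) :
    ∃ T ⊆ L, T.card ≤ n ∧ (2 * (M.filter fun m => (hitPoints P T m).card < D).card < M.card ∨
      n * M.card * (k * s) ≤ 8 * L.card * ∑ m ∈ M, min (hitPoints P T m).card D) := by
  induction n with
  | zero => exact ⟨∅, by simp, by simp, Or.inr (by simp)⟩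
  | succ n ih =>
    obtain ⟨T, hTL, hTn, h | h⟩ := ih
    · exact ⟨T, hTL, by omega, Or.inl h⟩
    by_cases hB : 2 * (M.filter fun m => (hitPoints P T m).card < D).card < M.card
    · exact ⟨T, hTL, by omega, Or.inl hB⟩
    push Not at hB
    set B := M.filter fun m => (hitPoints P T m).card < D with hBdef
    let U : Set (Fin 3 → ℝ) → Finset (Fin 3 → ℝ) :=
      fun m => P.filter fun x => x ∈ m ∧ ¬ ∃ l ∈ T, x ∈ l
    have hUcard : ∀ m ∈ B, s ≤ 2 * (U m).card := by
      intro m hm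
      rw [hBdef, Finset.mem_filter] at hm
      have h1 := hM m hm.1
      have h2 := Finset.card_filter_add_card_filter_not (s := P.filter fun x => x ∈ m)
        (fun x => ∃ l ∈ T, x ∈ l)
      simp only [Finset.filter_filter] at h2
      have h3 := hm.2
      simp only [hitPoints] at h3
      simp only [U]
      omega
    let gain : Set (Fin 3 → ℝ) → ℕ :=
      fun l => ∑ m ∈ B, if l ≠ m then ((U m).filter fun x => x ∈ l).card else 0
    have hsum : M.card * (k * s) ≤ 8 * ∑ l ∈ L, gain l := by
      have h1 : ∑ l ∈ L, gain l =
          ∑ m ∈ B, ∑ l ∈ L.filter (fun l => l ≠ m), ((U m).filter fun x => x ∈ l).card := by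
        simp only [gain]
        rw [Finset.sum_comm]
        exact Finset.sum_congr rfl fun m _ => (Finset.sum_filter _ _).symm
      have h2 : B.card * (k * s) ≤ 4 * ∑ l ∈ L, gain l := by
        rw [h1, Finset.mul_sum, ← smul_eq_mul]
        refine Finset.card_nsmul_le_sum _ _ _ fun m hm => ?_
        have h3 := sum_unhit_le hk hP m (U m) (Finset.filter_subset _ _)
        have h4 := Nat.mul_le_mul_left k (hUcard m hm)
        nlinarith
      nlinarith [Nat.mul_le_mul_right (k * s) hB]
    rcases L.eq_empty_or_nonempty with hL0 | hL0
    · have hM0 : M = ∅ := Finset.subset_empty.1 (hL0 ▸ hML)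
      exact ⟨T, hTL, by omega, Or.inr (by simp [hM0])⟩
    obtain ⟨l, hl, hgain⟩ : ∃ l ∈ L, M.card * (k * s) ≤ 8 * L.card * gain l := by
      by_contra hcon
      push Not at hcon
      have h1 : ∑ l ∈ L, 8 * L.card * gain l < ∑ l ∈ L, M.card * (k * s) :=
        Finset.sum_lt_sum_of_nonempty hL0 hcon
      rw [← Finset.mul_sum, Finset.sum_const, smul_eq_mul] at h1
      nlinarith [Nat.mul_le_mul_left L.card hsum]
    refine ⟨insert l T, Finset.insert_subset hl hTL, (Finset.card_insert_le _ _).trans (by omega),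
      Or.inr ?_⟩
    have hstep : ∑ m ∈ M, min (hitPoints P T m).card D + gain l ≤
        ∑ m ∈ M, min (hitPoints P (insert l T) m).card D := by
      simp only [gain, hBdef]
      rw [Finset.sum_filter, ← Finset.sum_add_distrib]
      refine Finset.sum_le_sum fun m hm => ?_
      have hmono : (hitPoints P T m).card ≤ (hitPoints P (insert l T) m).card := by
        refine Finset.card_le_card fun x hx => ?_
        simp only [hitPoints, Finset.mem_filter, Finset.mem_insert] at hx ⊢
        obtain ⟨h1, h2, l', h3, h4⟩ := hx
        exact ⟨h1, h2, l', Or.inr h3, h4⟩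
      split_ifs with h1 h2
      · have hone : ((U m).filter fun x => x ∈ l).card ≤ 1 := by
          refine le_trans (Finset.card_le_card fun x hx => ?_)
            (card_filter_mem_inter_le_one (hL l hl) (hL m (hML hm)) h2 P)
          simp only [U, Finset.mem_filter] at hx ⊢
          tauto
        have hadd : (hitPoints P T m).card + ((U m).filter fun x => x ∈ l).card ≤
            (hitPoints P (insert l T) m).card := by
          rw [← Finset.card_union_of_disjoint]
          · refine Finset.card_le_card fun x hx => ?_
            simp only [U, hitPoints, Finset.mem_union, Finset.mem_filter, Finset.mem_insert]
              at hx ⊢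
            rcases hx with ⟨h1, h2, l', h3, h4⟩ | ⟨⟨h1, h2, -⟩, h3⟩
            · exact ⟨h1, h2, l', Or.inr h3, h4⟩
            · exact ⟨h1, h2, l, Or.inl rfl, h3⟩
          · rw [Finset.disjoint_left]
            intro x hx hx'
            simp only [U, hitPoints, Finset.mem_filter] at hx hx'
            exact hx'.1.2.2 hx.2.2
        omega
      · omega
      · omega
    nlinarith [Nat.mul_le_mul_left (8 * L.card) hstep]

end Hitting

section RichSurface

open MvPolynomial

theorem mul_le_two_mul_card_of_rich {L : Finset (Set (Fin 3 → ℝ))} {P : Finset (Fin 3 → ℝ)}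
    (hL : ∀ l ∈ L, IsLine l) {k s : ℕ} (hk : 2 ≤ k)
    (hP : ∀ x ∈ P, k ≤ (L.filter fun l => x ∈ l).card) {m : Set (Fin 3 → ℝ)} (hm : IsLine m)
    (hms : s ≤ (P.filter fun x => x ∈ m).card) : k * s ≤ 2 * L.card := by
  have h1 := sum_unhit_le hk hP m (P.filter fun x => x ∈ m) (Finset.filter_subset _ _)
  have h2 : ∑ l ∈ L.filter (fun l => l ≠ m), ((P.filter fun x => x ∈ m).filter
      fun x => x ∈ l).card ≤ L.card := by
    calc _ ≤ ∑ l ∈ L.filter (fun l => l ≠ m), 1 := by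
          refine Finset.sum_le_sum fun l hl => ?_
          rw [Finset.mem_filter] at hl
          rw [Finset.filter_filter]
          exact card_filter_mem_inter_le_one hm (hL l hl.1) hl.2.symm P
      _ = (L.filter fun l => l ≠ m).card := by simp
      _ ≤ L.card := Finset.card_filter_le _ _
  nlinarith [Nat.mul_le_mul_left k hms]

theorem exists_surface_of_long_lines {L M : Finset (Set (Fin 3 → ℝ))} {P : Finset (Fin 3 → ℝ)}
    (hL : ∀ l ∈ L, IsLine l) (hML : M ⊆ L) (hM0 : M.Nonempty) {k s : ℕ} (hk : 2 ≤ k)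
    (hs : 720 ≤ s) (hP : ∀ x ∈ P, k ≤ (L.filter fun l => x ∈ l).card)
    (hM : ∀ m ∈ M, s ≤ (P.filter fun x => x ∈ m).card) (hlong : 15840 * L.card ≤ s * (k * s)) :
    ∃ (f : MvPolynomial (Fin 3) ℝ) (d : ℕ), f ≠ 0 ∧ f.totalDegree ≤ d ∧ 40 * d ≤ s ∧
      d * (k * s) ≤ 396 * L.card ∧ M.card ≤ 2 * (M.filter fun m => m ⊆ polyZeros f).card := by
  obtain ⟨m₀, hm₀⟩ := hM0
  have hX := mul_le_two_mul_card_of_rich hL hk hP (hL m₀ (hML hm₀)) (hM m₀ hm₀)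
  have hMpos : 0 < M.card := Finset.card_pos.2 ⟨m₀, hm₀⟩
  have hXpos : 0 < k * s := Nat.mul_pos (by omega) (by omega)
  set X := k * s with hXdef
  set c := 128 * L.card / X with hc
  have hc1 : c * X ≤ 128 * L.card := Nat.div_mul_le_self _ _
  have hc2 : 128 * L.card < (c + 1) * X := by
    rw [hc, mul_comm _ X]; exact Nat.lt_mul_div_succ _ hXpos
  have hc64 : 64 ≤ c := (Nat.le_div_iff_mul_le hXpos).2 (by omega)
  have hdX : 3 * (c + 2) * X ≤ 396 * L.card := by nlinarith
  have hds : 40 * (3 * (c + 2)) ≤ s := by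
    refine Nat.le_of_mul_le_mul_right (?_ : _ * X ≤ s * X) hXpos
    nlinarith
  set D := 3 * (c + 2) + 1 with hD
  set e := 8 * L.card * D / X with he
  have he1 : e * X ≤ 8 * L.card * D := Nat.div_mul_le_self _ _
  have he2 : 8 * L.card * D < (e + 1) * X := by
    rw [he, mul_comm _ X]; exact Nat.lt_mul_div_succ _ hXpos
  have he3 : 16 * e ≤ (c + 1) * D := by
    refine Nat.le_of_mul_le_mul_right (?_ : _ * X ≤ _ * X) hXpos
    nlinarith [Nat.mul_le_mul_right D hc2.le]
  obtain ⟨T, hTL, hTn, hT⟩ := exists_hitting_lines hL hML hk (by omega : 2 * D ≤ s) hP hM (e + 1)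
  have hgood : 2 * (M.filter fun m => (hitPoints P T m).card < D).card < M.card := by
    refine hT.resolve_right fun hcon => ?_
    have h1 : ∑ m ∈ M, min (hitPoints P T m).card D ≤ M.card * D := by
      rw [← smul_eq_mul]
      exact Finset.sum_le_card_nsmul _ _ _ fun m _ => min_le_right _ _
    have h2 := Nat.mul_le_mul_left (8 * L.card) h1
    have h3 : M.card * (8 * L.card * D) < M.card * ((e + 1) * X) :=
      Nat.mul_lt_mul_of_pos_left he2 hMpos
    rw [← hXdef] at hcon
    have h4 : M.card * ((e + 1) * X) = (e + 1) * M.card * X := by ring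
    have h5 : M.card * (8 * L.card * D) = 8 * L.card * (M.card * D) := by ring
    omega
  obtain ⟨f, hf, hfdeg, hfT⟩ := exists_vanishing_on_lines (c + 2) T (fun l hl => hL l (hTL hl)) (by
    have h1 : 16 * (D * T.card) ≤ D * ((c + 1) * D + 16) := by
      nlinarith [Nat.mul_le_mul_left D hTn, Nat.mul_le_mul_left D he3]
    have h2 : D * ((c + 1) * D + 16) < 16 * (c + 2) ^ 3 := by
      rw [hD]
      ring_nf
      nlinarith [Nat.zero_le (c ^ 3), Nat.zero_le (c ^ 2), Nat.mul_le_mul_right c hc64]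
    rw [← hD]
    omega)
  refine ⟨f, 3 * (c + 2), hf, hfdeg, hds, hdX, ?_⟩
  have hsplit := Finset.card_filter_add_card_filter_not (s := M)
    (fun m => (hitPoints P T m).card < D)
  have hsub : (M.filter fun m => ¬ (hitPoints P T m).card < D).card ≤
      (M.filter fun m => m ⊆ polyZeros f).card := by
    refine Finset.card_le_card fun m hm => ?_
    rw [Finset.mem_filter] at hm ⊢
    refine ⟨hm.1, (hL m (hML hm.1)).subset_polyZeros_of_card (S := hitPoints P T m) ?_ ?_ ?_⟩
    · intro x hx
      exact (Finset.mem_filter.1 hx).2.1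
    · intro x hx
      obtain ⟨l, hl, hxl⟩ := (Finset.mem_filter.1 hx).2.2
      exact hfT l hl hxl
    · omega
  omega

theorem exists_surface_of_short_lines {L M : Finset (Set (Fin 3 → ℝ))} {P : Finset (Fin 3 → ℝ)}
    (hL : ∀ l ∈ L, IsLine l) (hML : M ⊆ L) {k s : ℕ} (hs : 720 ≤ s)
    (hPk : P.card * k ≤ 2 * s * L.card)
    (hM : ∀ m ∈ M, s ≤ (P.filter fun x => x ∈ m).card) (hshort : s * (k * s) ≤ 15840 * L.card) :
    M.card * (k * s) ^ 2 ≤ 32 * 1440 ^ 3 * L.card ^ 2 ∨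
    ∃ (f : MvPolynomial (Fin 3) ℝ) (d : ℕ), f ≠ 0 ∧ f.totalDegree ≤ d ∧ 40 * d ≤ s ∧
      d * (k * s) ≤ 396 * L.card ∧ M.card ≤ 2 * (M.filter fun m => m ⊆ polyZeros f).card := by
  obtain ⟨b, hb1, hb2⟩ : ∃ b : ℕ, 720 * 2 ^ b ≤ s ∧ s < 1440 * 2 ^ b := by
    refine ⟨Nat.log 2 (s / 720), ?_, ?_⟩
    · have := Nat.pow_log_le_self 2 (x := s / 720) (by omega)
      omega
    · have := Nat.lt_pow_succ_log_self (b := 2) (by norm_num) (s / 720)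
      rw [pow_succ] at this
      omega
  obtain ⟨f, hf, -, hdeg, h⟩ := exists_partition_rich_lines Finset.univ Finset.univ_nonempty P b
  simp only [Finset.card_univ, Fintype.card_fin] at hdeg h
  by_cases hhalf : M.card ≤ 2 * (M.filter fun m => m ⊆ polyZeros f).card
  · refine Or.inr ⟨f, 18 * 2 ^ b, hf, by omega, by omega, ?_, hhalf⟩
    have := Nat.mul_le_mul_right (k * s) hb1
    nlinarith
  · left
    have hsplit := Finset.card_filter_add_card_filter_not (s := M) (fun m => m ⊆ polyZeros f)
    have h1 := h s (M.filter fun m => ¬ m ⊆ polyZeros f) (by omega) (by omega) (fun m hm => by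
      rw [Finset.mem_filter] at hm
      exact ⟨hL m (hML hm.1), hm.2, hM m hm.1⟩)
    set A := (M.filter fun m => ¬ m ⊆ polyZeros f).card
    have hMA : M.card ≤ 2 * A := by omega
    rw [pow_mul'] at h1
    set u := 2 ^ b
    have h2 : (P.card * k) ^ 2 ≤ (2 * s * L.card) ^ 2 := Nat.pow_le_pow_left hPk 2
    have h3 : u ^ 3 * (s * A) * k ^ 2 ≤ 16 * s ^ 2 * L.card ^ 2 := by
      calc u ^ 3 * (s * A) * k ^ 2 ≤ 4 * P.card ^ 2 * k ^ 2 := Nat.mul_le_mul_right _ h1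
        _ = 4 * (P.card * k) ^ 2 := by ring
        _ ≤ 4 * (2 * s * L.card) ^ 2 := Nat.mul_le_mul_left _ h2
        _ = _ := by ring
    have h4 : s ^ 3 ≤ (1440 * u) ^ 3 := Nat.pow_le_pow_left hb2.le 3
    have h5 : s ^ 2 * (A * (k * s) ^ 2) ≤ s ^ 2 * (16 * 1440 ^ 3 * L.card ^ 2) := by
      calc s ^ 2 * (A * (k * s) ^ 2) = s ^ 3 * (s * A * k ^ 2) := by ring
        _ ≤ (1440 * u) ^ 3 * (s * A * k ^ 2) := Nat.mul_le_mul_right _ h4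
        _ = 1440 ^ 3 * (u ^ 3 * (s * A) * k ^ 2) := by ring
        _ ≤ 1440 ^ 3 * (16 * s ^ 2 * L.card ^ 2) := Nat.mul_le_mul_left _ h3
        _ = _ := by ring
    have h6 := Nat.le_of_mul_le_mul_left h5 (by positivity)
    calc M.card * (k * s) ^ 2 ≤ 2 * A * (k * s) ^ 2 := Nat.mul_le_mul_right _ hMA
      _ = 2 * (A * (k * s) ^ 2) := by ring
      _ ≤ 2 * (16 * 1440 ^ 3 * L.card ^ 2) := Nat.mul_le_mul_left _ h6
      _ = _ := by ring

end RichSurface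

section SurfaceLines

open MvPolynomial

/-- The points of `P` that lie on the component `g` of a surface and on no other component. -/
noncomputable def soloPoints (P : Finset (Fin 3 → ℝ)) (G : Finset (MvPolynomial (Fin 3) ℝ))
    (g : MvPolynomial (Fin 3) ℝ) : Finset (Fin 3 → ℝ) :=
  P.filter fun x => eval x g = 0 ∧ ∀ q ∈ G, q ≠ g → eval x q ≠ 0

/-- The lines of `M` contained in the component `g` and in no other component. -/
noncomputable def soloLines (M : Finset (Set (Fin 3 → ℝ))) (G : Finset (MvPolynomial (Fin 3) ℝ))
    (g : MvPolynomial (Fin 3) ℝ) : Finset (Set (Fin 3 → ℝ)) :=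
  M.filter fun m => m ⊆ polyZeros g ∧ ∀ g' ∈ G, g' ≠ g → ¬ m ⊆ polyZeros g'

theorem card_filter_le_soloPoints_add {m : Set (Fin 3 → ℝ)} (hm : IsLine m)
    {G : Finset (MvPolynomial (Fin 3) ℝ)} {g : MvPolynomial (Fin 3) ℝ}
    (hmg : m ⊆ polyZeros g) (hmG : ∀ g' ∈ G, g' ≠ g → ¬ m ⊆ polyZeros g')
    (P : Finset (Fin 3 → ℝ)) :
    (P.filter fun x => x ∈ m).card ≤
      ((soloPoints P G g).filter fun x => x ∈ m).card + ∑ g' ∈ G, g'.totalDegree := by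
  have hsub : (P.filter fun x => x ∈ m) ⊆ ((soloPoints P G g).filter fun x => x ∈ m) ∪
      (G.filter fun g' => g' ≠ g).biUnion fun g' => P.filter fun x => x ∈ m ∧ eval x g' = 0 := by
    intro x hx
    simp only [soloPoints, Finset.mem_union, Finset.mem_filter, Finset.mem_biUnion] at hx ⊢
    by_cases h : ∀ g' ∈ G, g' ≠ g → eval x g' ≠ 0
    · exact Or.inl ⟨⟨hx.1, hmg hx.2, h⟩, hx.2⟩
    · push Not at h
      obtain ⟨g', h1, h2, h3⟩ := h
      exact Or.inr ⟨g', ⟨h1, h2⟩, hx.1, hx.2, h3⟩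
  refine (Finset.card_le_card hsub).trans ((Finset.card_union_le _ _).trans ?_)
  refine Nat.add_le_add_left (Finset.card_biUnion_le.trans ?_) _
  calc _ ≤ ∑ g' ∈ G.filter (fun g' => g' ≠ g), g'.totalDegree := by
        refine Finset.sum_le_sum fun g' hg' => ?_
        rw [Finset.mem_filter] at hg'
        exact hm.card_filter_zero_le (hmG g' hg'.1 hg'.2) P
    _ ≤ _ := Finset.sum_le_sum_of_subset (Finset.filter_subset _ _)

theorem subset_of_mem_soloPoints {P : Finset (Fin 3 → ℝ)} {f : MvPolynomial (Fin 3) ℝ}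
    {G : Finset (MvPolynomial (Fin 3) ℝ)} (hG : ∀ x, eval x f = 0 ↔ ∃ g ∈ G, eval x g = 0)
    {g : MvPolynomial (Fin 3) ℝ} {x : Fin 3 → ℝ} (hx : x ∈ soloPoints P G g)
    {l : Set (Fin 3 → ℝ)} (hl : IsLine l) (hxl : x ∈ l) (hlf : l ⊆ polyZeros f) :
    l ⊆ polyZeros g := by
  obtain ⟨g', hg', hlg'⟩ := hl.subset_component hG hlf
  by_cases h : g' = g
  · exact h ▸ hlg'
  · exact ((Finset.mem_filter.1 hx).2.2 g' hg' h (hlg' hxl)).elim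

/-- Incidences between points of a surface and lines not contained in it. -/
theorem sum_card_transverse_le {L : Finset (Set (Fin 3 → ℝ))} (hL : ∀ l ∈ L, IsLine l)
    (f : MvPolynomial (Fin 3) ℝ) (J : Finset (Fin 3 → ℝ)) (hJ : ∀ x ∈ J, eval x f = 0) :
    ∑ x ∈ J, (L.filter fun l => x ∈ l ∧ ¬ l ⊆ polyZeros f).card ≤ L.card * f.totalDegree := by
  have hswap : ∑ x ∈ J, (L.filter fun l => x ∈ l ∧ ¬ l ⊆ polyZeros f).card =
      ∑ l ∈ L, (J.filter fun x => x ∈ l ∧ ¬ l ⊆ polyZeros f).card :=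
    Finset.sum_card_bipartiteAbove_eq_sum_card_bipartiteBelow
      (fun x l => x ∈ l ∧ ¬ l ⊆ polyZeros f)
  rw [hswap, ← smul_eq_mul]
  refine Finset.sum_le_card_nsmul _ _ _ fun l hl => ?_
  by_cases hlf : l ⊆ polyZeros f
  · simp [hlf]
  · refine le_trans (Finset.card_le_card fun x hx => ?_) ((hL l hl).card_filter_zero_le hlf J)
    rw [Finset.mem_filter] at hx ⊢
    exact ⟨hx.1, hx.2.1, hJ x hx.1⟩

theorem card_lines_two_components_le {G : Finset (MvPolynomial (Fin 3) ℝ)}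
    (hGirr : ∀ g ∈ G, Irreducible g) (hGdvd : ∀ g ∈ G, ∀ g' ∈ G, g ≠ g' → ¬ g ∣ g')
    {M : Finset (Set (Fin 3 → ℝ))} (hM : ∀ m ∈ M, IsLine m) :
    (M.filter fun m => ∃ g ∈ G, ∃ g' ∈ G, g ≠ g' ∧ m ⊆ polyZeros g ∧ m ⊆ polyZeros g').card ≤
      (∑ g ∈ G, g.totalDegree) ^ 2 := by
  have hsub : (M.filter fun m => ∃ g ∈ G, ∃ g' ∈ G, g ≠ g' ∧ m ⊆ polyZeros g ∧
      m ⊆ polyZeros g') ⊆ (G ×ˢ G).biUnion fun q =>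
        M.filter fun m => q.1 ≠ q.2 ∧ m ⊆ polyZeros q.1 ∧ m ⊆ polyZeros q.2 := by
    intro m hm
    simp only [Finset.mem_biUnion, Finset.mem_filter, Finset.mem_product, Prod.exists] at hm ⊢
    obtain ⟨h0, g, hg, g', hg', h⟩ := hm
    exact ⟨g, g', ⟨hg, hg'⟩, h0, h⟩
  refine (Finset.card_le_card hsub).trans (Finset.card_biUnion_le.trans ?_)
  rw [sq, Finset.sum_mul_sum, ← Finset.sum_product']
  refine Finset.sum_le_sum fun q hq => ?_
  rw [Finset.mem_product] at hq
  by_cases h : q.1 = q.2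
  · simp [h]
  · refine card_lines_le_of_not_dvd (hGirr _ hq.1) (hGdvd _ hq.1 _ hq.2 h) _ ?_ ?_ ?_
    · intro l hl; exact hM l (Finset.mem_filter.1 hl).1
    · intro l hl; exact (Finset.mem_filter.1 hl).2.2.1
    · intro l hl; exact (Finset.mem_filter.1 hl).2.2.2

/-- The points of `P` on `m` lying on no other line of `L` contained in the surface. -/
noncomputable def freePoints (L : Finset (Set (Fin 3 → ℝ))) (P : Finset (Fin 3 → ℝ))
    (f : MvPolynomial (Fin 3) ℝ) (m : Set (Fin 3 → ℝ)) : Finset (Fin 3 → ℝ) :=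
  P.filter fun x => x ∈ m ∧ ∀ l ∈ L, x ∈ l → l ⊆ polyZeros f → l = m

theorem card_free_lines_le {L M : Finset (Set (Fin 3 → ℝ))} (hL : ∀ l ∈ L, IsLine l)
    (hML : M ⊆ L) {P : Finset (Fin 3 → ℝ)} {k s : ℕ} (hk : 2 ≤ k)
    (hP : ∀ x ∈ P, k ≤ (L.filter fun l => x ∈ l).card) {f : MvPolynomial (Fin 3) ℝ}
    (hM : ∀ m ∈ M, m ⊆ polyZeros f ∧ s ≤ 3 * (freePoints L P f m).card) :
    M.card * (k * s) ≤ 6 * (L.card * f.totalDegree) := by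
  have hdisj : Set.PairwiseDisjoint (M : Set (Set (Fin 3 → ℝ))) (freePoints L P f) := by
    intro m hm m' hm' hne
    rw [Function.onFun, Finset.disjoint_left]
    intro x hx hx'
    simp only [freePoints, Finset.mem_filter] at hx hx'
    exact hne (hx'.2.2 m (hML hm) hx.2.1 (hM m hm).1)
  have h1 := sum_card_transverse_le hL f (M.biUnion (freePoints L P f)) (by
    intro x hx
    rw [Finset.mem_biUnion] at hx
    obtain ⟨m, hm, hx⟩ := hx
    exact (hM m hm).1 (Finset.mem_filter.1 hx).2.1)
  rw [Finset.sum_biUnion hdisj] at h1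
  refine le_trans ?_ (Nat.mul_le_mul_left 6 h1)
  rw [Finset.mul_sum, ← smul_eq_mul]
  refine Finset.card_nsmul_le_sum _ _ _ fun m hm => ?_
  have h2 : (freePoints L P f m).card * k ≤
      2 * ∑ x ∈ freePoints L P f m, (L.filter fun l => x ∈ l ∧ ¬ l ⊆ polyZeros f).card := by
    rw [Finset.mul_sum, ← smul_eq_mul]
    refine Finset.card_nsmul_le_sum _ _ _ fun x hx => ?_
    simp only [freePoints, Finset.mem_filter] at hx
    have h3 := hP x hx.1
    have h4 : (L.filter fun l => x ∈ l) ⊆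
        insert m (L.filter fun l => x ∈ l ∧ ¬ l ⊆ polyZeros f) := by
      intro l hl
      simp only [Finset.mem_filter, Finset.mem_insert] at hl ⊢
      by_cases h : l ⊆ polyZeros f
      · exact Or.inl (hx.2.2 l hl.1 hl.2 h)
      · exact Or.inr ⟨hl.1, hl.2, h⟩
    have h5 := (Finset.card_le_card h4).trans (Finset.card_insert_le _ _)
    omega
  nlinarith [Nat.mul_le_mul_left k (hM m hm).2]

/-- Non-free lines on a component of degree at least three. -/
theorem card_nonfree_lines_le {L M : Finset (Set (Fin 3 → ℝ))} (hL : ∀ l ∈ L, IsLine l)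
    (hML : M ⊆ L) {P : Finset (Fin 3 → ℝ)} {s : ℕ} {f : MvPolynomial (Fin 3) ℝ}
    {G : Finset (MvPolynomial (Fin 3) ℝ)} (hG : ∀ x, eval x f = 0 ↔ ∃ g ∈ G, eval x g = 0)
    {g : MvPolynomial (Fin 3) ℝ} (hgG : g ∈ G) (hg : Irreducible g) (hdeg : 3 ≤ g.totalDegree)
    (hs : 40 * ∑ g' ∈ G, g'.totalDegree ≤ s)
    (hM : ∀ m ∈ M, s ≤ (P.filter fun x => x ∈ m).card)
    (hfree : ∀ m ∈ M, 3 * (freePoints L P f m).card < s) :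
    (soloLines M G g).card ≤ 12 * g.totalDegree ^ 2 := by
  refine card_lines_le_of_double_points hg hdeg _ fun m hm => ?_
  rw [soloLines, Finset.mem_filter] at hm
  obtain ⟨hmM, hmg, hmG⟩ := hm
  have hmline := hL m (hML hmM)
  refine ⟨hmline, hmg, ((soloPoints P G g).filter fun x => x ∈ m) \ freePoints L P f m, ?_, ?_⟩
  · have h1 := card_filter_le_soloPoints_add hmline hmg hmG P
    have h2 := hM m hmM
    have h3 := hfree m hmM
    have h4 := Finset.le_card_sdiff (freePoints L P f m)
      ((soloPoints P G g).filter fun x => x ∈ m)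
    have h5 : g.totalDegree ≤ ∑ g' ∈ G, g'.totalDegree :=
      Finset.single_le_sum (f := fun g' => totalDegree g') (fun _ _ => Nat.zero_le _) hgG
    omega
  · intro x hx
    rw [Finset.mem_sdiff, Finset.mem_filter] at hx
    obtain ⟨⟨hxs, hxm⟩, hxf⟩ := hx
    refine ⟨hxm, ?_⟩
    simp only [freePoints, Finset.mem_filter, not_and] at hxf
    have := hxf (Finset.mem_filter.1 hxs).1 hxm
    push Not at this
    obtain ⟨l, hl, hxl, hlf, hlm⟩ := this
    exact ⟨l, hL l hl, hlm, hxl, subset_of_mem_soloPoints hG hxs (hL l hl) hxl hlf⟩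

end SurfaceLines

section QuadricLines

open MvPolynomial

/-- On a line of the surface, few points lie on many lines of `L` contained in the surface. -/
theorem card_filter_transverse_ge {L : Finset (Set (Fin 3 → ℝ))} (hL : ∀ l ∈ L, IsLine l)
    {P : Finset (Fin 3 → ℝ)} {k s : ℕ} (hk : 2 ≤ k)
    (hP : ∀ x ∈ P, k ≤ (L.filter fun l => x ∈ l).card) {g : MvPolynomial (Fin 3) ℝ}
    (hc : 32 * (L.filter fun l => l ⊆ polyZeros g).card ≤ k * s)
    {m : Set (Fin 3 → ℝ)} (hm : IsLine m) (hms : s ≤ (P.filter fun x => x ∈ m).card) :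
    7 * s ≤ 8 * ((P.filter fun x => x ∈ m).filter fun x =>
      k ≤ 4 * (L.filter fun l => x ∈ l ∧ ¬ l ⊆ polyZeros g).card).card := by
  set H := (P.filter fun x => x ∈ m).filter fun x =>
    ¬ k ≤ 4 * (L.filter fun l => x ∈ l ∧ ¬ l ⊆ polyZeros g).card with hH
  have hsplit := Finset.card_filter_add_card_filter_not (s := P.filter fun x => x ∈ m)
    (fun x => k ≤ 4 * (L.filter fun l => x ∈ l ∧ ¬ l ⊆ polyZeros g).card)
  rw [← hH] at hsplit
  set B := L.filter fun l => l ⊆ polyZeros g ∧ l ≠ m with hB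
  have hBcard : B.card ≤ (L.filter fun l => l ⊆ polyZeros g).card := by
    refine Finset.card_le_card fun l hl => ?_
    rw [hB, Finset.mem_filter] at hl
    exact Finset.mem_filter.2 ⟨hl.1, hl.2.1⟩
  have h1 : H.card * k ≤ 4 * ∑ x ∈ H, (B.filter fun l => x ∈ l).card := by
    rw [Finset.mul_sum, ← smul_eq_mul]
    refine Finset.card_nsmul_le_sum _ _ _ fun x hx => ?_
    rw [hH, Finset.mem_filter, Finset.mem_filter] at hx
    have h2 := hP x hx.1.1
    have h3 : (L.filter fun l => x ∈ l) ⊆ insert m ((B.filter fun l => x ∈ l) ∪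
        L.filter fun l => x ∈ l ∧ ¬ l ⊆ polyZeros g) := by
      intro l hl
      simp only [hB, Finset.mem_filter, Finset.mem_insert, Finset.mem_union] at hl ⊢
      tauto
    have h4 := (Finset.card_le_card h3).trans (Finset.card_insert_le _ _)
    have h5 := Finset.card_union_le (B.filter fun l => x ∈ l)
      (L.filter fun l => x ∈ l ∧ ¬ l ⊆ polyZeros g)
    have h6 := hx.2
    omega
  have h2 : ∑ x ∈ H, (B.filter fun l => x ∈ l).card ≤ B.card := by
    have hswap : ∑ x ∈ H, (B.filter fun l => x ∈ l).card =
        ∑ l ∈ B, (H.filter fun x => x ∈ l).card :=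
      Finset.sum_card_bipartiteAbove_eq_sum_card_bipartiteBelow (fun x l => x ∈ l)
    rw [hswap, Finset.card_eq_sum_ones]
    refine Finset.sum_le_sum fun l hl => ?_
    rw [hB, Finset.mem_filter] at hl
    refine le_trans (Finset.card_le_card fun x hx => ?_)
      (card_filter_mem_inter_le_one (hL l hl.1) hm hl.2.2 P)
    simp only [hH, Finset.mem_filter] at hx ⊢
    tauto
  have h3 : k * (8 * H.card) ≤ k * s := by nlinarith
  have h4 := Nat.le_of_mul_le_mul_left h3 (by omega)
  omega

theorem card_rich_lines_on_quadric_le {L M : Finset (Set (Fin 3 → ℝ))} (hL : ∀ l ∈ L, IsLine l)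
    (hML : M ⊆ L) {P : Finset (Fin 3 → ℝ)} {k s : ℕ} (hk : 2 ≤ k) (hs : 720 ≤ s)
    (hP : ∀ x ∈ P, k ≤ (L.filter fun l => x ∈ l).card) {g : MvPolynomial (Fin 3) ℝ}
    (hg : Irreducible g) (hdeg : g.totalDegree ≤ 2)
    (hc : 32 * (L.filter fun l => l ⊆ polyZeros g).card ≤ k * s)
    (hM : ∀ m ∈ M, m ⊆ polyZeros g ∧ s ≤ (P.filter fun x => x ∈ m).card) :
    M.card * (k * s) ^ 2 * s ≤ 884736 *
      (32 * L.card ^ 2 * g.totalDegree + 4 * L.card * (g.totalDegree * (k * s)) * s) := by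
  set J := P.filter fun x => eval x g = 0 ∧
    k ≤ 4 * (L.filter fun l => x ∈ l ∧ ¬ l ⊆ polyZeros g).card with hJ
  have hJk : J.card * k ≤ 4 * (L.card * g.totalDegree) := by
    refine le_trans ?_ (Nat.mul_le_mul_left 4 (sum_card_transverse_le hL g J ?_))
    · rw [Finset.mul_sum, ← smul_eq_mul]
      refine Finset.card_nsmul_le_sum _ _ _ fun x hx => ?_
      rw [hJ, Finset.mem_filter] at hx
      exact hx.2.2
    · intro x hx
      rw [hJ, Finset.mem_filter] at hx
      exact hx.2.1
  have hST := card_rich_lines_le_of_quadric hg hdeg (σ := s / 2) (by omega) J M (by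
    intro m hm
    refine ⟨hL m (hML hm), (hM m hm).1, ?_⟩
    have h1 := card_filter_transverse_ge hL hk hP hc (hL m (hML hm)) (hM m hm).2
    have h2 : ((P.filter fun x => x ∈ m).filter fun x =>
        k ≤ 4 * (L.filter fun l => x ∈ l ∧ ¬ l ⊆ polyZeros g).card).card ≤
          (J.filter fun x => x ∈ m).card := by
      refine Finset.card_le_card fun x hx => ?_
      simp only [hJ, Finset.mem_filter] at hx ⊢
      exact ⟨⟨hx.1.1, (hM m hm).1 hx.1.2, hx.2⟩, hx.1.2⟩
    omega)
  have hσ1 : s ^ 3 ≤ (3 * (s / 2)) ^ 3 := Nat.pow_le_pow_left (by omega) 3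
  have hσ2 : (s / 2) ^ 2 ≤ s ^ 2 := Nat.pow_le_pow_left (Nat.div_le_self _ _) 2
  generalize s / 2 = σ at *
  set n := L.card
  set e := g.totalDegree
  have h1 : (J.card * k) ^ 2 ≤ 32 * n ^ 2 * e := by
    calc (J.card * k) ^ 2 ≤ (4 * (n * e)) ^ 2 := Nat.pow_le_pow_left hJk 2
      _ = 16 * n ^ 2 * e * e := by ring
      _ ≤ 16 * n ^ 2 * e * 2 := Nat.mul_le_mul_left _ hdeg
      _ = _ := by ring
  calc M.card * (k * s) ^ 2 * s = M.card * s ^ 3 * k ^ 2 := by ring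
    _ ≤ M.card * (3 * σ) ^ 3 * k ^ 2 := by gcongr
    _ = 27 * (M.card * σ ^ 3) * k ^ 2 := by ring
    _ ≤ 27 * (32768 * (J.card ^ 2 + J.card * σ ^ 2)) * k ^ 2 := by gcongr
    _ ≤ 27 * (32768 * (J.card ^ 2 + J.card * s ^ 2)) * k ^ 2 := by gcongr
    _ = 884736 * ((J.card * k) ^ 2 + (J.card * k) * (k * s) * s) := by ring
    _ ≤ 884736 * (32 * n ^ 2 * e + 4 * (n * e) * (k * s) * s) := by gcongr
    _ = _ := by ring

end QuadricLines

section RichLinesBound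

open MvPolynomial

theorem card_rich_lines_on_surface_le {L M : Finset (Set (Fin 3 → ℝ))} (hL : ∀ l ∈ L, IsLine l)
    (hML : M ⊆ L) {P : Finset (Fin 3 → ℝ)} {k s d : ℕ} (hk : 2 ≤ k) (hs : 720 ≤ s)
    (hP : ∀ x ∈ P, k ≤ (L.filter fun l => x ∈ l).card)
    (hc : ∀ g : MvPolynomial (Fin 3) ℝ, g ≠ 0 → g.totalDegree ≤ 2 →
      32 * (L.filter fun l => l ⊆ polyZeros g).card ≤ k * s)
    {f : MvPolynomial (Fin 3) ℝ} (hf : f ≠ 0) (hfd : f.totalDegree ≤ d) (hds : 40 * d ≤ s)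
    (hdX : d * (k * s) ≤ 396 * L.card)
    (hM : ∀ m ∈ M, m ⊆ polyZeros f ∧ s ≤ (P.filter fun x => x ∈ m).card) :
    M.card * (k * s) ^ 2 ≤ 1500000000 * L.card ^ 2 := by
  obtain ⟨G, hGirr, hGdvd, hGdeg, hG⟩ := exists_irreducible_components f hf
  have hMline : ∀ m ∈ M, IsLine m := fun m hm => hL m (hML hm)
  set X := k * s with hX
  set n := L.card with hn
  set M₁ := M.filter fun m => ∃ g ∈ G, ∃ g' ∈ G, g ≠ g' ∧ m ⊆ polyZeros g ∧ m ⊆ polyZeros g'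
  set M₂ := M.filter fun m => s ≤ 3 * (freePoints L P f m).card with hM₂
  set R := M.filter fun m => 3 * (freePoints L P f m).card < s with hR
  set M₃ := (G.filter fun g => 3 ≤ g.totalDegree).biUnion fun g => soloLines R G g
  set M₄ := (G.filter fun g => g.totalDegree ≤ 2).biUnion fun g => soloLines M G g
  have hcover : M ⊆ M₁ ∪ M₂ ∪ M₃ ∪ M₄ := by
    intro m hm
    obtain ⟨g, hg, hmg⟩ := (hMline m hm).subset_component hG (hM m hm).1
    simp only [Finset.mem_union]
    by_cases h1 : m ∈ M₁
    · exact Or.inl (Or.inl (Or.inl h1))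
    by_cases h2 : s ≤ 3 * (freePoints L P f m).card
    · exact Or.inl (Or.inl (Or.inr (Finset.mem_filter.2 ⟨hm, h2⟩)))
    have hsolo : ∀ g' ∈ G, g' ≠ g → ¬ m ⊆ polyZeros g' := fun g' hg' hne hmg' =>
      h1 (Finset.mem_filter.2 ⟨hm, g', hg', g, hg, hne, hmg', hmg⟩)
    by_cases h3 : g.totalDegree ≤ 2
    · exact Or.inr (Finset.mem_biUnion.2 ⟨g, Finset.mem_filter.2 ⟨hg, h3⟩,
        Finset.mem_filter.2 ⟨hm, hmg, hsolo⟩⟩)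
    · exact Or.inl (Or.inr (Finset.mem_biUnion.2 ⟨g, Finset.mem_filter.2 ⟨hg, by omega⟩,
        Finset.mem_filter.2 ⟨Finset.mem_filter.2 ⟨hm, by omega⟩, hmg, hsolo⟩⟩))
  have hcard : M.card ≤ M₁.card + M₂.card + M₃.card + M₄.card := by
    have h1 := Finset.card_le_card hcover
    have h2 := Finset.card_union_le (M₁ ∪ M₂ ∪ M₃) M₄
    have h3 := Finset.card_union_le (M₁ ∪ M₂) M₃
    have h4 := Finset.card_union_le M₁ M₂
    omega
  have hGd : ∑ g ∈ G, g.totalDegree ≤ d := hGdeg.trans hfd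
  have hdX2 : d ^ 2 * X ^ 2 ≤ 156816 * n ^ 2 := by
    calc d ^ 2 * X ^ 2 = (d * X) ^ 2 := by ring
      _ ≤ (396 * n) ^ 2 := Nat.pow_le_pow_left hdX 2
      _ = _ := by ring
  have hb₁ : M₁.card * X ^ 2 ≤ 156816 * n ^ 2 :=
    (Nat.mul_le_mul_right _ ((card_lines_two_components_le hGirr hGdvd hMline).trans
      (Nat.pow_le_pow_left hGd 2))).trans hdX2
  have hb₂ : M₂.card * X ^ 2 ≤ 2376 * n ^ 2 := by
    have h := card_free_lines_le hL ((Finset.filter_subset _ _).trans hML) hk hP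
      (s := s) (M := M₂) (f := f) (by
        intro m hm
        rw [hM₂, Finset.mem_filter] at hm
        exact ⟨(hM m hm.1).1, hm.2⟩)
    calc M₂.card * X ^ 2 = M₂.card * X * X := by ring
      _ ≤ 6 * (n * f.totalDegree) * X := Nat.mul_le_mul_right _ h
      _ ≤ 6 * (n * d) * X := by gcongr
      _ = 6 * n * (d * X) := by ring
      _ ≤ 6 * n * (396 * n) := by gcongr
      _ = _ := by ring
  have hb₃ : M₃.card * X ^ 2 ≤ 1881792 * n ^ 2 := by
    have h : M₃.card ≤ 12 * d ^ 2 := by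
      calc M₃.card ≤ ∑ g ∈ G.filter (fun g => 3 ≤ g.totalDegree), (soloLines R G g).card :=
            Finset.card_biUnion_le
        _ ≤ ∑ g ∈ G.filter (fun g => 3 ≤ g.totalDegree), 12 * g.totalDegree ^ 2 := by
            refine Finset.sum_le_sum fun g hg => ?_
            rw [Finset.mem_filter] at hg
            refine card_nonfree_lines_le hL ((Finset.filter_subset _ _).trans hML) hG hg.1
              (hGirr g hg.1) hg.2 (by omega : 40 * ∑ g' ∈ G, g'.totalDegree ≤ s) (P := P) ?_ ?_
            · intro m hm
              exact (hM m (Finset.mem_filter.1 hm).1).2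
            · intro m hm
              exact (Finset.mem_filter.1 hm).2
        _ ≤ ∑ g ∈ G, 12 * g.totalDegree ^ 2 :=
            Finset.sum_le_sum_of_subset (Finset.filter_subset _ _)
        _ ≤ ∑ g ∈ G, 12 * (g.totalDegree * d) := by
            refine Finset.sum_le_sum fun g hg => ?_
            rw [sq]
            exact Nat.mul_le_mul_left _ (Nat.mul_le_mul_left _ ((Finset.single_le_sum
              (f := fun g' => totalDegree g') (fun _ _ => Nat.zero_le _) hg).trans hGd))
        _ = 12 * ((∑ g ∈ G, g.totalDegree) * d) := by rw [← Finset.mul_sum, Finset.sum_mul]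
        _ ≤ 12 * (d * d) := by gcongr
        _ = _ := by ring
    calc M₃.card * X ^ 2 ≤ 12 * d ^ 2 * X ^ 2 := Nat.mul_le_mul_right _ h
      _ = 12 * (d ^ 2 * X ^ 2) := by ring
      _ ≤ 12 * (156816 * n ^ 2) := by gcongr
      _ = _ := by ring
  have hb₄ : M₄.card * X ^ 2 ≤ 884736 * (1585 * n ^ 2) := by
    refine Nat.le_of_mul_le_mul_right (?_ : _ * s ≤ _ * s) (by omega)
    calc M₄.card * X ^ 2 * s
        ≤ (∑ g ∈ G.filter (fun g => g.totalDegree ≤ 2), (soloLines M G g).card) * X ^ 2 * s := by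
          gcongr; exact Finset.card_biUnion_le
      _ = ∑ g ∈ G.filter (fun g => g.totalDegree ≤ 2), (soloLines M G g).card * X ^ 2 * s := by
          rw [Finset.sum_mul, Finset.sum_mul]
      _ ≤ ∑ g ∈ G.filter (fun g => g.totalDegree ≤ 2), 884736 *
            (32 * n ^ 2 * g.totalDegree + 4 * n * (g.totalDegree * X) * s) := by
          refine Finset.sum_le_sum fun g hg => ?_
          rw [Finset.mem_filter] at hg
          refine card_rich_lines_on_quadric_le hL ((Finset.filter_subset _ _).trans hML) hk hs hP
            (hGirr g hg.1) hg.2 (hc g (hGirr g hg.1).ne_zero hg.2) ?_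
          intro m hm
          have hm := Finset.mem_filter.1 hm
          exact ⟨hm.2.1, (hM m hm.1).2⟩
      _ ≤ ∑ g ∈ G, 884736 * (32 * n ^ 2 * g.totalDegree + 4 * n * (g.totalDegree * X) * s) :=
          Finset.sum_le_sum_of_subset (Finset.filter_subset _ _)
      _ = 884736 * (32 * n ^ 2 * (∑ g ∈ G, g.totalDegree) +
            4 * n * ((∑ g ∈ G, g.totalDegree) * X) * s) := by
          rw [← Finset.mul_sum, Finset.sum_add_distrib, ← Finset.mul_sum, ← Finset.sum_mul,
            ← Finset.mul_sum, ← Finset.sum_mul]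
      _ ≤ 884736 * (32 * n ^ 2 * d + 4 * n * (d * X) * s) := by gcongr
      _ ≤ 884736 * (n ^ 2 * s + 4 * n * (396 * n) * s) := by
          have : 32 * n ^ 2 * d ≤ n ^ 2 * s := by
            calc 32 * n ^ 2 * d = n ^ 2 * (32 * d) := by ring
              _ ≤ n ^ 2 * s := Nat.mul_le_mul_left _ (by omega)
          gcongr
      _ = _ := by ring
  have := Nat.mul_le_mul_right (X ^ 2) hcard
  nlinarith

/-- The number of lines containing many points of high multiplicity. -/
theorem card_rich_lines_le {L M : Finset (Set (Fin 3 → ℝ))} (hL : ∀ l ∈ L, IsLine l)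
    (hML : M ⊆ L) {P : Finset (Fin 3 → ℝ)} {k s : ℕ} (hk : 2 ≤ k) (hs : 720 ≤ s)
    (hP : ∀ x ∈ P, k ≤ (L.filter fun l => x ∈ l).card) (hPk : P.card * k ≤ 2 * s * L.card)
    (hc : ∀ g : MvPolynomial (Fin 3) ℝ, g ≠ 0 → g.totalDegree ≤ 2 →
      32 * (L.filter fun l => l ⊆ polyZeros g).card ≤ k * s)
    (hM : ∀ m ∈ M, s ≤ (P.filter fun x => x ∈ m).card) :
    M.card * (k * s) ^ 2 ≤ 10 ^ 11 * L.card ^ 2 := by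
  rcases M.eq_empty_or_nonempty with h0 | h0
  · simp [h0]
  have hfin : (∃ (f : MvPolynomial (Fin 3) ℝ) (d : ℕ), f ≠ 0 ∧ f.totalDegree ≤ d ∧ 40 * d ≤ s ∧
      d * (k * s) ≤ 396 * L.card ∧ M.card ≤ 2 * (M.filter fun m => m ⊆ polyZeros f).card) →
      M.card * (k * s) ^ 2 ≤ 10 ^ 11 * L.card ^ 2 := by
    rintro ⟨f, d, hf, hfd, hds, hdX, hhalf⟩
    have h := card_rich_lines_on_surface_le hL ((Finset.filter_subset _ _).trans hML) hk hs hP hc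
      hf hfd hds hdX (M := M.filter fun m => m ⊆ polyZeros f) (by
        intro m hm
        rw [Finset.mem_filter] at hm
        exact ⟨hm.2, hM m hm.1⟩)
    have := Nat.mul_le_mul_right ((k * s) ^ 2) hhalf
    nlinarith
  rcases le_total (15840 * L.card) (s * (k * s)) with hcase | hcase
  · exact hfin (exists_surface_of_long_lines hL hML h0 hk hs hP hM hcase)
  · rcases exists_surface_of_short_lines hL hML hs hPk hM hcase with h | h
    · nlinarith
    · exact hfin h

end RichLinesBound

section MainClaim

open MvPolynomial

theorem sum_le_of_mul_sq_le {a : ℕ → ℕ} {s S A : ℕ} (hs : 1 ≤ s) (hsS : s ≤ S)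
    (h : ∀ j ∈ Finset.Ioc s S, a j * j ^ 2 ≤ A * s ^ 2) : ∑ j ∈ Finset.Ioc s S, a j ≤ A * s := by
  have h1 : ((∑ j ∈ Finset.Ioc s S, a j : ℕ) : ℝ) ≤ A * s := by
    have hs' : (0 : ℝ) < s := by exact_mod_cast hs
    calc ((∑ j ∈ Finset.Ioc s S, a j : ℕ) : ℝ) = ∑ j ∈ Finset.Ioc s S, (a j : ℝ) := by push_cast; rfl
      _ ≤ ∑ j ∈ Finset.Ioc s S, (A * s ^ 2 : ℝ) * ((j : ℝ) ^ 2)⁻¹ := by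
          refine Finset.sum_le_sum fun j hj => ?_
          have hj0 : (0 : ℝ) < j := by
            have := (Finset.mem_Ioc.1 hj).1
            exact_mod_cast (by omega : 0 < j)
          rw [← div_eq_mul_inv, le_div_iff₀ (by positivity)]
          exact_mod_cast h j hj
      _ = (A * s ^ 2 : ℝ) * ∑ j ∈ Finset.Ioc s S, ((j : ℝ) ^ 2)⁻¹ := by rw [Finset.mul_sum]
      _ ≤ (A * s ^ 2 : ℝ) * ((s : ℝ)⁻¹ - (S : ℝ)⁻¹) := by
          gcongr
          exact sum_Ioc_inv_sq_le_sub (by omega) hsS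
      _ ≤ (A * s ^ 2 : ℝ) * (s : ℝ)⁻¹ := by
          gcongr
          have : (0 : ℝ) ≤ (S : ℝ)⁻¹ := by positivity
          linarith
      _ = A * s := by field_simp
  exact_mod_cast h1

theorem card_mul_le_sum_incidences {L : Finset (Set (Fin 3 → ℝ))} {P : Finset (Fin 3 → ℝ)} {k : ℕ}
    (hP : ∀ x ∈ P, k ≤ (L.filter fun l => x ∈ l).card) :
    P.card * k ≤ ∑ l ∈ L, (P.filter fun x => x ∈ l).card := by
  have hswap : ∑ l ∈ L, (P.filter fun x => x ∈ l).card =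
      ∑ x ∈ P, (L.filter fun l => x ∈ l).card :=
    Finset.sum_card_bipartiteAbove_eq_sum_card_bipartiteBelow (fun l x => x ∈ l)
  rw [hswap, ← smul_eq_mul]
  exact Finset.card_nsmul_le_sum _ _ _ hP

theorem sum_incidences_le_add (L : Finset (Set (Fin 3 → ℝ))) (P : Finset (Fin 3 → ℝ)) (s : ℕ) :
    ∑ l ∈ L, (P.filter fun x => x ∈ l).card ≤ s * L.card +
      ∑ j ∈ Finset.Ioc s (s + P.card), (L.filter fun l => j ≤ (P.filter fun x => x ∈ l).card).card := by
  have hswap : ∑ j ∈ Finset.Ioc s (s + P.card),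
      (L.filter fun l => j ≤ (P.filter fun x => x ∈ l).card).card =
      ∑ l ∈ L, ((Finset.Ioc s (s + P.card)).filter
        fun j => j ≤ (P.filter fun x => x ∈ l).card).card :=
    Finset.sum_card_bipartiteAbove_eq_sum_card_bipartiteBelow
      (fun j (l : Set (Fin 3 → ℝ)) => j ≤ (P.filter fun x => x ∈ l).card)
  rw [hswap, mul_comm, ← smul_eq_mul, ← Finset.sum_const, ← Finset.sum_add_distrib]
  refine Finset.sum_le_sum fun l _ => ?_
  have h1 : (P.filter fun x => x ∈ l).card ≤ P.card := Finset.card_filter_le _ _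
  set n := (P.filter fun x => x ∈ l).card
  have h2 : (Finset.Ioc s n) ⊆ (Finset.Ioc s (s + P.card)).filter fun j => j ≤ n := by
    intro j hj
    simp only [Finset.mem_filter, Finset.mem_Ioc] at hj ⊢
    omega
  have h3 := Finset.card_le_card h2
  rw [Nat.card_Ioc] at h3
  omega

/-- The weak-type bound for lines containing at least `s` points of multiplicity at least `k`. -/
theorem card_rich_lines_mul_sq_le {L : Finset (Set (Fin 3 → ℝ))} (hL : ∀ l ∈ L, IsLine l)
    {N K : ℕ} (hcard : L.card = N ^ 2)
    (ha : ∀ x : Fin 3 → ℝ, (L.filter fun l => x ∈ l).card ≤ K * N)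
    (hc : ∀ g : MvPolynomial (Fin 3) ℝ, g ≠ 0 → g.totalDegree ≤ 2 →
      (L.filter fun l => l ⊆ polyZeros g).card ≤ K * N)
    {P : Finset (Fin 3 → ℝ)} {k : ℕ} (hk : 2 ≤ k) (hK : 1 ≤ K)
    (hP : ∀ x ∈ P, k ≤ (L.filter fun l => x ∈ l).card) {s : ℕ} (hs : 1 ≤ s) :
    (L.filter fun l => s ≤ (P.filter fun x => x ∈ l).card).card * (k * s) ^ 2 ≤
      10 ^ 11 * K ^ 2 * N ^ 4 := by
  suffices h : ∀ j s, 1 ≤ s → P.card + 1 ≤ s + j →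
      (L.filter fun l => s ≤ (P.filter fun x => x ∈ l).card).card * (k * s) ^ 2 ≤
        10 ^ 11 * K ^ 2 * N ^ 4 from h (P.card + 1) s hs (by omega)
  intro j
  induction j with
  | zero =>
    intro s _ hsP
    have : (L.filter fun l => s ≤ (P.filter fun x => x ∈ l).card) = ∅ := by
      rw [Finset.filter_eq_empty_iff]
      intro l _ hcon
      have := Finset.card_filter_le P (fun x => x ∈ l)
      omega
    simp [this]
  | succ j ih =>
    intro s hs hsP
    by_contra hcon
    push Not at hcon
    set M := L.filter fun l => s ≤ (P.filter fun x => x ∈ l).card with hM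
    have hMN : M.card ≤ N ^ 2 := hcard ▸ Finset.card_filter_le _ _
    have hMpos : 0 < M.card := by
      rcases Nat.eq_zero_or_pos M.card with h | h
      · rw [h, zero_mul] at hcon; exact absurd hcon (Nat.not_lt_zero _)
      · exact h
    have hN : 0 < N := by
      rcases Nat.eq_zero_or_pos N with h | h
      · rw [h] at hMN; omega
      · exact h
    have hX : 10 ^ 11 * K ^ 2 * N ^ 2 < (k * s) ^ 2 := by
      refine Nat.lt_of_mul_lt_mul_left (a := N ^ 2) ?_
      calc N ^ 2 * (10 ^ 11 * K ^ 2 * N ^ 2) = 10 ^ 11 * K ^ 2 * N ^ 4 := by ring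
        _ < M.card * (k * s) ^ 2 := hcon
        _ ≤ N ^ 2 * (k * s) ^ 2 := Nat.mul_le_mul_right _ hMN
    have hX' : 720 * (K * N) < k * s := by
      refine lt_of_pow_lt_pow_left₀ 2 (Nat.zero_le _) (lt_of_le_of_lt ?_ hX)
      have : 0 ≤ K ^ 2 * N ^ 2 := Nat.zero_le _
      nlinarith
    obtain ⟨m, hm⟩ := Finset.card_pos.1 hMpos
    rw [hM, Finset.mem_filter] at hm
    obtain ⟨x, hx⟩ : (P.filter fun x => x ∈ m).Nonempty := Finset.card_pos.1 (by omega)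
    have hkK : k ≤ K * N := (hP x (Finset.mem_filter.1 hx).1).trans (ha x)
    have hs720 : 720 ≤ s := by
      by_contra hlt
      push Not at hlt
      nlinarith [Nat.mul_le_mul hkK hlt.le]
    have hsum : ∑ i ∈ Finset.Ioc s (s + P.card),
        (L.filter fun l => i ≤ (P.filter fun x => x ∈ l).card).card ≤ N ^ 2 * s := by
      refine sum_le_of_mul_sq_le hs (by omega) fun i hi => ?_
      rw [Finset.mem_Ioc] at hi
      have h1 := ih i (by omega) (by omega)
      have hk2 : 0 < k ^ 2 := Nat.pow_pos (by omega)
      refine le_of_mul_le_mul_left (?_ : k ^ 2 * _ ≤ k ^ 2 * _) hk2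
      set A := (L.filter fun l => i ≤ (P.filter fun x => x ∈ l).card).card
      calc k ^ 2 * (A * i ^ 2) = A * (k * i) ^ 2 := by ring
        _ ≤ 10 ^ 11 * K ^ 2 * N ^ 4 := h1
        _ = N ^ 2 * (10 ^ 11 * K ^ 2 * N ^ 2) := by ring
        _ ≤ N ^ 2 * (k * s) ^ 2 := Nat.mul_le_mul_left _ hX.le
        _ = _ := by ring
    have hPk : P.card * k ≤ 2 * s * L.card := by
      have h1 := card_mul_le_sum_incidences hP
      have h2 := sum_incidences_le_add L P s
      rw [hcard] at h2 ⊢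
      nlinarith
    have hfin := card_rich_lines_le hL (Finset.filter_subset _ _ : M ⊆ L) hk hs720 hP hPk
      (fun g hg hd => by have := hc g hg hd; omega)
      (fun m hm => (Finset.mem_filter.1 hm).2)
    rw [hcard] at hfin
    have h1 : 10 ^ 11 * (N ^ 2) ^ 2 ≤ 10 ^ 11 * K ^ 2 * N ^ 4 := by
      have : 1 ≤ K ^ 2 := Nat.one_le_pow _ _ hK
      calc 10 ^ 11 * (N ^ 2) ^ 2 = 10 ^ 11 * 1 * N ^ 4 := by ring
        _ ≤ _ := by gcongr
    exact absurd (hfin.trans h1) (not_le.2 hcon)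

end MainClaim

section SecondMoment

/-- All points lying on at least two of finitely many lines. -/
theorem exists_finset_double_points {L : Finset (Set (Fin 3 → ℝ))} (hL : ∀ l ∈ L, IsLine l) :
    ∃ Q : Finset (Fin 3 → ℝ), ∀ l ∈ L, ∀ l' ∈ L, l' ≠ l → ∀ x ∈ l' ∩ l, x ∈ Q := by
  refine ⟨(L ×ˢ L).image fun q => if h : (q.1 ∩ q.2).Nonempty then h.some else 0, ?_⟩
  intro l hl l' hl' hne x hx
  rw [Finset.mem_image]
  refine ⟨(l', l), Finset.mem_product.2 ⟨hl', hl⟩, ?_⟩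
  have h : (l' ∩ l).Nonempty := ⟨x, hx⟩
  simp only [h, dif_pos]
  by_contra hcon
  exact hne ((hL l' hl').eq_of_mem (hL l hl) hcon h.some_mem.1 hx.1 h.some_mem.2 hx.2)

theorem card_meeting_le {L : Finset (Set (Fin 3 → ℝ))} {Q : Finset (Fin 3 → ℝ)}
    {l : Set (Fin 3 → ℝ)} (hl : l ∈ L) (hQ : ∀ l' ∈ L, l' ≠ l → ∀ x ∈ l' ∩ l, x ∈ Q) {R : ℕ}
    (hR : ∀ x, (L.filter fun l => x ∈ l).card ≤ R) :
    (L.filter fun l' => l' ≠ l ∧ (l' ∩ l).Nonempty).card ≤ ∑ k ∈ Finset.Icc 2 R,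
      ((Q.filter fun x => k ≤ (L.filter fun l' => x ∈ l').card).filter fun x => x ∈ l).card := by
  have hsub : (L.filter fun l' => l' ≠ l ∧ (l' ∩ l).Nonempty) ⊆
      (Q.filter fun x => x ∈ l).biUnion fun x => (L.filter fun l' => x ∈ l').erase l := by
    intro l' hl'
    rw [Finset.mem_filter] at hl'
    obtain ⟨h1, h2, x, hx⟩ := hl'
    simp only [Finset.mem_biUnion, Finset.mem_filter, Finset.mem_erase]
    exact ⟨x, ⟨hQ l' h1 h2 x hx, hx.2⟩, h2, h1, hx.1⟩
  have hswap : ∑ k ∈ Finset.Icc 2 R, ((Q.filter fun x => x ∈ l).filter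
      fun x => k ≤ (L.filter fun l' => x ∈ l').card).card =
      ∑ x ∈ Q.filter fun x => x ∈ l, ((Finset.Icc 2 R).filter
        fun k => k ≤ (L.filter fun l' => x ∈ l').card).card :=
    Finset.sum_card_bipartiteAbove_eq_sum_card_bipartiteBelow
      (fun k (x : Fin 3 → ℝ) => k ≤ (L.filter fun l' => x ∈ l').card)
  simp only [Finset.filter_comm (fun x => _ ≤ (L.filter fun l' => x ∈ l').card)
    (fun x : Fin 3 → ℝ => x ∈ l)]
  rw [hswap]
  refine (Finset.card_le_card hsub).trans (Finset.card_biUnion_le.trans ?_)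
  refine Finset.sum_le_sum fun x hx => ?_
  rw [Finset.mem_filter] at hx
  rw [Finset.card_erase_of_mem (Finset.mem_filter.2 ⟨hl, hx.2⟩)]
  have h1 := hR x
  set n := (L.filter fun l' => x ∈ l').card
  have h2 : Finset.Icc 2 n ⊆ (Finset.Icc 2 R).filter fun k => k ≤ n := by
    intro k hk
    simp only [Finset.mem_filter, Finset.mem_Icc] at hk ⊢
    omega
  have h3 := Finset.card_le_card h2
  rw [Nat.card_Icc] at h3
  omega

theorem sum_inv_Icc_le (n : ℕ) : ∑ j ∈ Finset.Icc 1 n, (j : ℝ)⁻¹ ≤ 1 + Real.log n := by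
  have h := harmonic_le_one_add_log n
  rw [harmonic_eq_sum_Icc] at h
  push_cast at h
  exact h

theorem sq_le_sum_Icc {n S : ℕ} (h : n ≤ S) :
    n ^ 2 ≤ ∑ j ∈ Finset.Icc 1 S, if j ≤ n then 2 * j else 0 := by
  induction n with
  | zero => simp
  | succ n ih =>
    have h1 := ih (by omega)
    have h2 : ∑ j ∈ Finset.Icc 1 S, (if j ≤ n + 1 then 2 * j else 0) =
        ∑ j ∈ Finset.Icc 1 S, (if j ≤ n then 2 * j else 0) +
          ∑ j ∈ Finset.Icc 1 S, (if j = n + 1 then 2 * j else 0) := by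
      rw [← Finset.sum_add_distrib]
      refine Finset.sum_congr rfl fun j _ => ?_
      split_ifs <;> omega
    have h3 : ∑ j ∈ Finset.Icc 1 S, (if j = n + 1 then 2 * j else 0) = 2 * (n + 1) := by
      rw [Finset.sum_ite_eq' (Finset.Icc 1 S) (n + 1) (fun j => 2 * j), if_pos]
      rw [Finset.mem_Icc]; omega
    rw [h2, h3]
    nlinarith

/-- A weak-type bound yields a second-moment bound up to a logarithm. -/
theorem sum_sq_le_of_weak_type {ι : Type*} (L : Finset ι) (a : ι → ℕ) {S : ℕ} {A : ℝ}
    (haS : ∀ l ∈ L, a l ≤ S)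
    (h : ∀ s, 1 ≤ s → ((L.filter fun l => s ≤ a l).card : ℝ) * (s : ℝ) ^ 2 ≤ A) :
    ∑ l ∈ L, (a l : ℝ) ^ 2 ≤ 2 * A * (1 + Real.log S) := by
  have hA : 0 ≤ A := le_trans (by positivity) (h 1 le_rfl)
  have h1 : ∑ l ∈ L, a l ^ 2 ≤ ∑ j ∈ Finset.Icc 1 S, (L.filter fun l => j ≤ a l).card * (2 * j) := by
    calc ∑ l ∈ L, a l ^ 2 ≤ ∑ l ∈ L, ∑ j ∈ Finset.Icc 1 S, if j ≤ a l then 2 * j else 0 :=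
          Finset.sum_le_sum fun l hl => sq_le_sum_Icc (haS l hl)
      _ = ∑ j ∈ Finset.Icc 1 S, ∑ l ∈ L, if j ≤ a l then 2 * j else 0 := Finset.sum_comm
      _ = _ := by
          refine Finset.sum_congr rfl fun j _ => ?_
          rw [← Finset.sum_filter, Finset.sum_const, smul_eq_mul]
  calc ∑ l ∈ L, (a l : ℝ) ^ 2
      ≤ ∑ j ∈ Finset.Icc 1 S, ((L.filter fun l => j ≤ a l).card : ℝ) * (2 * j) := by
        exact_mod_cast h1
    _ ≤ ∑ j ∈ Finset.Icc 1 S, 2 * A * (j : ℝ)⁻¹ := by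
        refine Finset.sum_le_sum fun j hj => ?_
        have hj1 := (Finset.mem_Icc.1 hj).1
        have hj0 : (0 : ℝ) < j := by exact_mod_cast hj1
        rw [← div_eq_mul_inv, le_div_iff₀ hj0]
        nlinarith [h j hj1]
    _ = 2 * A * ∑ j ∈ Finset.Icc 1 S, (j : ℝ)⁻¹ := by rw [Finset.mul_sum]
    _ ≤ 2 * A * (1 + Real.log S) := by
        gcongr
        exact sum_inv_Icc_le S

theorem sum_sq_sum_le {ι : Type*} (L : Finset ι) (a : ℕ → ι → ℕ) {R : ℕ} {B : ℝ}
    (h : ∀ k ∈ Finset.Icc 2 R, ∑ l ∈ L, (a k l : ℝ) ^ 2 ≤ B * ((k : ℝ) ^ 2)⁻¹) (hB : 0 ≤ B) :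
    ∑ l ∈ L, ((∑ k ∈ Finset.Icc 2 R, a k l : ℕ) : ℝ) ^ 2 ≤ B * (1 + Real.log R) ^ 2 := by
  set H := ∑ k ∈ Finset.Icc 2 R, (k : ℝ)⁻¹ with hH
  have hpos : ∀ k ∈ Finset.Icc 2 R, (0 : ℝ) < k := fun k hk => by
    have := (Finset.mem_Icc.1 hk).1
    exact_mod_cast (by omega : 0 < k)
  have hH0 : 0 ≤ H := Finset.sum_nonneg fun k _ => by positivity
  have hHle : H ≤ 1 + Real.log R := by
    refine le_trans (Finset.sum_le_sum_of_subset_of_nonneg (fun k hk => ?_) fun k _ _ => ?_)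
      (sum_inv_Icc_le R)
    · rw [Finset.mem_Icc] at hk ⊢; omega
    · positivity
  calc ∑ l ∈ L, ((∑ k ∈ Finset.Icc 2 R, a k l : ℕ) : ℝ) ^ 2
      ≤ ∑ l ∈ L, H * ∑ k ∈ Finset.Icc 2 R, (k : ℝ) * (a k l : ℝ) ^ 2 := by
        refine Finset.sum_le_sum fun l _ => ?_
        push_cast
        refine Finset.sum_sq_le_sum_mul_sum_of_sq_le_mul _ (fun k _ => by positivity)
          (fun k _ => by positivity) fun k hk => ?_
        have := (hpos k hk).ne'
        refine le_of_eq ?_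
        field_simp
    _ = H * ∑ k ∈ Finset.Icc 2 R, (k : ℝ) * ∑ l ∈ L, (a k l : ℝ) ^ 2 := by
        rw [← Finset.mul_sum, Finset.sum_comm]
        simp only [Finset.mul_sum]
    _ ≤ H * ∑ k ∈ Finset.Icc 2 R, B * (k : ℝ)⁻¹ := by
        refine mul_le_mul_of_nonneg_left (Finset.sum_le_sum fun k hk => ?_) hH0
        have hk0 := hpos k hk
        calc (k : ℝ) * ∑ l ∈ L, (a k l : ℝ) ^ 2 ≤ k * (B * ((k : ℝ) ^ 2)⁻¹) := by
              gcongr; exact h k hk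
          _ = B * (k : ℝ)⁻¹ := by field_simp
    _ = B * H ^ 2 := by rw [← Finset.mul_sum, ← hH]; ring
    _ ≤ B * (1 + Real.log R) ^ 2 := by gcongr

end SecondMoment

/-- **Second-moment Guth–Katz bound.** Fix `C₀ ≥ 1`. There is a constant `C`
(depending only on `C₀`) such that for all sufficiently large `N`, if `L` is a set of `N²`
lines in `ℝ³` with (a) no point on more than `C₀·N` lines of `L`, (b) no affine plane
containing more than `C₀·N` lines of `L`, and (c) no zero set of a nonzero polynomial of
degree at most `2` containing more than `C₀·N` lines of `L`, then, with `ν(l)` the number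
of other lines of `L` meeting `l`, one has `Σ_{l∈L} ν(l)² ≤ C·N⁴·(log N)³`. -/
theorem second_moment_line_intersections (C₀ : ℝ) (hC₀ : 1 ≤ C₀) :
    ∃ C : ℝ, 0 < C ∧ ∃ N₀ : ℕ, ∀ N : ℕ, N₀ ≤ N →
      ∀ L : Finset (Set (Fin 3 → ℝ)), L.card = N ^ 2 →
        (∀ l ∈ L, IsLine l) →
        (∀ x : Fin 3 → ℝ, ((L.filter (fun l => x ∈ l)).card : ℝ) ≤ C₀ * N) →
        (∀ π : Set (Fin 3 → ℝ), IsPlane π →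
          ((L.filter (fun l => l ⊆ π)).card : ℝ) ≤ C₀ * N) →
        (∀ f : MvPolynomial (Fin 3) ℝ, f ≠ 0 → f.totalDegree ≤ 2 →
          ((L.filter (fun l => l ⊆ {x | MvPolynomial.eval x f = 0})).card : ℝ) ≤ C₀ * N) →
        ∑ l ∈ L, ((L.filter (fun l' => l' ≠ l ∧ (l' ∩ l).Nonempty)).card : ℝ) ^ 2
          ≤ C * (N : ℝ) ^ 4 * (Real.log N) ^ 3 := by
  obtain ⟨K, hK⟩ := exists_nat_ge C₀
  have hK1 : 1 ≤ K := by exact_mod_cast hC₀.trans hK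
  have hKpos : (0 : ℝ) < K := by exact_mod_cast hK1
  refine ⟨54 * (10 ^ 11 * K ^ 2), by positivity, max 3 K, ?_⟩
  intro N hN L hcard hL ha _ hc
  have hN3 : 3 ≤ N := (le_max_left _ _).trans hN
  have hKN : K ≤ N := (le_max_right _ _).trans hN
  have hle : ∀ n : ℕ, (n : ℝ) ≤ C₀ * N → n ≤ K * N := fun n hn => by
    have : (n : ℝ) ≤ K * N := hn.trans (by gcongr)
    exact_mod_cast this
  have ha' : ∀ x : Fin 3 → ℝ, (L.filter fun l => x ∈ l).card ≤ K * N := fun x => hle _ (ha x)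
  have hc' : ∀ g : MvPolynomial (Fin 3) ℝ, g ≠ 0 → g.totalDegree ≤ 2 →
      (L.filter fun l => l ⊆ polyZeros g).card ≤ K * N := fun g h1 h2 => hle _ (hc g h1 h2)
  obtain ⟨Q, hQ⟩ := exists_finset_double_points hL
  set P : ℕ → Finset (Fin 3 → ℝ) :=
    fun k => Q.filter fun x => k ≤ (L.filter fun l' => x ∈ l').card with hPdef
  have hP : ∀ k, ∀ x ∈ P k, k ≤ (L.filter fun l => x ∈ l).card :=
    fun k x hx => (Finset.mem_filter.1 hx).2
  set a : ℕ → Set (Fin 3 → ℝ) → ℕ := fun k l => ((P k).filter fun x => x ∈ l).card with hadef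
  set B : ℝ := 10 ^ 11 * K ^ 2 * N ^ 4 with hB
  have hB0 : 0 ≤ B := by positivity
  set Λ := 1 + Real.log ((N ^ 2 : ℕ) : ℝ) with hΛ
  have hlevel : ∀ k ∈ Finset.Icc 2 (K * N),
      ∑ l ∈ L, (a k l : ℝ) ^ 2 ≤ 2 * B * Λ * ((k : ℝ) ^ 2)⁻¹ := by
    intro k hk
    have hk2 := (Finset.mem_Icc.1 hk).1
    have hk0 : (0 : ℝ) < k := by exact_mod_cast (by omega : 0 < k)
    have h := sum_sq_le_of_weak_type L (a k) (S := N ^ 2) (A := B * ((k : ℝ) ^ 2)⁻¹) (by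
      intro l hl
      have := mul_le_two_mul_card_of_rich hL hk2 (hP k) (hL l hl) le_rfl
      rw [hcard] at this
      nlinarith [Nat.mul_le_mul_right (a k l) hk2]) (by
      intro s hs
      have := card_rich_lines_mul_sq_le hL hcard ha' hc' hk2 hK1 (hP k) hs
      have h2 : ((L.filter fun l => s ≤ a k l).card : ℝ) * ((k : ℝ) * s) ^ 2 ≤ B := by
        rw [hB]; exact_mod_cast this
      rw [← div_eq_mul_inv, le_div_iff₀ (by positivity)]
      calc _ = ((L.filter fun l => s ≤ a k l).card : ℝ) * ((k : ℝ) * s) ^ 2 := by ring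
        _ ≤ B := h2)
    calc _ ≤ _ := h
      _ = _ := by rw [hΛ]; ring
  have hlogN : 1 ≤ Real.log N := by
    rw [Real.le_log_iff_exp_le (by positivity)]
    have : (3 : ℝ) ≤ N := by exact_mod_cast hN3
    linarith [Real.exp_one_lt_d9]
  have hΛle : Λ ≤ 3 * Real.log N := by
    rw [hΛ]
    push_cast
    rw [Real.log_pow]
    push_cast
    linarith
  have hΛ0 : 0 ≤ Λ := by
    have : 0 ≤ Real.log ((N ^ 2 : ℕ) : ℝ) := Real.log_natCast_nonneg _
    linarith
  have hRle : 1 + Real.log ((K * N : ℕ) : ℝ) ≤ Λ := by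
    have h1 : 0 < K * N := Nat.mul_pos hK1 (by omega)
    have h2 : K * N ≤ N ^ 2 := by rw [sq]; exact Nat.mul_le_mul_right _ hKN
    have : Real.log ((K * N : ℕ) : ℝ) ≤ Real.log ((N ^ 2 : ℕ) : ℝ) :=
      Real.log_le_log (by exact_mod_cast h1) (by exact_mod_cast h2)
    linarith
  have hR0 : 0 ≤ 1 + Real.log ((K * N : ℕ) : ℝ) := by
    have : 0 ≤ Real.log ((K * N : ℕ) : ℝ) := Real.log_natCast_nonneg _
    linarith
  calc ∑ l ∈ L, ((L.filter (fun l' => l' ≠ l ∧ (l' ∩ l).Nonempty)).card : ℝ) ^ 2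
      ≤ ∑ l ∈ L, ((∑ k ∈ Finset.Icc 2 (K * N), a k l : ℕ) : ℝ) ^ 2 := by
        refine Finset.sum_le_sum fun l hl => ?_
        have h1 := card_meeting_le hl (hQ l hl) ha'
        have h2 : ((L.filter (fun l' => l' ≠ l ∧ (l' ∩ l).Nonempty)).card : ℝ) ≤
            ((∑ k ∈ Finset.Icc 2 (K * N), a k l : ℕ) : ℝ) := by exact_mod_cast h1
        gcongr
    _ ≤ 2 * B * Λ * (1 + Real.log ((K * N : ℕ) : ℝ)) ^ 2 :=
        sum_sq_sum_le L a hlevel (by positivity)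
    _ ≤ 2 * B * (3 * Real.log N) * (3 * Real.log N) ^ 2 := by
        have := hRle.trans hΛle
        gcongr
    _ = 54 * (10 ^ 11 * K ^ 2) * (N : ℝ) ^ 4 * (Real.log N) ^ 3 := by rw [hB]; ring
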